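/- Let S be a caterpillar with k ≥ 10 vertices that is not a path, and let v_1, …, v_m be the path formed by its internal vertices. Assume either m = 2, or m ≥ 3 and the degrees of v_2 and v_{m-1} in S both equal 2. If T is a tree with radius at least 4k, then d(S,T) ≤ 1 - 10^{-3}. -/

import Mathlib

open SimpleGraph Filter

/-- The degree of a vertex, as the cardinality of its neighbour set. -/
noncomputable def ndeg {V : Type*} (G : SimpleGraph V) (v : V) : ℕ :=
  (G.neighborSet v).ncard

/-- `Z_k(G)`: the number of `k`-vertex subtrees (connected subgraphs) of `G`. -/
noncomputable def subtreeCount {V : Type*} [Fintype V] (G : SimpleGraph V) (k : ℕ) : ℕ :=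
  {s : Finset V | s.card = k ∧ (G.induce (s : Set V)).Connected}.ncard

/-- The number of embeddings (subtrees isomorphic to `S`) of a tree `S` in `G`,
counted among `k`-vertex subtrees. -/
noncomputable def embCount {V W : Type*} [Fintype V] (G : SimpleGraph V)
    (S : SimpleGraph W) (k : ℕ) : ℕ :=
  {s : Finset V | s.card = k ∧ Nonempty ((G.induce (s : Set V)) ≃g S)}.ncard

/-- The density `d(S,T)`: the number of embeddings of the `|S|`-vertex tree `S` in `T`
divided by the number of `|S|`-vertex subtrees of `T` (`0` if `T` has fewer vertices). -/
noncomputable def density {V W : Type*} [Fintype V] [Fintype W]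
    (S : SimpleGraph W) (T : SimpleGraph V) : ℝ :=
  (embCount T S (Fintype.card W) : ℝ) / (subtreeCount T (Fintype.card W) : ℝ)

/-- `max { d(S,T) : T an n-vertex tree }`. -/
noncomputable def maxDensity {W : Type*} [Fintype W] (S : SimpleGraph W) (n : ℕ) : ℝ :=
  sSup {x : ℝ | ∃ T : SimpleGraph (Fin n), T.IsTree ∧ x = density S T}

/-- The inducibility of `S`: `limsup_{n → ∞} max { d(S,T) : T an n-vertex tree }`. -/
noncomputable def inducibility {W : Type*} [Fintype W] (S : SimpleGraph W) : ℝ :=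
  Filter.limsup (maxDensity S) Filter.atTop

/-- A graph is starlike if it has at most one non-leaf vertex. -/
def IsStarlike {V : Type*} (G : SimpleGraph V) : Prop :=
  {v | ndeg G v ≠ 1}.Subsingleton

/-- A graph is pathlike if its maximum degree is at most 2. -/
def IsPathlike {V : Type*} (G : SimpleGraph V) : Prop :=
  ∀ v, ndeg G v ≤ 2

/-- The vertex set of the component of `u` in `G - v`; together with the edge `uv`, this is
the branch of `G` rooted at `v` through its neighbour `u`. -/
def branchSet {V : Type*} (G : SimpleGraph V) (v u : V) : Set V :=
  {w | ∃ p : G.Walk u w, v ∉ p.support}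

/-- The branch of `G` rooted at `v` through `u` is non-trivial if it is not a single edge. -/
def NontrivialBranch {V : Type*} (G : SimpleGraph V) (v u : V) : Prop :=
  G.Adj v u ∧ branchSet G v u ≠ {u}

/-- The branch rooted at `v` through `u` is a fork: non-trivial and isomorphic to a star in
which `v` is a leaf (all vertices of the branch other than `u` and `v` are leaves of `G`). -/
def IsFork {V : Type*} (G : SimpleGraph V) (v u : V) : Prop :=
  NontrivialBranch G v u ∧ ∀ w ∈ branchSet G v u, w ≠ u → ndeg G w = 1

/-- The order of a fork: its number of leaves other than the root. -/
noncomputable def forkOrder {V : Type*} (G : SimpleGraph V) (v u : V) : ℕ :=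
  (branchSet G v u).ncard - 1

/-- A branch is major if it is non-trivial and not a fork. -/
def IsMajor {V : Type*} (G : SimpleGraph V) (v u : V) : Prop :=
  NontrivialBranch G v u ∧ ¬ IsFork G v u

/-- A caterpillar is a tree in which every vertex is the root of at most two
non-trivial branches. -/
def IsCaterpillar {V : Type*} (G : SimpleGraph V) : Prop :=
  G.IsTree ∧ ∀ v, {u | NontrivialBranch G v u}.ncard ≤ 2

/-- A center of `G`: each branch rooted at `v` has at most `|G|/2` edges (the branch through
a neighbour `u` has `(branchSet G v u).ncard` edges). -/
def IsCenter {V : Type*} [Fintype V] (G : SimpleGraph V) (v : V) : Prop :=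
  ∀ u, G.Adj v u → 2 * (branchSet G v u).ncard ≤ Fintype.card V

/-- `v` is the root of at least three non-trivial branches. -/
def RootsThreeNontrivial {V : Type*} (G : SimpleGraph V) (v : V) : Prop :=
  3 ≤ {u | NontrivialBranch G v u}.ncard

/-- A hub of `G`: a vertex `v` that is the only vertex on the path from `v` to the nearest
center of `G` that is the root of at least three non-trivial branches.  (A vertex `w` lies on
the path from `v` to `c` iff `dist v w + dist w c = dist v c`.) -/
def IsHub {V : Type*} [Fintype V] (G : SimpleGraph V) (v : V) : Prop :=
  RootsThreeNontrivial G v ∧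
  ∃ c, IsCenter G c ∧ (∀ c', IsCenter G c' → G.dist v c ≤ G.dist v c') ∧
    ∀ w, G.dist v w + G.dist w c = G.dist v c → w ≠ v → ¬ RootsThreeNontrivial G w

open scoped Classical in
/-- The degree of `x` inside the vertex set `s`. -/
noncomputable def degIn {V : Type*} (G : SimpleGraph V) (s : Finset V) (x : V) : ℕ :=
  (s.filter (G.Adj x)).card

/-- The sum of the squares of the degrees of the subgraph induced by `s`. -/
noncomputable def sqDeg {V : Type*} (G : SimpleGraph V) (s : Finset V) : ℕ :=
  ∑ x ∈ s, degIn G s x ^ 2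

/-- The vertex set `s` induces a connected subgraph. -/
def ConnIn {V : Type*} (G : SimpleGraph V) (s : Finset V) : Prop :=
  (G.induce (s : Set V)).Connected

section Basics

variable {V : Type*} {G : SimpleGraph V}

open scoped Classical

theorem ConnIn.exists_walk {s : Finset V} (hs : ConnIn G s) {y z : V} (hy : y ∈ s) (hz : z ∈ s) :
    ∃ p : G.Walk y z, p.IsPath ∧ ∀ w ∈ p.support, w ∈ s := by
  obtain ⟨p⟩ := hs.preconnected ⟨y, hy⟩ ⟨z, hz⟩
  obtain ⟨q, hq⟩ : ∃ q : G.Walk y z, ∀ w ∈ q.support, w ∈ s := by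
    refine ⟨p.map (SimpleGraph.Embedding.induce (s : Set V)).toHom, fun w hw => ?_⟩
    have hw' := (Walk.support_map (SimpleGraph.Embedding.induce (s : Set V)).toHom p) ▸ hw
    obtain ⟨a, -, rfl⟩ := List.mem_map.1 hw'
    exact a.2
  exact ⟨q.bypass, q.bypass_isPath, fun w hw => hq w (q.support_bypass_subset_support hw)⟩

theorem ConnIn.eq_of_adj (hG : G.IsAcyclic) {s : Finset V} (hs : ConnIn G s) {x y z : V}
    (hx : x ∉ s) (hy : y ∈ s) (hz : z ∈ s) (hxy : G.Adj x y) (hxz : G.Adj x z) : y = z := by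
  obtain ⟨p, hp, hps⟩ := hs.exists_walk hy hz
  have h1 : (Walk.cons hxy p).IsPath := by
    rw [Walk.cons_isPath_iff]
    exact ⟨hp, fun h => hx (hps x h)⟩
  have h2 : (Walk.cons hxz Walk.nil).IsPath := by
    simp [hxz.ne]
  have := (hG.subsingleton_path x z).elim ⟨_, h1⟩ ⟨_, h2⟩
  have h3 : (Walk.cons hxy p).support = (Walk.cons hxz Walk.nil).support := by
    have := congrArg (fun q : G.Path x z => q.1.support) this
    simpa using this
  cases p with
  | nil => rfl
  | cons h p => simp at h3

theorem connIn_of_forall_reachable {s : Finset V} {b : V} (hb : b ∈ s)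
    (h : ∀ y (hy : y ∈ s), (G.induce (s : Set V)).Reachable ⟨b, hb⟩ ⟨y, hy⟩) : ConnIn G s := by
  have : Nonempty (s : Set V) := ⟨⟨b, hb⟩⟩
  refine ⟨fun x y => ?_⟩
  exact (h x x.2).symm.trans (h y y.2)

theorem ConnIn.nonempty {s : Finset V} (hs : ConnIn G s) : s.Nonempty := by
  obtain ⟨x⟩ := SimpleGraph.Connected.nonempty hs
  exact ⟨x.1, x.2⟩

theorem ConnIn.of_subset {s t : Finset V} (hs : ConnIn G s) (hst : s ⊆ t)
    (h : ∀ y ∈ t, y ∈ s ∨ ∃ q ∈ s, G.Adj q y) : ConnIn G t := by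
  obtain ⟨b, hb⟩ := hs.nonempty
  have key : ∀ y (hy : y ∈ s), (G.induce (t : Set V)).Reachable ⟨b, hst hb⟩ ⟨y, hst hy⟩ := by
    intro y hy
    exact (hs.preconnected ⟨b, hb⟩ ⟨y, hy⟩).map (SimpleGraph.induceHomOfLE G (s := (s : Set V))
      (s' := (t : Set V)) (by exact_mod_cast hst)).toHom
  refine connIn_of_forall_reachable (hst hb) fun y hy => ?_
  rcases h y hy with h | ⟨q, hq, hqy⟩
  · exact key y h
  · refine (key q hq).trans (SimpleGraph.Adj.reachable ?_)
    simpa using hqy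

theorem ConnIn.insert {s : Finset V} (hs : ConnIn G s) {p q : V} (hq : q ∈ s) (hqp : G.Adj q p) :
    ConnIn G (insert p s) := by
  refine hs.of_subset (Finset.subset_insert _ _) fun y hy => ?_
  rcases Finset.mem_insert.1 hy with rfl | h
  · exact Or.inr ⟨q, hq, hqp⟩
  · exact Or.inl h

theorem connIn_singleton (x : V) : ConnIn G {x} := by
  refine connIn_of_forall_reachable (b := x) (by simp) fun y hy => ?_
  have : y = x := by simpa using hy
  subst this
  exact Reachable.refl _

theorem connIn_chain {x : ℕ → V} {m : ℕ} (hx : ∀ i, 1 ≤ i → i < m → G.Adj (x i) (x (i + 1)))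
    (a : ℕ) (ha : 1 ≤ a) (n : ℕ) (hn : a + n ≤ m) :
    ConnIn G ((Finset.Icc a (a + n)).image x) := by
  induction n with
  | zero => simpa using connIn_singleton (x a)
  | succ n ih =>
    have h1 := (ih (by omega)).insert (p := x (a + n + 1)) (q := x (a + n))
      (Finset.mem_image_of_mem _ (by simp)) (hx _ (by omega) (by omega))
    convert h1 using 1
    rw [← Finset.image_insert]
    congr 1
    ext i
    simp only [Finset.mem_Icc, Finset.mem_insert]
    omega

theorem degIn_insert {s : Finset V} {p : V} (hp : p ∉ s) (y : V) :
    degIn G (insert p s) y = degIn G s y + if G.Adj y p then 1 else 0 := by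
  unfold degIn
  rw [Finset.filter_insert]
  split_ifs with h
  · rw [Finset.card_insert_of_notMem (by simp [hp])]
  · rfl

theorem degIn_insert_of_ne (hG : G.IsAcyclic) {s : Finset V} (hs : ConnIn G s) {p q : V}
    (hp : p ∉ s) (hq : q ∈ s) (hqp : G.Adj q p) {y : V} (hy : y ∈ s) (hyq : y ≠ q) :
    degIn G (insert p s) y = degIn G s y := by
  rw [degIn_insert hp, if_neg, add_zero]
  exact fun h => hyq (hs.eq_of_adj hG hp hy hq h.symm hqp.symm)

theorem degIn_insert_adj {s : Finset V} {p q : V} (hp : p ∉ s) (hqp : G.Adj q p) :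
    degIn G (insert p s) q = degIn G s q + 1 := by
  rw [degIn_insert hp, if_pos hqp]

theorem degIn_eq_one (hG : G.IsAcyclic) {s : Finset V} (hs : ConnIn G s) {p q : V}
    (hp : p ∉ s) (hq : q ∈ s) (hqp : G.Adj q p) : degIn G s p = 1 := by
  unfold degIn
  rw [Finset.card_eq_one]
  refine ⟨q, ?_⟩
  ext y
  simp only [Finset.mem_filter, Finset.mem_singleton]
  constructor
  · rintro ⟨h1, h2⟩
    exact hs.eq_of_adj hG hp h1 hq h2 hqp.symm
  · rintro rfl
    exact ⟨hq, hqp.symm⟩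

theorem degIn_insert_self (hG : G.IsAcyclic) {s : Finset V} (hs : ConnIn G s) {p q : V}
    (hp : p ∉ s) (hq : q ∈ s) (hqp : G.Adj q p) : degIn G (insert p s) p = 1 := by
  rw [degIn_insert hp, if_neg (G.loopless.irrefl p), add_zero, degIn_eq_one hG hs hp hq hqp]

theorem sqDeg_insert (hG : G.IsAcyclic) {s : Finset V} (hs : ConnIn G s) {p q : V}
    (hp : p ∉ s) (hq : q ∈ s) (hqp : G.Adj q p) :
    sqDeg G (insert p s) = sqDeg G s + 2 * degIn G s q + 2 := by
  unfold sqDeg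
  rw [Finset.sum_insert hp, degIn_insert_self hG hs hp hq hqp, ← Finset.add_sum_erase _ _ hq,
    ← Finset.add_sum_erase s _ hq, degIn_insert_adj hp hqp]
  have : ∑ x ∈ s.erase q, degIn G (insert p s) x ^ 2 = ∑ x ∈ s.erase q, degIn G s x ^ 2 := by
    refine Finset.sum_congr rfl fun y hy => ?_
    rw [degIn_insert_of_ne hG hs hp hq hqp (Finset.mem_of_mem_erase hy) (Finset.ne_of_mem_erase hy)]
  rw [this]
  ring

theorem connIn_union {B X : Finset V} (hB : ConnIn G B) {u : V} (hu : u ∈ B)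
    (hX : ∀ y ∈ X, G.Adj u y) : ConnIn G (B ∪ X) := by
  refine hB.of_subset Finset.subset_union_left fun y hy => ?_
  rcases Finset.mem_union.1 hy with h | h
  · exact Or.inl h
  · exact Or.inr ⟨u, hu, hX y h⟩

theorem degIn_union_of_ne (hG : G.IsAcyclic) {B X : Finset V} (hB : ConnIn G B) {u : V}
    (hu : u ∈ B) (hX : ∀ y ∈ X, y ∉ B ∧ G.Adj u y) {y : V} (hy : y ∈ B) (hyu : y ≠ u) :
    degIn G (B ∪ X) y = degIn G B y := by
  unfold degIn
  congr 1
  ext z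
  simp only [Finset.mem_filter, Finset.mem_union]
  constructor
  · rintro ⟨h1 | h1, h2⟩
    · exact ⟨h1, h2⟩
    · exact absurd (hB.eq_of_adj hG (hX z h1).1 hy hu h2.symm (hX z h1).2.symm) hyu
  · rintro ⟨h1, h2⟩
    exact ⟨Or.inl h1, h2⟩

theorem degIn_union_self {B X : Finset V} {u : V}
    (hX : ∀ y ∈ X, y ∉ B ∧ G.Adj u y) : degIn G (B ∪ X) u = degIn G B u + X.card := by
  unfold degIn
  rw [Finset.filter_union, Finset.card_union_of_disjoint]
  · congr 2
    exact Finset.filter_true_of_mem fun y hy => (hX y hy).2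
  · rw [Finset.disjoint_left]
    intro y h1 h2
    exact (hX y (Finset.mem_filter.1 h2).1).1 (Finset.mem_filter.1 h1).1

theorem degIn_union_mem (hG : G.IsAcyclic) {B X : Finset V} (hB : ConnIn G B) {u : V}
    (hu : u ∈ B) (hX : ∀ y ∈ X, y ∉ B ∧ G.Adj u y) {x : V} (hx : x ∈ X) :
    degIn G (B ∪ X) x = 1 := by
  have h1 : B ∪ X = insert x (B ∪ X.erase x) := by
    ext z
    simp only [Finset.mem_union, Finset.mem_insert, Finset.mem_erase]
    by_cases hz : z = x
    · subst hz; simp [hx]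
    · simp [hz]
  rw [h1]
  refine degIn_insert_self hG (connIn_union hB hu fun y hy =>
    (hX y (Finset.mem_of_mem_erase hy)).2) ?_ (Finset.mem_union_left _ hu) (hX x hx).2
  simp [(hX x hx).1]

theorem sqDeg_union (hG : G.IsAcyclic) {B X : Finset V} (hB : ConnIn G B) {u : V}
    (hu : u ∈ B) (hX : ∀ y ∈ X, y ∉ B ∧ G.Adj u y) :
    sqDeg G (B ∪ X) = sqDeg G B + X.card ^ 2 + X.card + 2 * degIn G B u * X.card := by
  induction X using Finset.induction_on with
  | empty => simp
  | insert x X hx ih =>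
    have hX' : ∀ y ∈ X, y ∉ B ∧ G.Adj u y := fun y hy => hX y (Finset.mem_insert_of_mem hy)
    have h2 := hX x (Finset.mem_insert_self _ _)
    rw [Finset.union_insert, sqDeg_insert hG (connIn_union hB hu fun y hy => (hX' y hy).2)
      (by simp [hx, h2.1]) (Finset.mem_union_left _ hu) h2.2, ih hX', degIn_union_self hX',
      Finset.card_insert_of_notMem hx]
    ring

end Basics

/-- The neighbours of `u` outside `M`. -/
noncomputable def nbrOut {V : Type*} [Fintype V] (G : SimpleGraph V) (M : Finset V) (u : V) :
    Finset V :=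
  open scoped Classical in Finset.univ.filter fun y => G.Adj u y ∧ y ∉ M

/-- The vertex sets obtained from `M` by adding `j` neighbours of `u` and `l` neighbours of `w`. -/
noncomputable def extSets {V : Type*} [Fintype V] (G : SimpleGraph V) (M : Finset V) (u w : V)
    (j l : ℕ) : Finset (Finset V) :=
  open scoped Classical in
  ((nbrOut G M u).powersetCard j ×ˢ (nbrOut G M w).powersetCard l).image fun p => M ∪ p.1 ∪ p.2

/-- `M` is a caterpillar with spine `x 1, …, x m` whose end vertices are leaves and whose other
spine vertices have the prescribed degrees `d i`. -/
structure IsCore {V : Type*} (G : SimpleGraph V) (d : ℕ → ℕ) (m : ℕ) (M : Finset V)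
    (x : ℕ → V) : Prop where
  inj : Set.InjOn x (Set.Icc 1 m)
  mem : ∀ i, 1 ≤ i → i ≤ m → x i ∈ M
  adj : ∀ i, 1 ≤ i → i < m → G.Adj (x i) (x (i + 1))
  deg_first : degIn G M (x 1) = 1
  deg_last : degIn G M (x m) = 1
  deg_mid : ∀ i, 1 < i → i < m → degIn G M (x i) = d i
  cover : ∀ y ∈ M, (∃ i, 1 ≤ i ∧ i ≤ m ∧ y = x i) ∨
    (degIn G M y = 1 ∧ ∃ i, 1 < i ∧ i < m ∧ G.Adj y (x i))

/-- The set `t` is `M` together with `j` new neighbours `X` of `u` and `l` new neighbours `Y`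
of `w`. -/
structure IsExt {V : Type*} (G : SimpleGraph V) (M : Finset V) (u w : V) (j l : ℕ)
    (t X Y : Finset V) : Prop where
  left : ∀ y ∈ X, y ∉ M ∧ G.Adj u y
  right : ∀ y ∈ Y, y ∉ M ∧ G.Adj w y
  card_left : X.card = j
  card_right : Y.card = l
  mem_iff : ∀ y, y ∈ t ↔ y ∈ M ∨ y ∈ X ∨ y ∈ Y

/-- The degree sequence of the spine of a caterpillar that is not a path and whose second and
second to last spine vertices have degree two if there are at least three spine vertices. -/
structure SpineDegrees (d : ℕ → ℕ) (m : ℕ) : Prop where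
  two_le : 2 ≤ m
  first : 2 ≤ d 1
  last : 2 ≤ d m
  mid : ∀ i, 1 < i → i < m → 2 ≤ d i
  second : 3 ≤ m → d 2 = 2
  penult : 3 ≤ m → d (m - 1) = 2
  not_path : ∃ i, 1 ≤ i ∧ i ≤ m ∧ d i ≠ 2

section Core

variable {V : Type*} {G : SimpleGraph V} {d : ℕ → ℕ} {m : ℕ} {M : Finset V} {x : ℕ → V}

open scoped Classical

theorem SpineDegrees.reverse (h : SpineDegrees d m) : SpineDegrees (fun i => d (m + 1 - i)) m where
  two_le := h.two_le
  first := by simpa using h.last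
  last := by simpa using h.first
  mid i h1 h2 := h.mid _ (by omega) (by omega)
  second h3 := by
    have : m + 1 - 2 = m - 1 := by omega
    simp only [this]
    exact h.penult h3
  penult h3 := by
    have : m + 1 - (m - 1) = 2 := by omega
    simp only [this]
    exact h.second h3
  not_path := by
    obtain ⟨i, h1, h2, h3⟩ := h.not_path
    refine ⟨m + 1 - i, by omega, by omega, ?_⟩
    have : m + 1 - (m + 1 - i) = i := by omega
    simpa only [this] using h3

theorem IsCore.ne (h : IsCore G d m M x) {i j : ℕ} (h1 : 1 ≤ i) (h2 : i ≤ m) (h3 : 1 ≤ j)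
    (h4 : j ≤ m) (hij : i ≠ j) : x i ≠ x j :=
  fun h5 => hij (h.inj ⟨h1, h2⟩ ⟨h3, h4⟩ h5)

theorem IsCore.reverse (h : IsCore G d m M x) :
    IsCore G (fun i => d (m + 1 - i)) m M (fun i => x (m + 1 - i)) where
  inj i hi j hj hij := by
    simp only [Set.mem_Icc] at hi hj
    have := h.inj ⟨by omega, by omega⟩ ⟨by omega, by omega⟩ hij
    omega
  mem i h1 h2 := h.mem _ (by omega) (by omega)
  adj i h1 h2 := by
    have := h.adj (m - i) (by omega) (by omega)
    have e1 : m + 1 - (i + 1) = m - i := by omega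
    have e2 : m + 1 - i = m - i + 1 := by omega
    simp only [e1, e2]
    exact this.symm
  deg_first := by simpa using h.deg_last
  deg_last := by simpa using h.deg_first
  deg_mid i h1 h2 := h.deg_mid _ (by omega) (by omega)
  cover y hy := by
    rcases h.cover y hy with ⟨i, h1, h2, rfl⟩ | ⟨h0, i, h1, h2, h3⟩
    · refine Or.inl ⟨m + 1 - i, by omega, by omega, ?_⟩
      congr 1
      omega
    · refine Or.inr ⟨h0, m + 1 - i, by omega, by omega, ?_⟩
      have : m + 1 - (m + 1 - i) = i := by omega
      simpa only [this] using h3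

theorem IsExt.reverse {u w : V} {j l : ℕ} {t X Y : Finset V} (h : IsExt G M u w j l t X Y) :
    IsExt G M w u l j t Y X :=
  ⟨h.right, h.left, h.card_right, h.card_left, fun y => by rw [h.mem_iff]; tauto⟩

theorem IsExt.eq_union {u w : V} {j l : ℕ} {t X Y : Finset V} (h : IsExt G M u w j l t X Y) :
    t = M ∪ X ∪ Y := by
  ext y
  simp [h.mem_iff]

theorem IsCore.conn (h : IsCore G d m M x) (hm : 2 ≤ m) : ConnIn G M := by
  refine (connIn_chain h.adj 1 le_rfl (m - 1) (by omega)).of_subset ?_ fun y hy => ?_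
  · intro y hy
    obtain ⟨i, hi, rfl⟩ := Finset.mem_image.1 hy
    rw [Finset.mem_Icc] at hi
    exact h.mem i (by omega) (by omega)
  · rcases h.cover y hy with ⟨i, h1, h2, rfl⟩ | ⟨-, i, h1, h2, h3⟩
    · exact Or.inl (Finset.mem_image_of_mem _ (Finset.mem_Icc.2 (by omega)))
    · exact Or.inr ⟨x i, Finset.mem_image_of_mem _ (Finset.mem_Icc.2 (by omega)), h3.symm⟩

theorem IsCore.first_ne_last (h : IsCore G d m M x) (hm : 2 ≤ m) : x 1 ≠ x m := by
  intro h1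
  exact h.ne le_rfl (by omega) (by omega) le_rfl (by omega) h1

section Ext

variable {j l : ℕ} {t X Y : Finset V}

theorem IsExt.right_union (hG : G.IsAcyclic) (hm : 2 ≤ m) (h : IsCore G d m M x)
    (e : IsExt G M (x 1) (x m) j l t X Y) : ∀ y ∈ Y, y ∉ M ∪ X ∧ G.Adj (x m) y := by
  intro y hy
  refine ⟨?_, (e.right y hy).2⟩
  rw [Finset.mem_union]
  rintro (h1 | h1)
  · exact (e.right y hy).1 h1
  · exact h.first_ne_last hm ((h.conn hm).eq_of_adj hG (e.right y hy).1
      (h.mem 1 le_rfl (by omega)) (h.mem m (by omega) le_rfl) (e.left y h1).2.symm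
      (e.right y hy).2.symm)

theorem IsExt.conn_left (hm : 2 ≤ m) (h : IsCore G d m M x)
    (e : IsExt G M (x 1) (x m) j l t X Y) : ConnIn G (M ∪ X) :=
  connIn_union (h.conn hm) (h.mem 1 le_rfl (by omega)) fun y hy => (e.left y hy).2

theorem IsExt.conn (hm : 2 ≤ m) (h : IsCore G d m M x)
    (e : IsExt G M (x 1) (x m) j l t X Y) : ConnIn G t := by
  rw [e.eq_union]
  exact connIn_union (e.conn_left hm h)
    (Finset.mem_union_left _ (h.mem m (by omega) le_rfl)) fun y hy => (e.right y hy).2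

theorem IsExt.card (hG : G.IsAcyclic) (hm : 2 ≤ m) (h : IsCore G d m M x)
    (e : IsExt G M (x 1) (x m) j l t X Y) : t.card = M.card + j + l := by
  rw [e.eq_union, Finset.card_union_of_disjoint, Finset.card_union_of_disjoint, e.card_left,
    e.card_right]
  · rw [Finset.disjoint_right]
    exact fun y hy => (e.left y hy).1
  · rw [Finset.disjoint_right]
    exact fun y hy => (e.right_union hG hm h y hy).1

theorem IsExt.degIn_first (hG : G.IsAcyclic) (hm : 2 ≤ m) (h : IsCore G d m M x)
    (e : IsExt G M (x 1) (x m) j l t X Y) : degIn G t (x 1) = 1 + j := by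
  rw [e.eq_union, degIn_union_of_ne hG (e.conn_left hm h)
    (Finset.mem_union_left _ (h.mem m (by omega) le_rfl)) (e.right_union hG hm h)
    (Finset.mem_union_left _ (h.mem 1 le_rfl (by omega))) (h.first_ne_last hm),
    degIn_union_self e.left, h.deg_first, e.card_left]

theorem IsExt.degIn_last (hG : G.IsAcyclic) (hm : 2 ≤ m) (h : IsCore G d m M x)
    (e : IsExt G M (x 1) (x m) j l t X Y) : degIn G t (x m) = 1 + l := by
  rw [e.eq_union, degIn_union_self (e.right_union hG hm h),
    degIn_union_of_ne hG (h.conn hm) (h.mem 1 le_rfl (by omega)) e.left (h.mem m (by omega) le_rfl)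
      (h.first_ne_last hm).symm, h.deg_last, e.card_right]

theorem IsExt.degIn_of_mem (hG : G.IsAcyclic) (hm : 2 ≤ m) (h : IsCore G d m M x)
    (e : IsExt G M (x 1) (x m) j l t X Y) {y : V} (hy : y ∈ M) (h1 : y ≠ x 1) (h2 : y ≠ x m) :
    degIn G t y = degIn G M y := by
  rw [e.eq_union, degIn_union_of_ne hG (e.conn_left hm h)
    (Finset.mem_union_left _ (h.mem m (by omega) le_rfl)) (e.right_union hG hm h)
    (Finset.mem_union_left _ hy) h2,
    degIn_union_of_ne hG (h.conn hm) (h.mem 1 le_rfl (by omega)) e.left hy h1]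

theorem IsExt.degIn_right (hG : G.IsAcyclic) (hm : 2 ≤ m) (h : IsCore G d m M x)
    (e : IsExt G M (x 1) (x m) j l t X Y) {y : V} (hy : y ∈ Y) : degIn G t y = 1 := by
  rw [e.eq_union]
  exact degIn_union_mem hG (e.conn_left hm h)
    (Finset.mem_union_left _ (h.mem m (by omega) le_rfl)) (e.right_union hG hm h) hy

theorem IsExt.sqDeg_eq (hG : G.IsAcyclic) (hm : 2 ≤ m) (h : IsCore G d m M x)
    (e : IsExt G M (x 1) (x m) j l t X Y) :
    sqDeg G t = sqDeg G M + (j ^ 2 + 3 * j) + (l ^ 2 + 3 * l) := by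
  rw [e.eq_union, sqDeg_union hG (e.conn_left hm h)
    (Finset.mem_union_left _ (h.mem m (by omega) le_rfl)) (e.right_union hG hm h),
    sqDeg_union hG (h.conn hm) (h.mem 1 le_rfl (by omega)) e.left,
    degIn_union_of_ne hG (h.conn hm) (h.mem 1 le_rfl (by omega)) e.left (h.mem m (by omega) le_rfl)
      (h.first_ne_last hm).symm, h.deg_last, h.deg_first, e.card_left, e.card_right]
  ring

/-- The reversed extension of the reversed core. -/
theorem IsExt.reverse_core (e : IsExt G M (x 1) (x m) j l t X Y) :
    IsExt G M ((fun i => x (m + 1 - i)) 1) ((fun i => x (m + 1 - i)) m) l j t Y X := by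
  simpa using e.reverse

theorem IsExt.degIn_left (hG : G.IsAcyclic) (hm : 2 ≤ m) (h : IsCore G d m M x)
    (e : IsExt G M (x 1) (x m) j l t X Y) {y : V} (hy : y ∈ X) : degIn G t y = 1 :=
  e.reverse_core.degIn_right hG hm h.reverse hy

theorem IsExt.degIn_mid (hG : G.IsAcyclic) (hm : 2 ≤ m) (h : IsCore G d m M x)
    (e : IsExt G M (x 1) (x m) j l t X Y) {i : ℕ} (h1 : 1 < i) (h2 : i < m) :
    degIn G t (x i) = d i := by
  rw [e.degIn_of_mem hG hm h (h.mem i (by omega) (by omega)), h.deg_mid i h1 h2]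
  · exact h.ne (by omega) (by omega) le_rfl (by omega) (by omega)
  · exact h.ne (by omega) (by omega) (by omega) le_rfl (by omega)

/-- Every vertex of an extension is a spine vertex, a new leaf at an end of the spine, or a leaf
attached to an inner spine vertex. -/
theorem IsExt.cases (hG : G.IsAcyclic) (hm : 2 ≤ m) (h : IsCore G d m M x)
    (e : IsExt G M (x 1) (x m) j l t X Y) {y : V} (hy : y ∈ t) :
    (∃ i, 1 ≤ i ∧ i ≤ m ∧ y = x i) ∨ (degIn G t y = 1 ∧ (y ∈ X ∨ y ∈ Y ∨
      (y ∈ M ∧ ∃ i, 1 < i ∧ i < m ∧ G.Adj y (x i)))) := by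
  by_cases hs : ∃ i, 1 ≤ i ∧ i ≤ m ∧ y = x i
  · exact Or.inl hs
  right
  rcases (e.mem_iff y).1 hy with h1 | h1 | h1
  · have h2 := (h.cover y h1).resolve_left hs
    rw [e.degIn_of_mem hG hm h h1]
    · exact ⟨h2.1, Or.inr (Or.inr ⟨h1, h2.2⟩)⟩
    · rintro rfl
      exact hs ⟨1, le_rfl, by omega, rfl⟩
    · rintro rfl
      exact hs ⟨m, by omega, le_rfl, rfl⟩
  · exact ⟨e.degIn_left hG hm h h1, Or.inl h1⟩
  · exact ⟨e.degIn_right hG hm h h1, Or.inr (Or.inl h1)⟩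

theorem IsExt.mem_spine (e : IsExt G M (x 1) (x m) j l t X Y) (h : IsCore G d m M x) {i : ℕ}
    (h1 : 1 ≤ i) (h2 : i ≤ m) : x i ∈ t :=
  (e.mem_iff _).2 (Or.inl (h.mem i h1 h2))

end Ext

theorem two_le_degIn {s : Finset V} {y a b : V} (ha : a ∈ s) (hb : b ∈ s) (hab : a ≠ b)
    (h1 : G.Adj y a) (h2 : G.Adj y b) : 2 ≤ degIn G s y := by
  have : ({a, b} : Finset V) ⊆ s.filter (G.Adj y) := by
    intro z hz
    simp only [Finset.mem_insert, Finset.mem_singleton] at hz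
    rcases hz with rfl | rfl <;> simp [*]
  have h := Finset.card_le_card this
  rwa [Finset.card_pair hab] at h

theorem three_le_degIn {s : Finset V} {y a b c : V} (ha : a ∈ s) (hb : b ∈ s) (hc : c ∈ s)
    (hab : a ≠ b) (hac : a ≠ c) (hbc : b ≠ c)
    (h1 : G.Adj y a) (h2 : G.Adj y b) (h3 : G.Adj y c) : 3 ≤ degIn G s y := by
  have : ({a, b, c} : Finset V) ⊆ s.filter (G.Adj y) := by
    intro z hz
    simp only [Finset.mem_insert, Finset.mem_singleton] at hz
    rcases hz with rfl | rfl | rfl <;> simp [*]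
  have h := Finset.card_le_card this
  rwa [Finset.card_eq_three.2 ⟨a, b, c, hab, hac, hbc, rfl⟩] at h

theorem eq_of_degIn_eq_one {s : Finset V} {y a b : V} (h : degIn G s y = 1) (ha : a ∈ s)
    (hb : b ∈ s) (h1 : G.Adj y a) (h2 : G.Adj y b) : a = b := by
  by_contra hab
  have := two_le_degIn ha hb hab h1 h2
  omega

end Core

/-- The vertices of `t` that are not leaves of `t` but have at most one neighbour that is not a
leaf. -/
noncomputable def endCand {V : Type*} (G : SimpleGraph V) (t : Finset V) : Finset V :=
  open scoped Classical in
  t.filter fun x => 2 ≤ degIn G t x ∧ (t.filter fun y => G.Adj x y ∧ 2 ≤ degIn G t y).card ≤ 1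

/-- The leaves of `t` adjacent to a vertex of degree two. -/
noncomputable def leafCand {V : Type*} (G : SimpleGraph V) (t : Finset V) : Finset V :=
  open scoped Classical in
  t.filter fun x => degIn G t x = 1 ∧ ∃ y ∈ t, G.Adj x y ∧ degIn G t y = 2

/-- The triple consists of a core together with the two ends of its spine. -/
def IsCoreTriple {V : Type*} (G : SimpleGraph V) (d : ℕ → ℕ) (m : ℕ) (c : Finset V × V × V) :
    Prop :=
  ∃ x, IsCore G d m c.1 x ∧ x 1 = c.2.1 ∧ x m = c.2.2

section Fiber

variable {V : Type*} {G : SimpleGraph V} {d : ℕ → ℕ} {m : ℕ} {M : Finset V} {x : ℕ → V}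
  {j l : ℕ} {t X Y : Finset V}

open scoped Classical

theorem IsExt.eq_second (hm : 2 ≤ m) (h : IsCore G d m M x)
    {y : V} (hy : y ∈ M) (hxy : G.Adj (x 1) y) : y = x 2 :=
  eq_of_degIn_eq_one h.deg_first hy (h.mem 2 (by omega) hm) hxy (h.adj 1 le_rfl (by omega))

theorem IsExt.first_mem_endCand (hG : G.IsAcyclic) (hm : 2 ≤ m) (h : IsCore G d m M x)
    (e : IsExt G M (x 1) (x m) j l t X Y) (hj : 1 ≤ j) : x 1 ∈ endCand G t := by
  refine Finset.mem_filter.2 ⟨e.mem_spine h le_rfl (by omega), ?_, ?_⟩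
  · rw [e.degIn_first hG hm h]
    omega
  · refine (Finset.card_le_card (t := {x 2}) fun y hy => ?_).trans (by simp)
    obtain ⟨h1, h2, h3⟩ := Finset.mem_filter.1 hy
    rw [Finset.mem_singleton]
    rcases (e.mem_iff y).1 h1 with h4 | h4 | h4
    · exact IsExt.eq_second hm h h4 h2
    · have := e.degIn_left hG hm h h4
      omega
    · have := e.degIn_right hG hm h h4
      omega

theorem IsExt.last_mem_endCand (hG : G.IsAcyclic) (hm : 2 ≤ m) (h : IsCore G d m M x)
    (e : IsExt G M (x 1) (x m) j l t X Y) (hl : 1 ≤ l) : x m ∈ endCand G t := by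
  simpa using e.reverse_core.first_mem_endCand hG hm h.reverse hl

theorem IsExt.notMem_endCand (h : IsCore G d m M x)
    (e : IsExt G M (x 1) (x m) j l t X Y) {i : ℕ} (h1 : 1 < i) (h2 : i < m)
    (h3 : 2 ≤ degIn G t (x (i - 1))) (h4 : 2 ≤ degIn G t (x (i + 1))) : x i ∉ endCand G t := by
  intro h5
  have h6 := (Finset.mem_filter.1 h5).2.2
  have h7 : ({x (i - 1), x (i + 1)} : Finset V) ⊆
      t.filter fun y => G.Adj (x i) y ∧ 2 ≤ degIn G t y := by
    intro z hz
    have h8 := h.adj (i - 1) (by omega) (by omega)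
    have h9 : i - 1 + 1 = i := by omega
    rw [h9] at h8
    simp only [Finset.mem_insert, Finset.mem_singleton] at hz
    rcases hz with rfl | rfl
    · exact Finset.mem_filter.2 ⟨e.mem_spine h (by omega) (by omega), h8.symm, h3⟩
    · exact Finset.mem_filter.2 ⟨e.mem_spine h (by omega) (by omega),
        h.adj i (by omega) (by omega), h4⟩
  have h8 := Finset.card_le_card h7
  rw [Finset.card_pair (h.ne (by omega) (by omega) (by omega) (by omega) (by omega))] at h8
  omega

theorem IsExt.two_le_degIn_spine (hG : G.IsAcyclic) (hd : SpineDegrees d m)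
    (h : IsCore G d m M x) (e : IsExt G M (x 1) (x m) j l t X Y) {i : ℕ} (h1 : 1 ≤ i)
    (h2 : i ≤ m) (hi : i = 1 → 1 ≤ j) (hi' : i = m → 1 ≤ l) : 2 ≤ degIn G t (x i) := by
  have hm := hd.two_le
  by_cases h3 : i = 1
  · subst h3
    rw [e.degIn_first hG hm h]
    have := hi rfl
    omega
  by_cases h4 : i = m
  · subst h4
    rw [e.degIn_last hG hm h]
    have := hi' rfl
    omega
  rw [e.degIn_mid hG hm h (by omega) (by omega)]
  exact hd.mid i (by omega) (by omega)

theorem IsExt.endCand_subset (hG : G.IsAcyclic) (hd : SpineDegrees d m)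
    (h : IsCore G d m M x) (e : IsExt G M (x 1) (x m) j l t X Y) (hj : 1 ≤ j) :
    endCand G t ⊆ {x 1, x (if l = 0 then m - 1 else m)} := by
  have hm := hd.two_le
  intro y hy
  have hyt := (Finset.mem_filter.1 hy).1
  have hy2 := (Finset.mem_filter.1 hy).2.1
  rcases e.cases hG hm h hyt with ⟨i, h1, h2, rfl⟩ | ⟨h1, -⟩
  swap
  · omega
  by_cases h3 : i = 1
  · simp [h3]
  by_cases h4 : i = if l = 0 then m - 1 else m
  · simp [h4]
  exfalso
  by_cases h5 : i = m
  · subst h5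
    rw [e.degIn_last hG hm h] at hy2
    rw [if_neg (by omega)] at h4
    exact h4 rfl
  refine e.notMem_endCand h (by omega) (by omega) (e.two_le_degIn_spine hG hd h (by omega)
    (by omega) (fun _ => hj) (by omega)) (e.two_le_degIn_spine hG hd h (by omega) (by omega)
    (by omega) fun h6 => ?_) hy
  by_contra h7
  rw [if_pos (by omega)] at h4
  omega

theorem IsExt.last_mem_leafCand (hG : G.IsAcyclic) (hd : SpineDegrees d m) (hm : 3 ≤ m)
    (h : IsCore G d m M x) (e : IsExt G M (x 1) (x m) j 0 t X Y) : x m ∈ leafCand G t := by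
  refine Finset.mem_filter.2 ⟨e.mem_spine h (by omega) le_rfl, ?_, x (m - 1),
    e.mem_spine h (by omega) (by omega), ?_, ?_⟩
  · rw [e.degIn_last hG hd.two_le h]
  · have := h.adj (m - 1) (by omega) (by omega)
    have h9 : m - 1 + 1 = m := by omega
    rw [h9] at this
    exact this.symm
  · rw [e.degIn_mid hG hd.two_le h (by omega) (by omega), hd.penult hm]

theorem IsExt.three_le_degIn_mid (h : IsCore G d m M x)
    (e : IsExt G M (x 1) (x m) j l t X Y) {i : ℕ} (h1 : 1 < i) (h2 : i < m) {y : V} (hy : y ∈ t)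
    (hyi : ∀ i, 1 ≤ i → i ≤ m → y ≠ x i) (hadj : G.Adj y (x i)) : 3 ≤ degIn G t (x i) := by
  have h8 := h.adj (i - 1) (by omega) (by omega)
  have h9 : i - 1 + 1 = i := by omega
  rw [h9] at h8
  exact three_le_degIn hy (e.mem_spine h (i := i - 1) (by omega) (by omega))
    (e.mem_spine h (i := i + 1) (by omega) (by omega)) (hyi _ (by omega) (by omega))
    (hyi _ (by omega) (by omega)) (h.ne (by omega) (by omega) (by omega) (by omega) (by omega))
    hadj.symm h8.symm (h.adj i (by omega) (by omega))

theorem IsExt.card_leafCand_le (hG : G.IsAcyclic) (hd : SpineDegrees d m)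
    (h : IsCore G d m M x) (e : IsExt G M (x 1) (x m) j 0 t X Y) (hj : 1 ≤ j) :
    (leafCand G t).card ≤ 2 := by
  have hm := hd.two_le
  have hY : Y = ∅ := Finset.card_eq_zero.1 e.card_right
  have key : leafCand G t ⊆ insert (x m) (if j = 1 then X else ∅) := by
    intro y hy
    obtain ⟨hyt, h1, z, hz, hyz, hz2⟩ := Finset.mem_filter.1 hy
    rw [Finset.mem_insert]
    by_cases hs : ∃ i, 1 ≤ i ∧ i ≤ m ∧ y = x i
    · obtain ⟨i, h2, h3, rfl⟩ := hs
      left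
      by_contra h4
      have := e.two_le_degIn_spine hG hd h h2 h3 (fun _ => hj) fun h5 => absurd (by rw [h5]) h4
      omega
    right
    rcases ((e.cases hG hm h hyt).resolve_left hs).2 with h2 | h2 | ⟨-, i, h3, h4, h5⟩
    · have h3 := eq_of_degIn_eq_one h1 hz (e.mem_spine h le_rfl (by omega)) hyz (e.left y h2).2.symm
      rw [h3, e.degIn_first hG hm h] at hz2
      rwa [if_pos (by omega)]
    · simp [hY] at h2
    · have h6 := eq_of_degIn_eq_one h1 hz (e.mem_spine h h3.le h4.le) hyz h5
      have h7 := e.three_le_degIn_mid h h3 h4 hyt (fun i h8 h9 h10 => hs ⟨i, h8, h9, h10⟩) h5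
      rw [← h6] at h7
      omega
  refine (Finset.card_le_card key).trans ((Finset.card_insert_le _ _).trans ?_)
  split_ifs with h1
  · rw [e.card_left, h1]
  · simp

theorem IsExt.core_eq (hG : G.IsAcyclic) (hd : SpineDegrees d m)
    (h : IsCore G d m M x) (e : IsExt G M (x 1) (x m) j l t X Y)
    (hjl : 3 ≤ m ∨ (1 ≤ j ∧ 1 ≤ l)) :
    M = t.filter fun y => ¬ (degIn G t y = 1 ∧ (G.Adj (x 1) y ∨ G.Adj (x m) y)) := by
  have hm := hd.two_le
  ext y
  rw [Finset.mem_filter, e.mem_iff y]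
  constructor
  · refine fun hy => ⟨Or.inl hy, ?_⟩
    rintro ⟨h1, h2 | h2⟩
    · rw [IsExt.eq_second hm h hy h2] at h1
      have := e.two_le_degIn_spine hG hd h (i := 2) (by omega) hm (by omega) (by omega)
      omega
    · have h3 := IsExt.eq_second (x := fun i => x (m + 1 - i)) hm h.reverse hy (by simpa using h2)
      have h4 : m + 1 - 2 = m - 1 := by omega
      simp only [h4] at h3
      rw [h3] at h1
      have := e.two_le_degIn_spine hG hd h (i := m - 1) (by omega) (by omega) (by omega) (by omega)
      omega
  · rintro ⟨h1 | h1 | h1, h2⟩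
    · exact h1
    · exact absurd ⟨e.degIn_left hG hm h h1, Or.inl (e.left y h1).2⟩ h2
    · exact absurd ⟨e.degIn_right hG hm h h1, Or.inr (e.right y h1).2⟩ h2

/-- A vertex set arises as an extension of at most four cores. -/
theorem card_cores_le_four (hG : G.IsAcyclic) (hd : SpineDegrees d m)
    {F : Finset (Finset V × V × V)}
    (hF : ∀ c ∈ F, IsCoreTriple G d m c ∧ ∃ X Y, IsExt G c.1 c.2.1 c.2.2 j l t X Y)
    (hjl : (3 ≤ m ∧ 1 ≤ j + l) ∨ (1 ≤ j ∧ 1 ≤ l)) : F.card ≤ 4 := by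
  have key : ∀ A B : Finset V, (∀ c ∈ F, c.2.1 ∈ A ∧ c.2.2 ∈ B) → A.card ≤ 2 → B.card ≤ 2 →
      F.card ≤ 4 := by
    intro A B h1 h2 h3
    calc F.card ≤ (A ×ˢ B).card := by
          refine Finset.card_le_card_of_injOn (fun c => c.2) (fun c hc => ?_) ?_
          · exact Finset.mem_coe.2 (Finset.mem_product.2 (h1 c hc))
          · rintro ⟨M, u, w⟩ hc ⟨M', u', w'⟩ hc' heq
            obtain ⟨⟨x, hx, rfl, rfl⟩, X, Y, e⟩ := hF _ (Finset.mem_coe.1 hc)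
            obtain ⟨⟨x', hx', h4, h5⟩, X', Y', e'⟩ := hF _ (Finset.mem_coe.1 hc')
            simp only [Prod.mk.injEq] at heq h4 h5
            obtain ⟨rfl, rfl⟩ := heq
            have e1 := e.core_eq hG hd hx (by omega)
            rw [← h4, ← h5] at e'
            have e2 := e'.core_eq hG hd hx' (by omega)
            dsimp only at e1 e2
            rw [h4, h5, ← e1] at e2
            rw [e2]
      _ = A.card * B.card := Finset.card_product _ _
      _ ≤ 2 * 2 := Nat.mul_le_mul h2 h3
  rcases F.eq_empty_or_nonempty with h0 | ⟨c, hc⟩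
  · rw [h0]
    simp
  obtain ⟨⟨x, hx, hx1, hxm⟩, X, Y, e⟩ := hF c hc
  rw [← hx1, ← hxm] at e
  have hA : 1 ≤ j → (endCand G t).card ≤ 2 := fun hj =>
    (Finset.card_le_card (e.endCand_subset hG hd hx hj)).trans Finset.card_le_two
  have hA' : 1 ≤ l → (endCand G t).card ≤ 2 := fun hl =>
    (Finset.card_le_card (e.reverse_core.endCand_subset hG hd.reverse hx.reverse hl)).trans
      Finset.card_le_two
  have hB1 : ∀ c ∈ F, 1 ≤ j → c.2.1 ∈ endCand G t := by
    intro c hc hj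
    obtain ⟨⟨x, hx, h1, h2⟩, X, Y, e⟩ := hF c hc
    rw [← h1, ← h2] at e
    rw [← h1]
    exact e.first_mem_endCand hG hd.two_le hx hj
  have hB2 : ∀ c ∈ F, 1 ≤ l → c.2.2 ∈ endCand G t := by
    intro c hc hj
    obtain ⟨⟨x, hx, h1, h2⟩, X, Y, e⟩ := hF c hc
    rw [← h1, ← h2] at e
    rw [← h2]
    exact e.last_mem_endCand hG hd.two_le hx hj
  have hC1 : ∀ c ∈ F, 3 ≤ m → j = 0 → c.2.1 ∈ leafCand G t := by
    intro c hc hm hj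
    obtain ⟨⟨x, hx, h1, h2⟩, X, Y, e⟩ := hF c hc
    rw [← h1, ← h2] at e
    rw [← h1]
    subst hj
    simpa using e.reverse_core.last_mem_leafCand hG hd.reverse hm hx.reverse
  have hC2 : ∀ c ∈ F, 3 ≤ m → l = 0 → c.2.2 ∈ leafCand G t := by
    intro c hc hm hj
    obtain ⟨⟨x, hx, h1, h2⟩, X, Y, e⟩ := hF c hc
    rw [← h1, ← h2] at e
    rw [← h2]
    subst hj
    exact e.last_mem_leafCand hG hd hm hx
  rcases Nat.eq_zero_or_pos j with hj | hj
  · have hm : 3 ≤ m := by omega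
    have hl : 1 ≤ l := by omega
    subst hj
    exact key _ _ (fun c hc => ⟨hC1 c hc hm rfl, hB2 c hc hl⟩)
      (e.reverse_core.card_leafCand_le hG hd.reverse hx.reverse hl) (hA' hl)
  rcases Nat.eq_zero_or_pos l with hl | hl
  · have hm : 3 ≤ m := by omega
    subst hl
    exact key _ _ (fun c hc => ⟨hB1 c hc hj, hC2 c hc hm rfl⟩) (hA hj)
      (e.card_leafCand_le hG hd hx hj)
  · exact key _ _ (fun c hc => ⟨hB1 c hc hj, hB2 c hc hl⟩) (hA hj) (hA hj)

end Fiber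

/-- The sum of the distances between the vertices of `s`. -/
noncomputable def wiener {V : Type*} (G : SimpleGraph V) (s : Finset V) : ℕ :=
  ∑ u ∈ s, ∑ v ∈ s, G.dist u v

/-- `E` is a family of `k`-vertex caterpillars with spine degrees `d 1, …, d m` in the tree `G`,
and `N` contains all other connected `k`-sets. -/
structure IsFamily {V : Type*} (G : SimpleGraph V) (d : ℕ → ℕ) (m k : ℕ)
    (E N : Finset (Finset V)) : Prop where
  tree : G.IsTree
  deg : SpineDegrees d m
  decomp : ∀ s ∈ E, ∃ M x X Y, IsCore G d m M x ∧
    IsExt G M (x 1) (x m) (d 1 - 1) (d m - 1) s X Y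
  sqDeg_eq : ∀ s ∈ E, ∀ t ∈ E, sqDeg G s = sqDeg G t
  wiener_eq : ∀ s ∈ E, ∀ t ∈ E, wiener G s = wiener G t
  card_eq : ∀ s ∈ E, s.card = k
  lt_card : m + 2 < k
  mem_of_notMem : ∀ t, ConnIn G t → t.card = k → t ∉ E → t ∈ N

theorem choose_sq_le (D a : ℕ) (ha : 1 ≤ a) (haD : a < D) :
    D.choose a ^ 2 ≤ 4 * (D.choose (a - 1) * D.choose (a + 1)) := by
  obtain ⟨b, rfl⟩ : ∃ b, a = b + 1 := ⟨a - 1, by omega⟩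
  obtain ⟨p, rfl⟩ : ∃ p, D = b + 1 + (p + 1) := ⟨D - (b + 2), by omega⟩
  have h1 := Nat.choose_succ_right_eq (b + 1 + (p + 1)) b
  have h2 := Nat.choose_succ_right_eq (b + 1 + (p + 1)) (b + 1)
  have e1 : b + 1 + (p + 1) - b = p + 2 := by omega
  have e2 : b + 1 + (p + 1) - (b + 1) = p + 1 := by omega
  rw [e1] at h1
  rw [e2] at h2
  simp only [Nat.add_sub_cancel]
  set A := (b + 1 + (p + 1)).choose (b + 1)
  set A0 := (b + 1 + (p + 1)).choose b
  set A1 := (b + 1 + (p + 1)).choose (b + 1 + 1)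
  have h3 : A ^ 2 * ((b + 1) * (p + 1)) = A0 * A1 * ((p + 2) * (b + 2)) := by
    calc A ^ 2 * ((b + 1) * (p + 1)) = (A * (b + 1)) * (A * (p + 1)) := by ring
      _ = A0 * A1 * ((p + 2) * (b + 2)) := by rw [h1, ← h2]; ring
  have h4 : (p + 2) * (b + 2) ≤ 4 * ((b + 1) * (p + 1)) := by nlinarith
  refine Nat.le_of_mul_le_mul_right (c := (b + 1) * (p + 1)) ?_ (by positivity)
  rw [h3]
  calc A0 * A1 * ((p + 2) * (b + 2)) ≤ A0 * A1 * (4 * ((b + 1) * (p + 1))) :=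
        Nat.mul_le_mul_left _ h4
    _ = _ := by ring

theorem choose_mul_choose_sq_le {D D' a b : ℕ} (ha : 1 ≤ a) (hb : 1 ≤ b) (haD : a < D)
    (hbD : b < D') : (D.choose a * D'.choose b) ^ 2 ≤
      16 * ((D.choose (a + 1) * D'.choose (b - 1)) * (D.choose (a - 1) * D'.choose (b + 1))) := by
  have := Nat.mul_le_mul (choose_sq_le D a ha haD) (choose_sq_le D' b hb hbD)
  calc (D.choose a * D'.choose b) ^ 2 = D.choose a ^ 2 * D'.choose b ^ 2 := by ring
    _ ≤ _ := this
    _ = _ := by ring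

theorem choose_mul_choose_le_four {D D' a b : ℕ} (ha : 1 ≤ a) (hb : 1 ≤ b) (haD : a < D)
    (hbD : b < D') :
    D.choose a * D'.choose b ≤ 4 * (D.choose (a + 1) * D'.choose (b - 1)) ∨
    D.choose a * D'.choose b ≤ 4 * (D.choose (a - 1) * D'.choose (b + 1)) := by
  have h := choose_mul_choose_sq_le ha hb haD hbD
  by_contra! hc
  nlinarith [Nat.mul_lt_mul'' hc.1 hc.2]

theorem choose_mul_choose_le_sixteen {D D' b : ℕ} (hb : 1 ≤ b) (haD : b + 1 < D)
    (hbD : b < D') :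
    D.choose (b + 1) * D'.choose b ≤ 16 * (D.choose (b + 2) * D'.choose (b - 1)) ∨
    D.choose (b + 1) * D'.choose b ≤ 16 * (D.choose (b - 1) * D'.choose (b + 2)) := by
  have h := choose_mul_choose_sq_le (a := b + 1) (by omega) hb haD hbD
  simp only [Nat.add_sub_cancel] at h
  have hpos : 0 < D.choose (b + 1) * D'.choose b :=
    Nat.mul_pos (Nat.choose_pos haD.le) (Nat.choose_pos hbD.le)
  by_cases h1 : D.choose b * D'.choose (b + 1) ≤ D.choose (b + 1) * D'.choose b
  · left
    refine Nat.le_of_mul_le_mul_right (c := D.choose (b + 1) * D'.choose b) ?_ hpos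
    nlinarith [Nat.mul_le_mul_left (D.choose (b + 1 + 1) * D'.choose (b - 1)) h1]
  · right
    have h2 : b + 1 < D' := by
      by_contra h2
      have h3 : D' = b + 1 := by omega
      subst h3
      apply h1
      have h4 := Nat.choose_succ_right_eq D b
      simp only [Nat.choose_self, mul_one, Nat.choose_succ_self_right]
      rw [h4]
      exact Nat.le_mul_of_pos_right _ (by omega)
    have h3 := choose_mul_choose_sq_le (a := b) (b := b + 1) hb (by omega) (by omega : b < D) h2
    simp only [Nat.add_sub_cancel] at h3
    push Not at h1
    have hpos' := hpos.trans h1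
    refine Nat.le_of_mul_le_mul_right (c := D.choose b * D'.choose (b + 1)) ?_ hpos'
    nlinarith [Nat.mul_le_mul_left (D.choose b * D'.choose (b + 1)) h1.le,
      Nat.mul_le_mul_left (D.choose (b - 1) * D'.choose (b + 2)) h1.le]

section Family

variable {V : Type*} {G : SimpleGraph V} {d : ℕ → ℕ} {m k : ℕ} {M : Finset V} {x : ℕ → V}
  {j l : ℕ} {t X Y : Finset V} {E N : Finset (Finset V)}

open scoped Classical

theorem mem_nbrOut [Fintype V] {u y : V} : y ∈ nbrOut G M u ↔ G.Adj u y ∧ y ∉ M := by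
  simp [nbrOut]

theorem mem_extSets [Fintype V] {u w : V} :
    t ∈ extSets G M u w j l ↔ ∃ X Y, IsExt G M u w j l t X Y := by
  unfold extSets
  simp only [Finset.mem_image, Finset.mem_product, Finset.mem_powersetCard, Prod.exists]
  constructor
  · rintro ⟨X, Y, ⟨⟨h1, h2⟩, h3, h4⟩, rfl⟩
    exact ⟨X, Y, fun y hy => (mem_nbrOut.1 (h1 hy)).symm, fun y hy => (mem_nbrOut.1 (h3 hy)).symm,
      h2, h4, fun y => by simp⟩
  · rintro ⟨X, Y, e⟩
    exact ⟨X, Y, ⟨⟨fun y hy => mem_nbrOut.2 (e.left y hy).symm, e.card_left⟩,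
      fun y hy => mem_nbrOut.2 (e.right y hy).symm, e.card_right⟩, e.eq_union.symm⟩

theorem card_extSets [Fintype V] (hG : G.IsAcyclic) (hm : 2 ≤ m) (h : IsCore G d m M x) :
    (extSets G M (x 1) (x m) j l).card =
      (nbrOut G M (x 1)).card.choose j * (nbrOut G M (x m)).card.choose l := by
  unfold extSets
  rw [Finset.card_image_of_injOn, Finset.card_product, Finset.card_powersetCard,
    Finset.card_powersetCard]
  have hdisj : ∀ y ∈ nbrOut G M (x 1), y ∉ nbrOut G M (x m) := by
    intro y h1 h2
    rw [mem_nbrOut] at h1 h2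
    exact h.first_ne_last hm ((h.conn hm).eq_of_adj hG h1.2
      (h.mem 1 le_rfl (by omega)) (h.mem m (by omega) le_rfl) h1.1.symm h2.1.symm)
  have hfst : ∀ p ∈ (nbrOut G M (x 1)).powersetCard j ×ˢ (nbrOut G M (x m)).powersetCard l,
      (M ∪ p.1 ∪ p.2) ∩ nbrOut G M (x 1) = p.1 ∧ (M ∪ p.1 ∪ p.2) ∩ nbrOut G M (x m) = p.2 := by
    rintro ⟨X, Y⟩ hp
    simp only [Finset.mem_product, Finset.mem_powersetCard] at hp
    obtain ⟨⟨h1, -⟩, h2, -⟩ := hp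
    constructor
    · ext y
      simp only [Finset.mem_inter, Finset.mem_union]
      constructor
      · rintro ⟨(h3 | h3) | h3, h4⟩
        · exact absurd h3 (mem_nbrOut.1 h4).2
        · exact h3
        · exact absurd (h2 h3) (hdisj y h4)
      · exact fun h3 => ⟨Or.inl (Or.inr h3), h1 h3⟩
    · ext y
      simp only [Finset.mem_inter, Finset.mem_union]
      constructor
      · rintro ⟨(h3 | h3) | h3, h4⟩
        · exact absurd h3 (mem_nbrOut.1 h4).2
        · exact absurd h4 (hdisj y (h1 h3))
        · exact h3
      · exact fun h3 => ⟨Or.inr h3, h2 h3⟩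
  intro p hp q hq hpq
  dsimp only at hpq
  have h1 := hfst p hp
  have h2 := hfst q hq
  rw [hpq] at h1
  exact Prod.ext (h1.1.symm.trans h2.1) (h1.2.symm.trans h2.2)

/-- A counting lemma: groups `F c` covering `E`, each dominated by a set `T c` of targets. -/
theorem card_le_of_groups {ι α : Type*} {C : Finset ι} {F T : ι → Finset α} {E N : Finset α}
    {K D : ℕ} (hE : ∀ s ∈ E, ∃ c ∈ C, s ∈ F c) (hF : ∀ c ∈ C, (F c).card ≤ K * (T c).card)
    (hT : ∀ c ∈ C, T c ⊆ N) (hfib : ∀ t ∈ N, ∀ C' ⊆ C, (∀ c ∈ C', t ∈ T c) → C'.card ≤ D) :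
    E.card ≤ K * D * N.card := by
  calc E.card ≤ (C.biUnion F).card := by
        refine Finset.card_le_card fun s hs => ?_
        obtain ⟨c, hc, hs⟩ := hE s hs
        exact Finset.mem_biUnion.2 ⟨c, hc, hs⟩
    _ ≤ ∑ c ∈ C, (F c).card := Finset.card_biUnion_le
    _ ≤ ∑ c ∈ C, K * (T c).card := Finset.sum_le_sum hF
    _ = K * ∑ c ∈ C, (T c).card := by rw [Finset.mul_sum]
    _ = K * ∑ c ∈ C, ∑ t ∈ N, if t ∈ T c then 1 else 0 := by
        congr 1
        refine Finset.sum_congr rfl fun c hc => ?_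
        rw [← Finset.sum_filter, Finset.sum_const, smul_eq_mul, mul_one,
          Finset.filter_mem_eq_inter, Finset.inter_eq_right.2 (hT c hc)]
    _ = K * ∑ t ∈ N, (C.filter fun c => t ∈ T c).card := by
        rw [Finset.sum_comm]
        simp only [Finset.card_filter]
    _ ≤ K * ∑ t ∈ N, D := Nat.mul_le_mul_left _ (Finset.sum_le_sum fun t ht =>
        hfib t ht _ (Finset.filter_subset _ _) fun c hc => (Finset.mem_filter.1 hc).2)
    _ = K * D * N.card := by
        rw [Finset.sum_const, smul_eq_mul]
        ring

theorem IsFamily.reverse (H : IsFamily G d m k E N) :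
    IsFamily G (fun i => d (m + 1 - i)) m k E N where
  tree := H.tree
  deg := H.deg.reverse
  decomp s hs := by
    obtain ⟨M, x, X, Y, h, e⟩ := H.decomp s hs
    refine ⟨M, _, Y, X, h.reverse, ?_⟩
    simpa using e.reverse
  sqDeg_eq := H.sqDeg_eq
  wiener_eq := H.wiener_eq
  card_eq := H.card_eq
  lt_card := H.lt_card
  mem_of_notMem := H.mem_of_notMem

theorem IsFamily.mem_of_sqDeg_ne (H : IsFamily G d m k E N) {s : Finset V} (hs : s ∈ E)
    (ht : ConnIn G t) (hc : t.card = s.card) (hZ : sqDeg G t ≠ sqDeg G s) : t ∈ N :=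
  H.mem_of_notMem t ht (hc.trans (H.card_eq s hs)) fun h => hZ (H.sqDeg_eq t h s hs)

theorem IsFamily.mem_of_isExt (H : IsFamily G d m k E N) {s X' Y' : Finset V} {a b : ℕ}
    (hs : s ∈ E)
    (h : IsCore G d m M x) (e' : IsExt G M (x 1) (x m) a b s X' Y')
    (e : IsExt G M (x 1) (x m) j l t X Y) (hjl : j + l = a + b)
    (hja : j ≠ a) (hjb : j ≠ b) : t ∈ N := by
  have hm := H.deg.two_le
  have hG := H.tree.2
  refine H.mem_of_sqDeg_ne hs (e.conn hm h) ?_ ?_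
  · rw [e.card hG hm h, e'.card hG hm h]
    omega
  · rw [e.sqDeg_eq hG hm h, e'.sqDeg_eq hG hm h]
    intro h1
    have h2 : ((j : ℤ) - a) * (j - b) = 0 := by
      have hl : (l : ℤ) = a + b - j := by omega
      zify at h1
      rw [hl] at h1
      linarith
    rcases mul_eq_zero.1 h2 with h3 | h3 <;> omega

/-- The members of the family whose core has comparably many extensions with `j` and `l` instead
of `d 1 - 1` and `d m - 1` new leaves at the ends of the spine. -/
theorem IsFamily.card_le_of_choose_le [Fintype V] (H : IsFamily G d m k E N)
    {E' : Finset (Finset V)} (hE' : E' ⊆ E) {K : ℕ}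
    (hjl : j + l = (d 1 - 1) + (d m - 1)) (hja : j ≠ d 1 - 1) (hjb : j ≠ d m - 1)
    (hpos : 3 ≤ m ∨ (1 ≤ j ∧ 1 ≤ l))
    (h : ∀ s ∈ E', ∃ M x X Y, IsCore G d m M x ∧
      IsExt G M (x 1) (x m) (d 1 - 1) (d m - 1) s X Y ∧
      (nbrOut G M (x 1)).card.choose (d 1 - 1) * (nbrOut G M (x m)).card.choose (d m - 1) ≤
        K * ((nbrOut G M (x 1)).card.choose j * (nbrOut G M (x m)).card.choose l)) :
    E'.card ≤ K * 4 * N.card := by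
  have hm := H.deg.two_le
  have hG := H.tree.2
  set C : Finset (Finset V × V × V) := Finset.univ.filter fun c => IsCoreTriple G d m c ∧
    (∃ s ∈ E, s ∈ extSets G c.1 c.2.1 c.2.2 (d 1 - 1) (d m - 1)) ∧
    (nbrOut G c.1 c.2.1).card.choose (d 1 - 1) * (nbrOut G c.1 c.2.2).card.choose (d m - 1) ≤
      K * ((nbrOut G c.1 c.2.1).card.choose j * (nbrOut G c.1 c.2.2).card.choose l) with hC
  refine card_le_of_groups (C := C)
    (F := fun c => extSets G c.1 c.2.1 c.2.2 (d 1 - 1) (d m - 1))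
    (T := fun c => extSets G c.1 c.2.1 c.2.2 j l) ?_ ?_ ?_ ?_
  · intro s hs
    obtain ⟨M, x, X, Y, h1, e, h2⟩ := h s hs
    have h3 := mem_extSets.2 ⟨X, Y, e⟩
    refine ⟨(M, x 1, x m), Finset.mem_filter.2 ⟨Finset.mem_univ _, ⟨x, h1, rfl, rfl⟩,
      ⟨s, hE' hs, h3⟩, h2⟩, h3⟩
  · rintro ⟨M, u, w⟩ hc
    obtain ⟨-, ⟨x, h1, rfl, rfl⟩, -, h2⟩ := Finset.mem_filter.1 hc
    dsimp only at h1 h2 ⊢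
    rwa [card_extSets hG hm h1, card_extSets hG hm h1]
  · rintro ⟨M, u, w⟩ hc t ht
    obtain ⟨-, ⟨x, h1, rfl, rfl⟩, ⟨s, hs, hs'⟩, -⟩ := Finset.mem_filter.1 hc
    dsimp only at h1 hs' ht
    obtain ⟨X, Y, e⟩ := mem_extSets.1 ht
    obtain ⟨X', Y', e'⟩ := mem_extSets.1 hs'
    exact H.mem_of_isExt hs h1 e' e hjl hja hjb
  · intro t ht C' hC' h3
    have h1 := H.deg.first
    refine card_cores_le_four (t := t) (j := j) (l := l) hG H.deg (fun c hc => ?_) (by omega)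
    exact ⟨(Finset.mem_filter.1 (hC' hc)).2.1, mem_extSets.1 (h3 c hc)⟩

theorem IsFamily.card_le_of_loose_of_le [Fintype V] (H : IsFamily G d m k E N)
    {E' : Finset (Finset V)} (hE' : E' ⊆ E) (hle : d m ≤ d 1)
    (hpos : 3 ≤ m ∨ (3 ≤ d 1 ∧ 3 ≤ d m))
    (h : ∀ s ∈ E', ∃ M x X Y, IsCore G d m M x ∧
      IsExt G M (x 1) (x m) (d 1 - 1) (d m - 1) s X Y ∧
      d 1 - 1 < (nbrOut G M (x 1)).card ∧ d m - 1 < (nbrOut G M (x m)).card) :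
    E'.card ≤ 128 * N.card := by
  have h1 := H.deg.first
  have h2 := H.deg.last
  have key : ∀ E₁ E₂ : Finset (Finset V), (∀ s ∈ E', s ∈ E₁ ∨ s ∈ E₂) →
      E₁.card ≤ 64 * N.card → E₂.card ≤ 64 * N.card → E'.card ≤ 128 * N.card := by
    intro E₁ E₂ h3 h4 h5
    have h6 : E' ⊆ E₁ ∪ E₂ := fun s hs => Finset.mem_union.2 (h3 s hs)
    have := (Finset.card_le_card h6).trans (Finset.card_union_le _ _)
    omega
  let R : ℕ → ℕ → Finset V → Prop := fun j l s => ∃ M x X Y, IsCore G d m M x ∧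
      IsExt G M (x 1) (x m) (d 1 - 1) (d m - 1) s X Y ∧
      (nbrOut G M (x 1)).card.choose (d 1 - 1) * (nbrOut G M (x m)).card.choose (d m - 1) ≤
        16 * ((nbrOut G M (x 1)).card.choose j * (nbrOut G M (x m)).card.choose l)
  have hR : ∀ j l, j + l = (d 1 - 1) + (d m - 1) → j ≠ d 1 - 1 → j ≠ d m - 1 →
      (3 ≤ m ∨ (1 ≤ j ∧ 1 ≤ l)) → (E'.filter (R j l)).card ≤ 64 * N.card := by
    intro j l h3 h4 h5 h6
    have := H.card_le_of_choose_le (K := 16) (E' := E'.filter (R j l))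
      ((Finset.filter_subset _ _).trans hE') h3 h4 h5 h6 fun s hs => (Finset.mem_filter.1 hs).2
    linarith
  by_cases hab : d 1 = d m + 1
  · have r1 := hR (d 1) (d m - 2) (by omega) (by omega) (by omega) (by omega)
    have r2 := hR (d m - 2) (d 1) (by omega) (by omega) (by omega) (by omega)
    refine key _ _ (fun s hs => ?_) r1 r2
    obtain ⟨M, x, X, Y, h3, e, h4, h5⟩ := h s hs
    have h6 := choose_mul_choose_le_sixteen (b := d m - 1) (by omega) (D := (nbrOut G M (x 1)).card)
      (by omega) h5
    have e1 : d m - 1 + 1 = d 1 - 1 := by omega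
    have e2 : d m - 1 + 2 = d 1 := by omega
    have e3 : d m - 1 - 1 = d m - 2 := by omega
    rw [e1, e2, e3] at h6
    rcases h6 with h6 | h6
    · exact Or.inl (Finset.mem_filter.2 ⟨hs, M, x, X, Y, h3, e, h6⟩)
    · exact Or.inr (Finset.mem_filter.2 ⟨hs, M, x, X, Y, h3, e, h6⟩)
  · have r1 := hR (d 1) (d m - 2) (by omega) (by omega) (by omega) (by omega)
    have r2 := hR (d 1 - 2) (d m) (by omega) (by omega) (by omega) (by omega)
    refine key _ _ (fun s hs => ?_) r1 r2
    obtain ⟨M, x, X, Y, h3, e, h4, h5⟩ := h s hs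
    have h6 := choose_mul_choose_le_four (a := d 1 - 1) (b := d m - 1) (by omega) (by omega) h4 h5
    have e1 : d m - 1 + 1 = d m := by omega
    have e2 : d 1 - 1 + 1 = d 1 := by omega
    have e3 : d m - 1 - 1 = d m - 2 := by omega
    have e4 : d 1 - 1 - 1 = d 1 - 2 := by omega
    rw [e1, e2, e3, e4] at h6
    rcases h6 with h6 | h6
    · exact Or.inl (Finset.mem_filter.2 ⟨hs, M, x, X, Y, h3, e,
        h6.trans (Nat.mul_le_mul_right _ (by norm_num))⟩)
    · exact Or.inr (Finset.mem_filter.2 ⟨hs, M, x, X, Y, h3, e,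
        h6.trans (Nat.mul_le_mul_right _ (by norm_num))⟩)

/-- There are few members of the family such that both ends of the spine have further neighbours
in the host tree. -/
theorem IsFamily.card_le_of_loose [Fintype V] (H : IsFamily G d m k E N)
    {E' : Finset (Finset V)} (hE' : E' ⊆ E)
    (hpos : 3 ≤ m ∨ (3 ≤ d 1 ∧ 3 ≤ d m))
    (h : ∀ s ∈ E', ∃ M x X Y, IsCore G d m M x ∧
      IsExt G M (x 1) (x m) (d 1 - 1) (d m - 1) s X Y ∧
      d 1 - 1 < (nbrOut G M (x 1)).card ∧ d m - 1 < (nbrOut G M (x m)).card) :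
    E'.card ≤ 128 * N.card := by
  rcases le_total (d m) (d 1) with hle | hle
  · exact H.card_le_of_loose_of_le hE' hle hpos h
  · refine H.reverse.card_le_of_loose_of_le hE' (by simpa using hle) (by simpa [and_comm] using hpos)
      fun s hs => ?_
    obtain ⟨M, x, X, Y, h3, e, h4, h5⟩ := h s hs
    refine ⟨M, _, Y, X, h3.reverse, ?_, ?_, ?_⟩
    · simpa using e.reverse
    · simpa using h5
    · simpa using h4

end Family

/-- The set `t` arises from `t'` by adding a vertex that is closer to the root `r` than all
vertices of `t'`. -/
def UpStep {V : Type*} (G : SimpleGraph V) (r : V) (t' t : Finset V) : Prop :=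
  open scoped Classical in
  ∃ p, p ∉ t' ∧ (∀ y ∈ t', G.dist r p < G.dist r y) ∧ t = insert p t'

section Root

variable {V : Type*} {G : SimpleGraph V} {r : V}

open scoped Classical

theorem exists_adj_dist_succ (hG : G.Connected) {q : V} (hq : G.dist r q ≠ 0) :
    ∃ p, G.Adj q p ∧ G.dist r p + 1 = G.dist r q := by
  obtain ⟨p, hp⟩ := hG.exists_walk_length_eq_dist q r
  cases p with
  | nil => simp at hq
  | cons h p =>
    rename_i v
    refine ⟨v, h, ?_⟩
    have h1 := dist_le p
    rw [Walk.length_cons] at hp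
    have h2 := hG.dist_triangle (u := r) (v := v) (w := q)
    have h3 := dist_eq_one_iff_adj.2 h.symm
    rw [dist_comm (u := q)] at hp
    rw [dist_comm (u := v)] at h1
    omega

theorem dist_lt_of_connIn (hG : G.IsTree) {s : Finset V} (hs : ConnIn G s) {p q : V} (hp : p ∉ s)
    (hq : q ∈ s) (hqp : G.Adj q p) (hlt : G.dist r p < G.dist r q) :
    ∀ y ∈ s, G.dist r p < G.dist r y := by
  intro y hy
  by_contra hle
  have key : ∀ v, ∃ w : G.Walk r v, ∀ z ∈ w.support, G.dist r z ≤ G.dist r v := by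
    intro v
    obtain ⟨w, hw⟩ := hG.1.exists_walk_length_eq_dist r v
    refine ⟨w, fun z hz => ?_⟩
    rw [← hw]
    exact (dist_le (w.takeUntil z hz)).trans (w.length_takeUntil_le_length hz)
  obtain ⟨w1, h1⟩ := key y
  obtain ⟨w2, h2⟩ := key p
  obtain ⟨w3, h3, h4⟩ := hs.exists_walk hy hq
  have h5 : q ∉ (w1.reverse.append w2).bypass.support := by
    intro h
    have h6 := Walk.support_bypass_subset_support _ h
    rw [Walk.mem_support_append_iff, Walk.support_reverse, List.mem_reverse] at h6
    rcases h6 with h6 | h6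
    · have := h1 q h6
      omega
    · have := h2 q h6
      omega
  have h6 : ((w1.reverse.append w2).bypass.concat hqp.symm).IsPath :=
    (Walk.concat_isPath_iff _).2 ⟨Walk.bypass_isPath _, h5⟩
  have h7 := (hG.2.subsingleton_path y q).elim ⟨_, h6⟩ ⟨_, h3⟩
  have h8 : ((w1.reverse.append w2).bypass.concat hqp.symm).support = w3.support :=
    congrArg (fun q : G.Path _ _ => q.1.support) h7
  apply hp
  apply h4
  rw [← h8, Walk.support_concat]
  simp

theorem UpStep.unique {t₁ t₂ t : Finset V} (h₁ : UpStep G r t₁ t) (h₂ : UpStep G r t₂ t) :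
    t₁ = t₂ := by
  obtain ⟨p, hp, hpt, rfl⟩ := h₁
  obtain ⟨q, hq, hqt, h⟩ := h₂
  have hpq : p = q := by
    by_contra hne
    have h1 : p ∈ insert q t₂ := by
      rw [← h]
      exact Finset.mem_insert_self _ _
    have h2 : q ∈ insert p t₁ := by
      rw [h]
      exact Finset.mem_insert_self _ _
    have h3 := hqt p ((Finset.mem_insert.1 h1).resolve_left hne)
    have h4 := hpt q ((Finset.mem_insert.1 h2).resolve_left (Ne.symm hne))
    omega
  subst hpq
  rw [← Finset.erase_insert hp, h, Finset.erase_insert hq]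

/-- A lowest vertex of a set that avoids the root has a neighbour below the whole set. -/
theorem exists_upper (hG : G.IsTree) {s : Finset V} {p₀ : V}
    (hlow : ∀ y ∈ s, G.dist r p₀ ≤ G.dist r y) (hpos : 1 ≤ G.dist r p₀) :
    ∃ p, G.Adj p₀ p ∧ p ∉ s ∧ G.dist r p + 1 = G.dist r p₀ ∧
      ∀ y ∈ s, G.dist r p < G.dist r y := by
  obtain ⟨p, hp, hd⟩ := exists_adj_dist_succ hG.1 (r := r) (q := p₀) (by omega)
  have h : ∀ y ∈ s, G.dist r p < G.dist r y := by
    intro y hy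
    have := hlow y hy
    omega
  exact ⟨p, hp, fun hps => lt_irrefl _ (h p hps), hd, h⟩

end Root

section Tight

variable {V : Type*} {G : SimpleGraph V} {d : ℕ → ℕ} {m : ℕ} {l : ℕ}

open scoped Classical

/-- A counting lemma for sets `s` containing all neighbours of the end of the spine: `s` can be
recovered from its core and the set `t'` obtained by deleting leaves at this end. -/
theorem card_le_of_tight [Fintype V] (hG : G.IsAcyclic) (hd : SpineDegrees d m)
    {E N : Finset (Finset V)} {D : ℕ} (P : Finset V → Finset (Finset V))
    (hP : ∀ t ∈ N, (P t).card ≤ D) (hpos : 3 ≤ m ∨ 1 ≤ l)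
    (h : ∀ s ∈ E, ∃ M x X Y t', ∃ t ∈ N, IsCore G d m M x ∧
      IsExt G M (x 1) (x m) (d 1 - 1) l t' X Y ∧ (∀ y, y ∈ s ↔ y ∈ t' ∨ G.Adj (x m) y) ∧
      t' ∈ P t) :
    E.card ≤ 4 * D * N.card := by
  rcases E.eq_empty_or_nonempty with rfl | ⟨s₀, hs₀⟩
  · simp
  have : Nonempty V := by
    obtain ⟨M, x, -⟩ := h s₀ hs₀
    exact ⟨x 0⟩
  choose! M x X Y t' t h1 h2 h3 h4 h5 using h
  have h6 := hd.first
  obtain ⟨C, hC⟩ : ∃ C : Finset (Finset V × V × V), ∀ c, c ∈ C ↔ IsCoreTriple G d m c :=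
    ⟨Finset.univ.filter fun c => IsCoreTriple G d m c, fun c => by simp⟩
  obtain ⟨Q, hQ4, hmem⟩ : ∃ Q : Finset V → Finset (Finset V × V × V), (∀ t', (Q t').card ≤ 4) ∧
      ∀ s ∈ E, (M s, x s 1, x s m) ∈ Q (t' s) := by
    have hpos' : (3 ≤ m ∧ 1 ≤ (d 1 - 1) + l) ∨ (1 ≤ d 1 - 1 ∧ 1 ≤ l) := by omega
    refine ⟨fun t' => C.filter fun c => ∃ X Y, IsExt G c.1 c.2.1 c.2.2 (d 1 - 1) l t' X Y,
      fun t' => card_cores_le_four (j := d 1 - 1) (l := l) (t := t') hG hd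
        (fun c hc => ⟨(hC c).1 (Finset.mem_filter.1 hc).1, (Finset.mem_filter.1 hc).2⟩) hpos',
      fun s hs => ?_⟩
    exact Finset.mem_filter.2 ⟨(hC _).2 ⟨x s, h2 s hs, rfl, rfl⟩, X s, Y s, h3 s hs⟩
  have hfib : ∀ z ∈ N, (E.filter fun s => t s = z).card ≤ 4 * D := by
    intro z hz
    calc (E.filter fun s => t s = z).card
        ≤ ((P z).sigma fun t' => Q t').card := by
          refine Finset.card_le_card_of_injOn
            (fun s => ⟨t' s, (M s, x s 1, x s m)⟩) (fun s hs => ?_) ?_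
          · obtain ⟨hsE, hz'⟩ := Finset.mem_filter.1 (Finset.mem_coe.1 hs)
            subst hz'
            exact Finset.mem_coe.2 (Finset.mem_sigma.2 ⟨h5 s hsE, hmem s hsE⟩)
          · intro s hs s' hs' heq
            have hs := (Finset.mem_filter.1 (Finset.mem_coe.1 hs)).1
            have hs' := (Finset.mem_filter.1 (Finset.mem_coe.1 hs')).1
            simp only [Sigma.mk.injEq, heq_eq_eq, Prod.mk.injEq] at heq
            ext y
            rw [h4 s hs, h4 s' hs', heq.1, heq.2.2.2]
      _ = ∑ t' ∈ P z, (Q t').card := Finset.card_sigma _ _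
      _ ≤ (P z).card • 4 := Finset.sum_le_card_nsmul _ _ _ fun t' _ => hQ4 t'
      _ ≤ 4 * D := by
          rw [smul_eq_mul, mul_comm]
          exact Nat.mul_le_mul_left _ (hP z hz)
  exact Finset.card_le_mul_card_image_of_maps_to h1 (4 * D) hfib

theorem card_filter_le_one [Fintype V] {R : Finset V → Finset V → Prop}
    (hR : ∀ t₁ t₂ t, R t₁ t → R t₂ t → t₁ = t₂) (t : Finset V) :
    (Finset.univ.filter fun t' => R t' t).card ≤ 1 := by
  rw [Finset.card_le_one]
  intro a ha b hb
  exact hR a b t (Finset.mem_filter.1 ha).2 (Finset.mem_filter.1 hb).2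

theorem card_le_of_tight_of_unique [Fintype V] (hG : G.IsAcyclic) (hd : SpineDegrees d m)
    {E N : Finset (Finset V)} {R : Finset V → Finset V → Prop}
    (hR : ∀ t₁ t₂ t, R t₁ t → R t₂ t → t₁ = t₂) (hpos : 3 ≤ m ∨ 1 ≤ l)
    (h : ∀ s ∈ E, ∃ M x X Y t', ∃ t ∈ N, IsCore G d m M x ∧
      IsExt G M (x 1) (x m) (d 1 - 1) l t' X Y ∧ (∀ y, y ∈ s ↔ y ∈ t' ∨ G.Adj (x m) y) ∧
      R t' t) :
    E.card ≤ 4 * N.card := by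
  have := card_le_of_tight hG hd (E := E) (N := N) (D := 1)
    (fun t => Finset.univ.filter fun t' => R t' t) (fun t _ => card_filter_le_one hR t) hpos ?_
  · linarith
  intro s hs
  obtain ⟨M, x, X, Y, t', t, ht, h1, h2, h3, h4⟩ := h s hs
  exact ⟨M, x, X, Y, t', t, ht, h1, h2, h3, Finset.mem_filter.2 ⟨Finset.mem_univ _, h4⟩⟩

end Tight

/-- The set `s` contains all neighbours of the last spine vertex, and some set in `N` is related by
`R` to the set `t'` obtained from `s` by deleting all but `l` of its leaves at this vertex. -/
def TightStep {V : Type*} (G : SimpleGraph V) (d : ℕ → ℕ) (m l : ℕ) (N : Finset (Finset V))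
    (R : Finset V → Finset V → Prop) (s : Finset V) : Prop :=
  ∃ M x X Y t', ∃ t ∈ N, IsCore G d m M x ∧ IsExt G M (x 1) (x m) (d 1 - 1) l t' X Y ∧
    (∀ y, y ∈ s ↔ y ∈ t' ∨ G.Adj (x m) y) ∧ R t' t

theorem card_le_of_tightStep {V : Type*} [Fintype V] {G : SimpleGraph V} {d : ℕ → ℕ} {m l : ℕ}
    (hG : G.IsAcyclic) (hd : SpineDegrees d m) {E N : Finset (Finset V)}
    {R : Finset V → Finset V → Prop} (hR : ∀ t₁ t₂ t, R t₁ t → R t₂ t → t₁ = t₂)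
    (hpos : 3 ≤ m ∨ 1 ≤ l) (h : ∀ s ∈ E, TightStep G d m l N R s) : E.card ≤ 4 * N.card :=
  card_le_of_tight_of_unique hG hd hR hpos h

theorem card_le_add_of_or {α : Type*} {E : Finset α} {A B : α → Prop} {a b : ℕ}
    (h : ∀ s ∈ E, A s ∨ B s) (hA : ∀ F ⊆ E, (∀ s ∈ F, A s) → F.card ≤ a)
    (hB : ∀ F ⊆ E, (∀ s ∈ F, B s) → F.card ≤ b) : E.card ≤ a + b := by
  classical
  have h1 : E ⊆ E.filter A ∪ E.filter B := by
    intro s hs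
    rcases h s hs with h2 | h2
    · exact Finset.mem_union_left _ (Finset.mem_filter.2 ⟨hs, h2⟩)
    · exact Finset.mem_union_right _ (Finset.mem_filter.2 ⟨hs, h2⟩)
  calc E.card ≤ (E.filter A ∪ E.filter B).card := Finset.card_le_card h1
    _ ≤ _ := Finset.card_union_le _ _
    _ ≤ a + b := Nat.add_le_add
        (hA _ (Finset.filter_subset _ _) fun s hs => (Finset.mem_filter.1 hs).2)
        (hB _ (Finset.filter_subset _ _) fun s hs => (Finset.mem_filter.1 hs).2)

section Swap

variable {V : Type*} {G : SimpleGraph V} {d : ℕ → ℕ} {m k : ℕ} {M : Finset V} {x : ℕ → V}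
  {j l : ℕ} {s t X Y : Finset V} {E N : Finset (Finset V)} {r : V}

open scoped Classical

theorem IsExt.erase_right (hG : G.IsAcyclic) (hm : 2 ≤ m) (h : IsCore G d m M x)
    (e : IsExt G M (x 1) (x m) j l s X Y) {y : V} (hy : y ∈ Y) :
    IsExt G M (x 1) (x m) j (l - 1) (s.erase y) X (Y.erase y) where
  left := e.left
  right z hz := e.right z (Finset.mem_of_mem_erase hz)
  card_left := e.card_left
  card_right := by rw [Finset.card_erase_of_mem hy, e.card_right]
  mem_iff z := by
    have h1 := (e.right_union hG hm h y hy).1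
    simp only [Finset.mem_union, not_or] at h1
    rw [Finset.mem_erase, Finset.mem_erase, e.mem_iff]
    constructor
    · tauto
    · rintro (h2 | h2 | h2)
      · exact ⟨fun h3 => h1.1 (h3 ▸ h2), Or.inl h2⟩
      · exact ⟨fun h3 => h1.2 (h3 ▸ h2), Or.inr (Or.inl h2)⟩
      · exact ⟨h2.1, Or.inr (Or.inr h2.2)⟩

theorem IsExt.mem_right (e : IsExt G M (x 1) (x m) j l s X Y) {y : V} (hy : y ∈ Y) : y ∈ s :=
  (e.mem_iff y).2 (Or.inr (Or.inr hy))

/-- In a member of the family, the second vertex of a path hanging from a leaf has degree two. -/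
theorem IsExt.degIn_eq_two (hG : G.IsAcyclic) (hd : SpineDegrees d m) (hm : 3 ≤ m)
    (h : IsCore G d m M x) (e : IsExt G M (x 1) (x m) (d 1 - 1) (d m - 1) s X Y) {p q z : V}
    (hp : p ∈ s) (hq : q ∈ s) (hz : z ∈ s) (hpq : G.Adj p q) (hqz : G.Adj q z) (hpz : p ≠ z)
    (h1 : degIn G s p = 1) (h2 : degIn G s q = 2) : degIn G s z = 2 := by
  have hm2 := hd.two_le
  have h3 := hd.first
  have h4 := hd.last
  have hsp : ∀ i, 1 ≤ i → i ≤ m → 2 ≤ degIn G s (x i) := fun i hi1 hi2 =>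
    e.two_le_degIn_spine hG hd h hi1 hi2 (fun _ => by omega) (fun _ => by omega)
  have hps : ∀ i, 1 ≤ i → i ≤ m → p ≠ x i := by
    rintro i hi1 hi2 rfl
    have := hsp i hi1 hi2
    omega
  have hmid : ∀ i, 1 < i → i < m → q ≠ x i := by
    rintro i hi1 hi2 rfl
    have := e.three_le_degIn_mid h hi1 hi2 hp hps hpq
    omega
  obtain ⟨i, hi1, hi2, rfl⟩ : ∃ i, 1 ≤ i ∧ i ≤ m ∧ q = x i := by
    rcases e.cases hG hm2 h hq with h5 | h5
    · exact h5
    · omega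
  have hz' : ∀ w ∈ s, G.Adj (x i) w → w ≠ p → z = w := by
    intro w hw h5 h6
    by_contra h7
    have := three_le_degIn hp hz hw hpz (Ne.symm h6) h7 hpq.symm hqz h5
    omega
  rcases eq_or_lt_of_le hi1 with rfl | hi1
  · rw [hz' (x 2) (e.mem_spine h (by omega) (by omega)) (h.adj 1 le_rfl (by omega))
      (hps 2 (by omega) (by omega)).symm, e.degIn_mid hG hm2 h (by omega) (by omega)]
    exact hd.second hm
  rcases eq_or_lt_of_le hi2 with rfl | hi2
  · have h5 := h.adj (i - 1) (by omega) (by omega)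
    rw [Nat.sub_add_cancel (by omega)] at h5
    rw [hz' (x (i - 1)) (e.mem_spine h (by omega) (by omega)) h5.symm
      (hps (i - 1) (by omega) (by omega)).symm, e.degIn_mid hG hm2 h (by omega) (by omega)]
    exact hd.penult hm
  · exact absurd rfl (hmid i hi1 hi2)

theorem upStep_insert {s t : Finset V} {p : V} (hst : t ⊆ s) (hp : p ∉ s)
    (hlow : ∀ y ∈ s, G.dist r p < G.dist r y) : UpStep G r t (insert p t) :=
  ⟨p, fun h => hp (hst h), fun y hy => hlow y (hst hy), rfl⟩

theorem mem_iff_or_adj_erase {s' : Finset V} {u y : V} (h : ∀ z, z ∈ s ↔ z ∈ s' ∨ G.Adj u z)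
    (huy : G.Adj u y) (z : V) : z ∈ s ↔ z ∈ s'.erase y ∨ G.Adj u z := by
  rw [h, Finset.mem_erase]
  constructor
  · rintro (hz | hz)
    · by_cases h : z = y
      · exact Or.inr (h ▸ huy)
      · exact Or.inl ⟨h, hz⟩
    · exact Or.inr hz
  · tauto

theorem mem_iff_or_adj {u : V} (h : ∀ z, G.Adj u z → z ∈ s) (z : V) : z ∈ s ↔ z ∈ s ∨ G.Adj u z :=
  ⟨Or.inl, fun hz => hz.elim id (h z)⟩

theorem exists_lowest (hs : s.Nonempty) : ∃ p ∈ s, ∀ y ∈ s, G.dist r p ≤ G.dist r y :=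
  s.exists_min_image (fun y => G.dist r y) hs

/-- Members of the family that contain all neighbours of an end of the spine which has at least
two leaves. -/
theorem IsFamily.card_le_of_three_le [Fintype V] (H : IsFamily G d m k E N)
    {E' : Finset (Finset V)} (hE' : E' ⊆ E) (hdm : 3 ≤ d m) (hpos : 3 ≤ m ∨ 3 ≤ d 1)
    (hfar : ∀ s ∈ E', ∀ y ∈ s, 2 ≤ G.dist r y)
    (h : ∀ s ∈ E', ∃ M x X Y, IsCore G d m M x ∧
      IsExt G M (x 1) (x m) (d 1 - 1) (d m - 1) s X Y ∧ ∀ y, G.Adj (x m) y → y ∈ s) :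
    E'.card ≤ 8 * N.card := by
  have hm := H.deg.two_le
  have hG := H.tree.2
  have hd1 := H.deg.first
  have key : ∀ s ∈ E', TightStep G d m (d m - 1 - 1) N (UpStep G r) s ∨
      (d m ≠ 3 ∧ TightStep G d m (d m - 1 - 1 - 1) N
        (fun t' t => ∃ t'', UpStep G r t' t'' ∧ UpStep G r t'' t) s) ∨
      (3 ≤ m ∧ TightStep G d m (d m - 1 - 1 - 1) N
        (fun t' t => ∃ t'', UpStep G r t' t'' ∧ UpStep G r t'' t) s) := by
    intro s hs
    obtain ⟨M, x, X, Y, hc, e, htight⟩ := h s hs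
    have hconn := e.conn hm hc
    obtain ⟨p₀, hp₀, hlow⟩ := exists_lowest (G := G) (r := r) hconn.nonempty
    have hp₀2 := hfar s hs p₀ hp₀
    obtain ⟨p₁, h01, hp₁, hd₁, hlow₁⟩ := exists_upper H.tree hlow (by omega)
    have hp₀x : p₀ ≠ x m := by
      rintro rfl
      exact hp₁ (htight _ h01)
    obtain ⟨y, hy, hyp⟩ : ∃ y ∈ Y, y ≠ p₀ := by
      refine Finset.exists_mem_ne ?_ p₀
      rw [e.card_right]
      omega
    have e1 := e.erase_right hG hm hc hy
    have hys := e.mem_right hy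
    have hxy := (e.right y hy).2
    have hconn1 := e1.conn hm hc
    have hp₀' : p₀ ∈ s.erase y := Finset.mem_erase.2 ⟨hyp.symm, hp₀⟩
    have hp₁' : p₁ ∉ s.erase y := fun h => hp₁ (Finset.mem_of_mem_erase h)
    have hx' := e1.mem_spine hc (show 1 ≤ m by omega) le_rfl
    have hyn : y ∉ s.erase y := Finset.notMem_erase _ _
    have hz1 := sqDeg_insert hG hconn1 hyn hx' hxy
    have hz2 := sqDeg_insert hG hconn1 hp₁' hp₀' h01
    have hdeg := degIn_insert_of_ne hG hconn1 hyn hx' hxy hp₀' hp₀x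
    rw [Finset.insert_erase hys] at hz1 hdeg
    have hdx := e1.degIn_last hG hm hc
    have hconn1' := hconn1.insert hp₀' h01
    by_cases hb : degIn G s p₀ = d m - 1
    · right
      obtain ⟨y', hy', hyp'⟩ : ∃ y' ∈ Y.erase y, y' ≠ p₀ := by
        obtain ⟨y', hy'⟩ : (Y.erase y).Nonempty := by
          rw [← Finset.card_pos, e1.card_right]
          omega
        refine ⟨y', hy', ?_⟩
        rintro rfl
        have := e.degIn_right hG hm hc (Finset.mem_of_mem_erase hy')
        omega
      have e2 := e1.erase_right hG hm hc hy'
      have hconn2 := e2.conn hm hc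
      have hys' := e1.mem_right hy'
      have hxy' := (e1.right y' hy').2
      have hp₀'' : p₀ ∈ (s.erase y).erase y' := Finset.mem_erase.2 ⟨hyp'.symm, hp₀'⟩
      have hsub : (s.erase y).erase y' ⊆ s :=
        (Finset.erase_subset _ _).trans (Finset.erase_subset _ _)
      have hp₁'' : p₁ ∉ (s.erase y).erase y' := fun h => hp₁ (hsub h)
      have hx'' := e2.mem_spine hc (show 1 ≤ m by omega) le_rfl
      have hyn' : y' ∉ (s.erase y).erase y' := Finset.notMem_erase _ _
      have hz3 := sqDeg_insert hG hconn2 hyn' hx'' hxy'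
      have hz4 := sqDeg_insert hG hconn2 hp₁'' hp₀'' h01
      have hdeg' := degIn_insert_of_ne hG hconn2 hyn' hx'' hxy' hp₀'' hp₀x
      rw [Finset.insert_erase hys'] at hz3 hdeg'
      have hdx' := e2.degIn_last hG hm hc
      have hconn3 := hconn2.insert hp₀'' h01
      have hlow2 : ∀ z ∈ insert p₁ ((s.erase y).erase y'), G.dist r p₁ ≤ G.dist r z := by
        intro z hz
        rcases Finset.mem_insert.1 hz with rfl | hz
        · exact le_rfl
        · exact (hlow₁ z (hsub hz)).le
      obtain ⟨p₂, h12, hp₂, -, hlow₂⟩ := exists_upper H.tree hlow2 (by omega)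
      have hp₁m : p₁ ∈ insert p₁ ((s.erase y).erase y') := Finset.mem_insert_self _ _
      have hz5 := sqDeg_insert hG hconn3 hp₂ hp₁m h12
      have hd1' := degIn_insert_self hG hconn2 hp₁'' hp₀'' h01
      have hcard : (insert p₂ (insert p₁ ((s.erase y).erase y'))).card = s.card := by
        rw [Finset.card_insert_of_notMem hp₂, Finset.card_insert_of_notMem hp₁'',
          Finset.card_erase_of_mem hys', Finset.card_erase_of_mem hys]
        have : 2 ≤ s.card := by
          rw [e.card hG hm hc]
          omega
        omega
      have hT : insert p₂ (insert p₁ ((s.erase y).erase y')) ∈ N →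
          TightStep G d m (d m - 1 - 1 - 1) N
            (fun t' t => ∃ t'', UpStep G r t' t'' ∧ UpStep G r t'' t) s := fun hN =>
        ⟨M, x, X, _, _, _, hN, hc, e2,
          mem_iff_or_adj_erase (mem_iff_or_adj_erase (mem_iff_or_adj htight) hxy) hxy', _,
          upStep_insert hsub hp₁ hlow₁, upStep_insert subset_rfl hp₂ hlow₂⟩
      have hconn4 := hconn3.insert hp₁m h12
      by_cases hd3 : d m = 3
      · right
        have hm3 : 3 ≤ m := by
          by_contra hm3
          obtain rfl : m = 2 := by omega
          rcases e.cases hG hm hc hp₀ with ⟨i, hi1, hi2, rfl⟩ | h5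
          · obtain rfl : i = 1 := by
              by_contra
              obtain rfl : i = 2 := by omega
              exact hp₀x rfl
            rw [e.degIn_first hG hm hc] at hb
            omega
          · omega
        refine ⟨hm3, hT (H.mem_of_notMem _ hconn4 (hcard.trans (H.card_eq s (hE' hs))) fun hE => ?_)⟩
        obtain ⟨M', x', X', Y', hc', e'⟩ := H.decomp _ hE
        have hp₀3 : p₀ ∈ insert p₁ ((s.erase y).erase y') := Finset.mem_insert_of_mem hp₀''
        have hne : p₀ ≠ p₁ := h01.ne
        have h6 := e'.degIn_eq_two hG H.deg hm3 hc' (p := p₂) (q := p₁) (z := p₀)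
          (Finset.mem_insert_self _ _) (Finset.mem_insert_of_mem hp₁m)
          (Finset.mem_insert_of_mem hp₀3) h12.symm h01.symm
          (fun h => hp₂ (h ▸ hp₀3)) (degIn_insert_self hG hconn3 hp₂ hp₁m h12)
          (by rw [degIn_insert_adj hp₂ h12, hd1'])
        rw [degIn_insert_of_ne hG hconn3 hp₂ hp₁m h12 hp₀3 hne, degIn_insert_adj hp₁'' h01] at h6
        omega
      · left
        refine ⟨hd3, hT (H.mem_of_sqDeg_ne (hE' hs) hconn4 hcard ?_)⟩
        omega
    · left
      refine ⟨M, x, X, _, _, insert p₁ (s.erase y), ?_, hc, e1,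
        mem_iff_or_adj_erase (mem_iff_or_adj htight) hxy,
        upStep_insert (Finset.erase_subset _ _) hp₁ hlow₁⟩
      refine H.mem_of_sqDeg_ne (hE' hs) hconn1' ?_ (by omega)
      rw [Finset.card_insert_of_notMem hp₁', Finset.card_erase_of_mem hys]
      have := Finset.card_pos.2 ⟨y, hys⟩
      omega
  have hR2 : ∀ t₁ t₂ t : Finset V, (∃ t'', UpStep G r t₁ t'' ∧ UpStep G r t'' t) →
      (∃ t'', UpStep G r t₂ t'' ∧ UpStep G r t'' t) → t₁ = t₂ := by
    rintro t₁ t₂ t ⟨a, h1, h2⟩ ⟨b, h3, h4⟩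
    obtain rfl := h2.unique h4
    exact h1.unique h3
  have h8 : E'.card ≤ 4 * N.card + 4 * N.card :=
    card_le_add_of_or key
      (fun F _ hF => card_le_of_tightStep (l := d m - 1 - 1) (R := UpStep G r) hG H.deg (fun _ _ _ => UpStep.unique)
        (Or.inr (by omega)) hF)
      fun F _ hF => by
        rcases F.eq_empty_or_nonempty with rfl | ⟨s, hs⟩
        · simp
        have hpos' : 3 ≤ m ∨ 1 ≤ d m - 1 - 1 - 1 := by
          have := hF s hs
          omega
        exact card_le_of_tightStep hG H.deg hR2 hpos' fun s hs => by
          rcases hF s hs with h9 | h9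
          · exact h9.2
          · exact h9.2
  omega

end Swap

section Shift

variable {V : Type*} {G : SimpleGraph V} {d : ℕ → ℕ} {m k : ℕ} {M : Finset V} {x : ℕ → V}
  {j l : ℕ} {s t X Y : Finset V} {E N : Finset (Finset V)} {r : V}

open scoped Classical

theorem length_eq_dist_of_isPath (hG : G.IsTree) {u v : V} {p : G.Walk u v} (hp : p.IsPath) :
    p.length = G.dist u v := by
  obtain ⟨q, hq, hql⟩ := hG.1.exists_path_of_dist u v
  have h := (hG.2.subsingleton_path u v).elim ⟨p, hp⟩ ⟨q, hq⟩
  rw [← hql]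
  exact congrArg (fun q : G.Path u v => q.1.length) h

theorem dist_eq_add_one (hG : G.IsTree) (hs : ConnIn G s) {p q y : V} (hp : p ∉ s) (hq : q ∈ s)
    (hqp : G.Adj q p) (hy : y ∈ s) : G.dist p y = G.dist q y + 1 := by
  obtain ⟨w, hw, hws⟩ := hs.exists_walk hq hy
  have h1 : (w.cons hqp.symm).IsPath := hw.cons fun h => hp (hws p h)
  rw [← length_eq_dist_of_isPath hG h1, ← length_eq_dist_of_isPath hG hw, Walk.length_cons]

theorem wiener_insert (hG : G.IsTree) (hs : ConnIn G s) {p q : V} (hp : p ∉ s) (hq : q ∈ s)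
    (hqp : G.Adj q p) :
    wiener G (insert p s) = wiener G s + 2 * (∑ y ∈ s, G.dist q y + s.card) := by
  have h1 : ∑ y ∈ s, G.dist p y = ∑ y ∈ s, G.dist q y + s.card := by
    rw [Finset.card_eq_sum_ones, ← Finset.sum_add_distrib]
    exact Finset.sum_congr rfl fun y hy => dist_eq_add_one hG hs hp hq hqp hy
  have h2 : ∑ y ∈ s, G.dist y p = ∑ y ∈ s, G.dist p y :=
    Finset.sum_congr rfl fun y _ => dist_comm
  unfold wiener
  rw [Finset.sum_insert hp, Finset.sum_insert hp, dist_self]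
  simp only [Finset.sum_insert hp]
  rw [Finset.sum_add_distrib, h2, h1]
  ring

/-- Moving a leaf from one end of a caterpillar to the other end, twice, cannot preserve the sum of
the distances, unless the caterpillar is a path. -/
theorem card_eq_of_wiener_eq (hG : G.IsTree) {B : Finset V} {w q p₀ p₁ p₂ y : V}
    (hw : w ∉ B) (hp : p₁ ∉ insert w B) (hq : q ∈ B) (hp₀ : p₀ ∈ B)
    (h1 : ConnIn G (insert w B)) (h2 : ConnIn G (insert p₁ B)) (hqw : G.Adj q w)
    (hwy : G.Adj w y) (hy : y ∉ insert w B) (h01 : G.Adj p₀ p₁) (h12 : G.Adj p₁ p₂)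
    (hp₂ : p₂ ∉ insert p₁ B)
    (e1 : wiener G (insert y (insert w B)) = wiener G (insert p₁ (insert w B)))
    (e2 : wiener G (insert p₁ (insert w B)) = wiener G (insert p₂ (insert p₁ B))) :
    B.card = G.dist p₀ q + 1 := by
  have hwB : w ∉ insert p₁ B := by
    simp only [Finset.mem_insert, not_or]
    exact ⟨fun h => hp (h ▸ Finset.mem_insert_self _ _), hw⟩
  have hpB : p₁ ∉ B := fun h => hp (Finset.mem_insert_of_mem h)
  have m1 : ∀ {v}, v ∈ B → v ∈ insert w B := Finset.mem_insert_of_mem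
  have m2 : ∀ {v}, v ∈ B → v ∈ insert p₁ B := Finset.mem_insert_of_mem
  rw [wiener_insert hG h1 hy (Finset.mem_insert_self _ _) hwy,
    wiener_insert hG h1 hp (m1 hp₀) h01] at e1
  rw [Finset.insert_comm p₁ w, wiener_insert hG h2 hwB (m2 hq) hqw,
    wiener_insert hG h2 hp₂ (Finset.mem_insert_self _ _) h12] at e2
  have f1 : ∑ v ∈ B, G.dist w v = ∑ v ∈ B, G.dist q v + B.card := by
    rw [Finset.card_eq_sum_ones, ← Finset.sum_add_distrib]
    exact Finset.sum_congr rfl fun v hv => dist_eq_add_one hG h2 hwB (m2 hq) hqw (m2 hv)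
  have f2 : ∑ v ∈ B, G.dist p₁ v = ∑ v ∈ B, G.dist p₀ v + B.card := by
    rw [Finset.card_eq_sum_ones, ← Finset.sum_add_distrib]
    exact Finset.sum_congr rfl fun v hv => dist_eq_add_one hG h1 hp (m1 hp₀) h01 (m1 hv)
  have f3 := dist_eq_add_one hG h2 hwB (m2 hq) hqw (m2 hp₀)
  have f4 := dist_eq_add_one hG h1 hp (m1 hp₀) h01 (m1 hq)
  rw [Finset.sum_insert hw, Finset.sum_insert hw, dist_self] at e1
  rw [Finset.sum_insert hpB, Finset.sum_insert hpB, dist_self] at e2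
  rw [dist_comm (u := p₀) (v := w)] at e1
  rw [dist_comm (u := q) (v := p₁)] at e2
  rw [dist_comm (u := q) (v := p₀)] at f3
  omega

theorem IsCore.dist_le (hG : G.Connected) (h : IsCore G d m M x) {i : ℕ} (hi : 1 ≤ i) (n : ℕ)
    (hn : i + n ≤ m) : G.dist (x i) (x (i + n)) ≤ n := by
  induction n with
  | zero => simp
  | succ n ih =>
    have h1 := ih (by omega)
    have h2 := dist_eq_one_iff_adj.2 (h.adj (i + n) (by omega) (by omega))
    have h3 := hG.dist_triangle (u := x i) (v := x (i + n)) (w := x (i + (n + 1)))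
    rw [← add_assoc] at h3 ⊢
    omega

theorem IsExt.dist_le (hG : G.IsTree) (hm : 3 ≤ m) (h : IsCore G d m M x)
    (e : IsExt G M (x 1) (x m) j 0 t X Y) {y : V} (hy : y ∈ t) (hym : y ≠ x m) :
    G.dist y (x (m - 1)) ≤ m - 1 := by
  have key : ∀ i, 1 ≤ i → i < m → G.dist (x i) (x (m - 1)) ≤ m - 2 := by
    intro i hi1 hi2
    have := h.dist_le hG.1 hi1 (m - 1 - i) (by omega)
    rw [show i + (m - 1 - i) = m - 1 by omega] at this
    omega
  have key' : ∀ i, 1 ≤ i → i < m → G.Adj (x i) y → G.dist y (x (m - 1)) ≤ m - 1 := by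
    intro i hi1 hi2 hadj
    have h1 := key i hi1 hi2
    have h2 := dist_eq_one_iff_adj.2 hadj.symm
    have h3 := hG.1.dist_triangle (u := y) (v := x i) (w := x (m - 1))
    omega
  rcases e.cases hG.2 (by omega) h hy with ⟨i, hi1, hi2, rfl⟩ | ⟨-, h1 | h1 | ⟨-, i, hi1, hi2, h1⟩⟩
  · have : i ≠ m := fun h => hym (by rw [h])
    have := key i hi1 (by omega)
    omega
  · exact key' 1 le_rfl (by omega) (e.left y h1).2
  · rw [Finset.card_eq_zero.1 e.card_right] at h1
    simp at h1
  · exact key' i (by omega) hi2 h1.symm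

/-- A leaf adjacent to a vertex of degree two lies at one of the ends of the spine. -/
theorem IsExt.end_of_leaf (hG : G.IsAcyclic) (hd : SpineDegrees d m)
    (h : IsCore G d m M x) (e : IsExt G M (x 1) (x m) (d 1 - 1) (d m - 1) t X Y) {w q : V}
    (hw : w ∈ t) (hq : q ∈ t) (hwq : G.Adj w q) (h1 : degIn G t w = 1) (h2 : degIn G t q = 2) :
    (q = x 1 ∧ w ∈ X) ∨ (q = x m ∧ w ∈ Y) := by
  have hm := hd.two_le
  have h3 := hd.first
  have h4 := hd.last
  have hws : ∀ i, 1 ≤ i → i ≤ m → w ≠ x i := by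
    rintro i hi1 hi2 rfl
    have := e.two_le_degIn_spine hG hd h hi1 hi2 (fun _ => by omega) (fun _ => by omega)
    omega
  rcases e.cases hG hm h hw with ⟨i, hi1, hi2, h5⟩ | ⟨-, h5 | h5 | ⟨-, i, hi1, hi2, h5⟩⟩
  · exact absurd h5 (hws i hi1 hi2)
  · exact Or.inl ⟨eq_of_degIn_eq_one h1 hq (e.mem_spine h le_rfl (by omega)) hwq
      (e.left w h5).2.symm, h5⟩
  · exact Or.inr ⟨eq_of_degIn_eq_one h1 hq (e.mem_spine h (by omega) le_rfl) hwq
      (e.right w h5).2.symm, h5⟩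
  · obtain rfl := eq_of_degIn_eq_one h1 hq (e.mem_spine h (by omega) hi2.le) hwq h5
    have := e.three_le_degIn_mid h hi1 hi2 hw hws h5
    omega

end Shift

section Snake

variable {V : Type*} {G : SimpleGraph V} {d : ℕ → ℕ} {m k : ℕ} {M : Finset V} {x : ℕ → V}
  {j l : ℕ} {s t X Y : Finset V} {E N : Finset (Finset V)} {r : V}

open scoped Classical

theorem IsFamily.degIn_eq_one_of_mem (H : IsFamily G d m k E N)
    (hdm : d m = 2) (hs : s ∈ E) (h : IsCore G d m M x)
    (e : IsExt G M (x 1) (x m) (d 1 - 1) (d m - 1) s X Y) {y p₀ p₁ : V} (hy : y ∈ Y)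
    (hp₀ : p₀ ∈ s) (hp₀y : p₀ ≠ y) (h01 : G.Adj p₀ p₁) (hp₁ : p₁ ∉ s)
    (ht : insert p₁ (s.erase y) ∈ E) : degIn G (s.erase y) p₀ = 1 := by
  have hm := H.deg.two_le
  have hG := H.tree.2
  have e1 := e.erase_right hG hm h hy
  have hconn := e1.conn hm h
  have h1 := sqDeg_insert hG hconn (Finset.notMem_erase y s)
    (e1.mem_spine h (by omega) le_rfl) (e.right y hy).2
  rw [Finset.insert_erase (e.mem_right hy), e1.degIn_last hG hm h] at h1
  have h2 := sqDeg_insert hG hconn (fun h => hp₁ (Finset.mem_of_mem_erase h))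
    (Finset.mem_erase.2 ⟨hp₀y, hp₀⟩) h01
  have h3 := H.sqDeg_eq _ hs _ ht
  omega

theorem IsFamily.tightStep_shift (H : IsFamily G d m k E N)
    (hm3 : 3 ≤ m) (hdm : d m = 2) (hs : s ∈ E) (h : IsCore G d m M x)
    (e : IsExt G M (x 1) (x m) (d 1 - 1) (d m - 1) s X Y) {y p₀ p₁ : V} (hy : y ∈ Y)
    (hp₀ : p₀ ∈ s) (hp₀y : p₀ ≠ y) (hp₀m : p₀ ≠ x m) (h01 : G.Adj p₀ p₁) (hp₁ : p₁ ∉ s)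
    (hlow : ∀ z ∈ s, G.dist r p₁ < G.dist r z) (hpos : 1 ≤ G.dist r p₁)
    (ht : insert p₁ (s.erase y) ∈ E) (hx : ∀ z, G.Adj (x (m - 1)) z → z ∈ s) :
    TightStep G d m 0 N (UpStep G r) (insert p₁ (s.erase y)) ∨
    TightStep G (fun i => d (m + 1 - i)) m 0 N (UpStep G r) (insert p₁ (s.erase y)) := by
  have hm := H.deg.two_le
  have hG := H.tree.2
  have h1 := H.degIn_eq_one_of_mem hdm hs h e hy hp₀ hp₀y h01 hp₁ ht
  have e1 : IsExt G M (x 1) (x m) (d 1 - 1) 0 (s.erase y) X (Y.erase y) := by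
    have := e.erase_right hG hm h hy
    rwa [hdm] at this
  have hconn := e1.conn hm h
  have hp₀t : p₀ ∈ s.erase y := Finset.mem_erase.2 ⟨hp₀y, hp₀⟩
  have hp₁t : p₁ ∉ s.erase y := fun h => hp₁ (Finset.mem_of_mem_erase h)
  have hw : x m ∈ s.erase y := e1.mem_spine h (by omega) le_rfl
  have hq : x (m - 1) ∈ s.erase y := e1.mem_spine h (by omega) (by omega)
  have hqw : G.Adj (x (m - 1)) (x m) := by
    have := h.adj (m - 1) (by omega) (by omega)
    rwa [Nat.sub_add_cancel (by omega)] at this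
  have hdw : degIn G (s.erase y) (x m) = 1 := e1.degIn_last hG hm h
  have hdq : degIn G (s.erase y) (x (m - 1)) = 2 := by
    rw [e1.degIn_mid hG hm h (by omega) (by omega)]
    exact H.deg.penult hm3
  have hqp : x (m - 1) ≠ p₀ := by
    rintro rfl
    omega
  have hdw' := degIn_insert_of_ne hG hconn hp₁t hp₀t h01 hw hp₀m.symm
  have hdq' := degIn_insert_of_ne hG hconn hp₁t hp₀t h01 hq hqp
  have hwt : x m ∈ insert p₁ (s.erase y) := Finset.mem_insert_of_mem hw
  have hqt : x (m - 1) ∈ insert p₁ (s.erase y) := Finset.mem_insert_of_mem hq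
  have hyw : G.Adj (x m) y := (e.right y hy).2
  have hxt : ∀ z, G.Adj (x (m - 1)) z → z ∈ insert p₁ (s.erase y) := by
    intro z hz
    refine Finset.mem_insert_of_mem (Finset.mem_erase.2 ⟨?_, hx z hz⟩)
    rintro rfl
    have := eq_of_degIn_eq_one (e.degIn_right hG hm h hy) (Finset.mem_of_mem_erase hq)
      (Finset.mem_of_mem_erase hw) hz.symm hyw.symm
    exact h.ne (by omega) (by omega) (by omega) le_rfl (by omega) this
  have hp₁w : p₁ ≠ x m := fun h => hp₁t (h ▸ hw)
  have herase : (insert p₁ (s.erase y)).erase (x m) = insert p₁ ((s.erase y).erase (x m)) :=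
    Finset.erase_insert_of_ne hp₁w
  have hlow1 : ∀ z ∈ insert p₁ (s.erase y), G.dist r p₁ ≤ G.dist r z := by
    intro z hz
    rcases Finset.mem_insert.1 hz with rfl | hz
    · exact le_rfl
    · exact (hlow z (Finset.mem_of_mem_erase hz)).le
  obtain ⟨p₂, h12, hp₂, -, hlow₂⟩ := exists_upper H.tree hlow1 hpos
  have hp₂' : p₂ ∉ (insert p₁ (s.erase y)).erase (x m) :=
    fun h => hp₂ (Finset.mem_of_mem_erase h)
  have hp₁m : p₁ ∈ (insert p₁ (s.erase y)).erase (x m) :=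
    Finset.mem_erase.2 ⟨hp₁w, Finset.mem_insert_self _ _⟩
  have hup : UpStep G r ((insert p₁ (s.erase y)).erase (x m))
      (insert p₂ ((insert p₁ (s.erase y)).erase (x m))) :=
    upStep_insert (Finset.erase_subset _ _) hp₂ hlow₂
  have hB : insert (x m) ((s.erase y).erase (x m)) = s.erase y := Finset.insert_erase hw
  have hN : ConnIn G ((insert p₁ (s.erase y)).erase (x m)) →
      insert p₂ ((insert p₁ (s.erase y)).erase (x m)) ∈ N := by
    intro hconn'
    refine H.mem_of_notMem _ (hconn'.insert hp₁m h12) ?_ fun hE => ?_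
    · rw [Finset.card_insert_of_notMem hp₂', Finset.card_erase_of_mem hwt, H.card_eq _ ht]
      have := H.lt_card
      omega
    have h2 := H.wiener_eq _ hs _ ht
    have h3 := H.wiener_eq _ ht _ hE
    rw [herase] at h3 hconn' hp₂'
    have hys := Finset.insert_erase (e.mem_right hy)
    have h4 := card_eq_of_wiener_eq H.tree (B := (s.erase y).erase (x m)) (w := x m)
      (q := x (m - 1)) (p₀ := p₀) (p₁ := p₁) (p₂ := p₂) (y := y) (Finset.notMem_erase _ _)
      (by rwa [hB]) (Finset.mem_erase.2 ⟨hqw.ne, hq⟩) (Finset.mem_erase.2 ⟨hp₀m, hp₀t⟩)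
      (by rwa [hB]) hconn' hqw hyw (by rw [hB]; exact Finset.notMem_erase _ _) h01 h12 hp₂'
      (by rw [hB, hys]; exact h2) (by rw [hB]; exact h3)
    rw [Finset.card_erase_of_mem hw, Finset.card_erase_of_mem (e.mem_right hy),
      H.card_eq _ hs] at h4
    have h5 := e1.dist_le H.tree hm3 h hp₀t hp₀m
    have := H.lt_card
    omega
  obtain ⟨M', x', X', Y', h', e'⟩ := H.decomp _ ht
  rcases e'.end_of_leaf hG H.deg h' hwt hqt hqw.symm (by omega) (by omega) with h2 | h2
  · right
    have h3 := e'.degIn_first hG hm h'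
    rw [← h2.1] at h3
    have e2 := e'.reverse_core
    have h1m : m + 1 - m = 1 := by omega
    have e3 := e2.erase_right hG hm h'.reverse h2.2
    have hadj : ∀ z, G.Adj (x' (m + 1 - m)) z → z ∈ insert p₁ (s.erase y) := by
      rw [h1m, ← h2.1]
      exact hxt
    refine ⟨M', _, Y', X'.erase (x m), _, _, hN (e3.conn hm h'.reverse), h'.reverse, ?_,
      mem_iff_or_adj_erase (mem_iff_or_adj hadj) ?_, hup⟩
    · have h5 : d 1 - 1 - 1 = 0 := by omega
      rw [h5] at e3
      simpa using e3
    · rw [h1m, ← h2.1]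
      exact hqw
  · left
    have e3 := e'.erase_right hG hm h' h2.2
    have hadj : ∀ z, G.Adj (x' m) z → z ∈ insert p₁ (s.erase y) := by
      rw [← h2.1]
      exact hxt
    refine ⟨M', _, X', Y'.erase (x m), _, _, hN (e3.conn hm h'), h', ?_,
      mem_iff_or_adj_erase (mem_iff_or_adj hadj) ?_, hup⟩
    · rw [hdm] at e3
      exact e3
    · rw [← h2.1]
      exact hqw

end Snake

/-- The leaves of `t` that are adjacent to a vertex in `endCand G t`. -/
noncomputable def endLeaves {V : Type*} (G : SimpleGraph V) (t : Finset V) : Finset V :=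
  open scoped Classical in
  t.filter fun z => degIn G t z = 1 ∧ ∃ q ∈ endCand G t, G.Adj q z

section Regrow

variable {V : Type*} {G : SimpleGraph V} {d : ℕ → ℕ} {m k : ℕ} {M : Finset V} {x : ℕ → V}
  {j l : ℕ} {s t X Y : Finset V} {E N : Finset (Finset V)} {r : V}

open scoped Classical

theorem IsExt.mem_endLeaves_insert (hG : G.IsAcyclic) (hd : SpineDegrees d m) (hm3 : 3 ≤ m)
    (h : IsCore G d m M x) (e : IsExt G M (x 1) (x m) j 0 t X Y) {z : V} (hz : z ∉ t)
    (hqz : G.Adj (x (m - 1)) z) : z ∈ endLeaves G (insert z t) := by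
  have hm := hd.two_le
  have hconn := e.conn hm h
  have hq : x (m - 1) ∈ t := e.mem_spine h (by omega) (by omega)
  have hdq : degIn G t (x (m - 1)) = 2 := by
    rw [e.degIn_mid hG hm h (by omega) (by omega)]
    exact hd.penult hm3
  refine Finset.mem_filter.2 ⟨Finset.mem_insert_self _ _, degIn_insert_self hG hconn hz hq hqz,
    x (m - 1), Finset.mem_filter.2 ⟨Finset.mem_insert_of_mem hq, ?_, ?_⟩, hqz⟩
  · rw [degIn_insert_adj hz hqz]
    omega
  · calc _ ≤ ({x (m - 2)} : Finset V).card := Finset.card_le_card fun y hy => ?_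
      _ = 1 := Finset.card_singleton _
    obtain ⟨hyt, hqy, hdy⟩ := Finset.mem_filter.1 hy
    rw [Finset.mem_singleton]
    have hyz : y ≠ z := by
      rintro rfl
      rw [degIn_insert_self hG hconn hz hq hqz] at hdy
      omega
    have hyt := (Finset.mem_insert.1 hyt).resolve_left hyz
    rw [degIn_insert_of_ne hG hconn hz hq hqz hyt hqy.ne'] at hdy
    by_contra hne
    have h1 := h.adj (m - 2) (by omega) (by omega)
    have h2 := h.adj (m - 1) (by omega) (by omega)
    rw [show m - 2 + 1 = m - 1 by omega] at h1
    rw [show m - 1 + 1 = m by omega] at h2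
    have h3 : x m ≠ y := by
      rintro rfl
      rw [e.degIn_last hG hm h] at hdy
      omega
    have := three_le_degIn (e.mem_spine h (i := m) (by omega) le_rfl)
      (e.mem_spine h (i := m - 2) (by omega) (by omega)) hyt
      (h.ne (by omega) le_rfl (by omega) (by omega) (by omega)) h3 (Ne.symm hne) h2 h1.symm hqy
    omega

theorem IsExt.card_endLeaves_insert_le (hG : G.IsAcyclic) (hd : SpineDegrees d m) (hm3 : 3 ≤ m)
    (h : IsCore G d m M x) (e : IsExt G M (x 1) (x m) 1 0 t X Y) {z : V} (hz : z ∉ t)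
    (hqz : G.Adj (x (m - 1)) z) : (endLeaves G (insert z t)).card ≤ 3 := by
  have hm := hd.two_le
  have hconn := e.conn hm h
  have hq : x (m - 1) ∈ t := e.mem_spine h (by omega) (by omega)
  have hdq : degIn G t (x (m - 1)) = 2 := by
    rw [e.degIn_mid hG hm h (by omega) (by omega)]
    exact hd.penult hm3
  obtain ⟨p, hp⟩ := Finset.card_eq_one.1 e.card_left
  have hY := Finset.card_eq_zero.1 e.card_right
  refine le_trans (Finset.card_le_card (t := {p, x m, z}) fun y hy => ?_) Finset.card_le_three
  simp only [Finset.mem_insert, Finset.mem_singleton]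
  obtain ⟨hyt, hdy, q, hqe, hqy⟩ := Finset.mem_filter.1 hy
  by_contra! hne
  have hyt := (Finset.mem_insert.1 hyt).resolve_left hne.2.2
  have hmono : ∀ y, degIn G t y ≤ degIn G (insert z t) y := fun y => by
    rw [degIn_insert hz]
    omega
  have hyq : y ≠ x (m - 1) := by
    rintro rfl
    rw [degIn_insert_adj hz hqz] at hdy
    omega
  have hsp : ∀ i, 1 ≤ i → i < m → 2 ≤ degIn G t (x i) := fun i hi1 hi2 =>
    e.two_le_degIn_spine hG hd h hi1 hi2.le (fun _ => le_rfl) (fun _ => by omega)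
  have hy1 : degIn G t y = 1 := by
    rwa [degIn_insert_of_ne hG hconn hz hq hqz hyt hyq] at hdy
  have hys : ∀ i, 1 ≤ i → i ≤ m → y ≠ x i := by
    rintro i hi1 hi2 rfl
    rcases eq_or_lt_of_le hi2 with rfl | hi2
    · exact hne.2.1 rfl
    · have := hsp i hi1 hi2
      omega
  rcases e.cases hG hm h hyt with ⟨i, hi1, hi2, rfl⟩ | ⟨-, h1 | h1 | ⟨-, i, hi1, hi2, h1⟩⟩
  · exact hys i hi1 hi2 rfl
  · rw [hp, Finset.mem_singleton] at h1
    exact hne.1 h1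
  · simp [hY] at h1
  · have h3 := e.three_le_degIn_mid h hi1 hi2 hyt hys h1
    have h4 := e.degIn_mid hG hm h hi1 hi2
    have hi3 : i ≠ m - 1 := by
      rintro rfl
      omega
    have hi4 : i ≠ 2 := by
      rintro rfl
      have := hd.second hm3
      omega
    obtain ⟨hqt, -, hq1⟩ := Finset.mem_filter.1 hqe
    obtain rfl : x i = q := eq_of_degIn_eq_one hdy
      (Finset.mem_insert_of_mem (e.mem_spine h hi1.le hi2.le)) hqt h1 hqy.symm
    have h5 := h.adj (i - 1) (by omega) (by omega)
    rw [Nat.sub_add_cancel (by omega)] at h5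
    have h6 : ({x (i - 1), x (i + 1)} : Finset V) ⊆
        (insert z t).filter fun y => G.Adj (x i) y ∧ 2 ≤ degIn G (insert z t) y := by
      intro w hw
      rw [Finset.mem_insert, Finset.mem_singleton] at hw
      rcases hw with rfl | rfl
      · exact Finset.mem_filter.2 ⟨Finset.mem_insert_of_mem (e.mem_spine h (by omega) (by omega)),
          h5.symm, (hsp _ (by omega) (by omega)).trans (hmono _)⟩
      · exact Finset.mem_filter.2 ⟨Finset.mem_insert_of_mem (e.mem_spine h (by omega) (by omega)),
          h.adj i hi1.le hi2, (hsp _ (by omega) (by omega)).trans (hmono _)⟩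
    have h7 := Finset.card_le_card h6
    rw [Finset.card_pair (h.ne (by omega) (by omega) (by omega) (by omega) (by omega))] at h7
    omega

theorem IsFamily.first_eq_two (H : IsFamily G d m k E N)
    (hm3 : 3 ≤ m) (hdm : d m = 2) (hs : s ∈ E) (h : IsCore G d m M x)
    (e : IsExt G M (x 1) (x m) (d 1 - 1) (d m - 1) s X Y) {y p₀ p₁ : V} (hy : y ∈ Y)
    (hp₀ : p₀ ∈ s) (hp₀y : p₀ ≠ y) (hp₀m : p₀ ≠ x m) (h01 : G.Adj p₀ p₁) (hp₁ : p₁ ∉ s)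
    (ht : insert p₁ (s.erase y) ∈ E) : d 1 = 2 := by
  have hm := H.deg.two_le
  have hG := H.tree.2
  have hd1 := H.deg.first
  have h1 := H.degIn_eq_one_of_mem hdm hs h e hy hp₀ hp₀y h01 hp₁ ht
  have e1 : IsExt G M (x 1) (x m) (d 1 - 1) 0 (s.erase y) X (Y.erase y) := by
    have := e.erase_right hG hm h hy
    rwa [hdm] at this
  have hconn := e1.conn hm h
  have hp₀t : p₀ ∈ s.erase y := Finset.mem_erase.2 ⟨hp₀y, hp₀⟩
  have hp₁t : p₁ ∉ s.erase y := fun h => hp₁ (Finset.mem_of_mem_erase h)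
  have hY := Finset.card_eq_zero.1 e1.card_right
  have hps : ∀ i, 1 ≤ i → i ≤ m → p₀ ≠ x i := by
    rintro i hi1 hi2 rfl
    have := e1.two_le_degIn_spine hG H.deg h hi1 hi2 (fun _ => by omega) (by
      rintro rfl
      exact absurd rfl hp₀m)
    omega
  have key : ∀ g ∈ s.erase y, G.Adj p₀ g → degIn G (s.erase y) g = 2 := by
    intro g hg h0g
    obtain ⟨M', x', X', Y', h', e'⟩ := H.decomp _ ht
    rw [← degIn_insert_of_ne hG hconn hp₁t hp₀t h01 hg h0g.ne']
    refine e'.degIn_eq_two hG H.deg hm3 h' (p := p₁) (q := p₀) (Finset.mem_insert_self _ _)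
      (Finset.mem_insert_of_mem hp₀t) (Finset.mem_insert_of_mem hg) h01.symm h0g ?_
      (degIn_insert_self hG hconn hp₁t hp₀t h01) ?_
    · rintro rfl
      exact hp₁t hg
    · rw [degIn_insert_adj hp₁t h01, h1]
  rcases e1.cases hG hm h hp₀t with ⟨i, hi1, hi2, rfl⟩ | ⟨-, h2 | h2 | ⟨-, i, hi1, hi2, h2⟩⟩
  · exact absurd rfl (hps i hi1 hi2)
  · have h3 := key (x 1) (e1.mem_spine h le_rfl (by omega)) (e1.left _ h2).2.symm
    rw [e1.degIn_first hG hm h] at h3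
    omega
  · simp [hY] at h2
  · have h3 := key (x i) (e1.mem_spine h hi1.le hi2.le) h2
    have := e1.three_le_degIn_mid h hi1 hi2 hp₀t hps h2
    omega

/-- Members of the family that contain all neighbours of an end of the spine which has a single
leaf, provided that this leaf is not the vertex closest to the root. -/
theorem IsFamily.card_le_of_eq_two [Fintype V] (H : IsFamily G d m k E N)
    {E' : Finset (Finset V)} (hE' : E' ⊆ E) (hdm : d m = 2) (hm3 : 3 ≤ m)
    (hfar : ∀ s ∈ E', ∀ y ∈ s, 2 ≤ G.dist r y)
    (h : ∀ s ∈ E', ∃ M x X Y, IsCore G d m M x ∧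
      IsExt G M (x 1) (x m) (d 1 - 1) (d m - 1) s X Y ∧ (∀ y, G.Adj (x m) y → y ∈ s) ∧
      ∃ p ∈ s, p ∉ Y ∧ ∀ y ∈ s, G.dist r p ≤ G.dist r y) :
    E'.card ≤ 48 * N.card := by
  have hm := H.deg.two_le
  have hG := H.tree.2
  have hR : ∀ t₁ t₂ t, UpStep G r t₁ t → UpStep G r t₂ t → t₁ = t₂ := fun _ _ _ => UpStep.unique
  obtain ⟨B₁, hB₁⟩ : ∃ B : Finset (Finset V),
      ∀ t, t ∈ B ↔ t ∈ E ∧ TightStep G d m 0 N (UpStep G r) t :=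
    ⟨E.filter fun t => TightStep G d m 0 N (UpStep G r) t, fun t => Finset.mem_filter⟩
  obtain ⟨B₂, hB₂⟩ : ∃ B : Finset (Finset V),
      ∀ t, t ∈ B ↔ t ∈ E ∧ TightStep G (fun i => d (m + 1 - i)) m 0 N (UpStep G r) t :=
    ⟨E.filter fun t => TightStep G (fun i => d (m + 1 - i)) m 0 N (UpStep G r) t,
      fun t => Finset.mem_filter⟩
  have hb₁ : B₁.card ≤ 4 * N.card :=
    card_le_of_tightStep hG H.deg hR (Or.inl hm3) fun s hs => ((hB₁ s).1 hs).2
  have hb₂ : B₂.card ≤ 4 * N.card :=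
    card_le_of_tightStep hG H.deg.reverse hR (Or.inl hm3) fun s hs => ((hB₂ s).1 hs).2
  have hb : (B₁ ∪ B₂).card ≤ 8 * N.card := (Finset.card_union_le _ _).trans (by omega)
  let P : Finset V → Finset (Finset V) := fun t => (endLeaves G t).image t.erase
  have key : ∀ s ∈ E', TightStep G d m 0 N (UpStep G r) s ∨
      (TightStep G d m 0 (B₁ ∪ B₂) (UpStep G r) s ∨
        ∃ M x X Y t', ∃ t ∈ N.filter fun t => (P t).card ≤ 3, IsCore G d m M x ∧
          IsExt G M (x 1) (x m) (d 1 - 1) 0 t' X Y ∧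
          (∀ y, y ∈ s ↔ y ∈ t' ∨ G.Adj (x m) y) ∧ t' ∈ P t) := by
    intro s hs
    obtain ⟨M, x, X, Y, hc, e, htight, p₀, hp₀, hp₀Y, hlow⟩ := h s hs
    have hsE := hE' hs
    have hp₀2 := hfar s hs p₀ hp₀
    obtain ⟨p₁, h01, hp₁, hd₁, hlow₁⟩ := exists_upper H.tree hlow (by omega)
    have hp₀m : p₀ ≠ x m := by
      rintro rfl
      exact hp₁ (htight _ h01)
    obtain ⟨y, hy⟩ : Y.Nonempty := by
      rw [← Finset.card_pos, e.card_right]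
      omega
    have hp₀y : p₀ ≠ y := by
      rintro rfl
      exact hp₀Y hy
    have e1 : IsExt G M (x 1) (x m) (d 1 - 1) 0 (s.erase y) X (Y.erase y) := by
      have := e.erase_right hG hm hc hy
      rwa [hdm] at this
    have hconn := e1.conn hm hc
    have hys := e.mem_right hy
    have hp₀t : p₀ ∈ s.erase y := Finset.mem_erase.2 ⟨hp₀y, hp₀⟩
    have hp₁t : p₁ ∉ s.erase y := fun h => hp₁ (Finset.mem_of_mem_erase h)
    have hxy : G.Adj (x m) y := (e.right y hy).2
    have hrec := mem_iff_or_adj_erase (mem_iff_or_adj htight) hxy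
    have hup : UpStep G r (s.erase y) (insert p₁ (s.erase y)) :=
      upStep_insert (Finset.erase_subset _ _) hp₁ hlow₁
    have hpos := Finset.card_pos.2 ⟨y, hys⟩
    by_cases ht : insert p₁ (s.erase y) ∈ E
    · right
      by_cases hx : ∀ z, G.Adj (x (m - 1)) z → z ∈ s
      · left
        refine ⟨M, x, X, Y.erase y, s.erase y, _, ?_, hc, e1, hrec, hup⟩
        rcases H.tightStep_shift hm3 hdm hsE hc e hy hp₀ hp₀y hp₀m h01 hp₁ hlow₁ (by omega) ht hx
          with h1 | h1
        · exact Finset.mem_union_left _ ((hB₁ _).2 ⟨ht, h1⟩)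
        · exact Finset.mem_union_right _ ((hB₂ _).2 ⟨ht, h1⟩)
      · right
        push Not at hx
        obtain ⟨z, hqz, hz⟩ := hx
        have hzt : z ∉ s.erase y := fun h => hz (Finset.mem_of_mem_erase h)
        have hq : x (m - 1) ∈ s.erase y := e1.mem_spine hc (by omega) (by omega)
        have hd1 := H.first_eq_two hm3 hdm hsE hc e hy hp₀ hp₀y hp₀m h01 hp₁ ht
        have e2 : IsExt G M (x 1) (x m) 1 0 (s.erase y) X (Y.erase y) := by
          rwa [hd1] at e1
        refine ⟨M, x, X, Y.erase y, s.erase y, insert z (s.erase y), ?_, hc, e1, hrec, ?_⟩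
        · refine Finset.mem_filter.2 ⟨H.mem_of_sqDeg_ne hsE (hconn.insert hq hqz) ?_ ?_,
            Finset.card_image_le.trans (e2.card_endLeaves_insert_le hG H.deg hm3 hc hzt hqz)⟩
          · rw [Finset.card_insert_of_notMem hzt, Finset.card_erase_of_mem hys]
            omega
          · have h1 := sqDeg_insert hG hconn hzt hq hqz
            have h2 := sqDeg_insert hG hconn (Finset.notMem_erase y s)
              (e1.mem_spine hc (i := m) (by omega) le_rfl) hxy
            rw [Finset.insert_erase hys, e1.degIn_last hG hm hc] at h2
            rw [e1.degIn_mid hG hm hc (by omega) (by omega), H.deg.penult hm3] at h1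
            omega
        · exact Finset.mem_image.2 ⟨z, e1.mem_endLeaves_insert hG H.deg hm3 hc hzt hqz,
            Finset.erase_insert hzt⟩
    · left
      refine ⟨M, x, X, Y.erase y, s.erase y, _, ?_, hc, e1, hrec, hup⟩
      refine H.mem_of_notMem _ (hconn.insert hp₀t h01) ?_ ht
      rw [Finset.card_insert_of_notMem hp₁t, Finset.card_erase_of_mem hys, ← H.card_eq s hsE]
      omega
  have hA : ∀ F ⊆ E', (∀ s ∈ F, TightStep G d m 0 N (UpStep G r) s) → F.card ≤ 4 * N.card :=
    fun F _ hF => card_le_of_tightStep hG H.deg hR (Or.inl hm3) hF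
  refine (card_le_add_of_or key hA fun F _ hF => card_le_add_of_or (a := 32 * N.card)
    (b := 12 * N.card) hF (fun F' _ hF' => ?_) (fun F' _ hF' => ?_)).trans (by omega)
  · have := card_le_of_tightStep hG H.deg hR (Or.inl hm3) hF'
    omega
  · have h1 := card_le_of_tight hG H.deg (D := 3) P
      (fun t ht => (Finset.mem_filter.1 ht).2) (Or.inl hm3) hF'
    have h2 := Finset.card_filter_le N fun t => (P t).card ≤ 3
    omega

end Regrow

theorem choose_le_two_mul {D a : ℕ} (ha : 1 ≤ a) (haD : a < D) :
    D.choose a ≤ 2 * D.choose (a + 1) ∨ (2 ≤ a ∧ D.choose a ≤ 2 * D.choose (a - 1)) := by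
  have h1 := Nat.choose_succ_right_eq D a
  rcases le_or_gt (a + 1) (2 * (D - a)) with h | h
  · left
    refine Nat.le_of_mul_le_mul_right (c := D - a) ?_ (by omega)
    rw [← h1]
    nlinarith [Nat.mul_le_mul_left (D.choose (a + 1)) h]
  · right
    refine ⟨by omega, ?_⟩
    obtain ⟨b, rfl⟩ : ∃ b, a = b + 1 := ⟨a - 1, by omega⟩
    have h2 := Nat.choose_succ_right_eq D b
    refine Nat.le_of_mul_le_mul_right (c := b + 1) ?_ (by omega)
    rw [h2, Nat.add_sub_cancel]
    have h3 : D - b ≤ 2 * (b + 1) := by omega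
    nlinarith [Nat.mul_le_mul_left (D.choose b) h3]

section Lowest

variable {V : Type*} {G : SimpleGraph V} {d : ℕ → ℕ} {m k : ℕ} {M : Finset V} {x : ℕ → V}
  {j l : ℕ} {s t X Y : Finset V} {E N : Finset (Finset V)} {r : V}

open scoped Classical

theorem IsExt.nbrOut_eq [Fintype V] (hG : G.IsAcyclic) (hm : 2 ≤ m) (h : IsCore G d m M x)
    (e : IsExt G M (x 1) (x m) j l s X Y) (htight : ∀ y, G.Adj (x m) y → y ∈ s) :
    nbrOut G M (x m) = Y := by
  ext y
  rw [mem_nbrOut]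
  constructor
  · rintro ⟨h1, h2⟩
    rcases (e.mem_iff y).1 (htight y h1) with h3 | h3 | h3
    · exact absurd h3 h2
    · exact absurd ((h.conn hm).eq_of_adj hG h2 (h.mem 1 le_rfl (by omega))
        (h.mem m (by omega) le_rfl) (e.left y h3).2.symm h1.symm) (h.first_ne_last hm)
    · exact h3
  · intro h1
    exact ⟨(e.right y h1).2, (e.right y h1).1⟩

theorem IsFamily.card_le_of_lowest_of_choose_le [Fintype V] (H : IsFamily G d m k E N)
    {E' : Finset (Finset V)} (hE' : E' ⊆ E) (hdm : d m = 2) (hm3 : 3 ≤ m) (hd1 : 3 ≤ d 1)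
    (hfar : ∀ s ∈ E', ∀ y ∈ s, 1 ≤ G.dist r y)
    (h : ∀ s ∈ E', ∃ M x X Y, IsCore G d m M x ∧
      IsExt G M (x 1) (x m) (d 1 - 1) (d m - 1) s X Y ∧ (∀ y, G.Adj (x m) y → y ∈ s) ∧
      (nbrOut G M (x 1)).card.choose (d 1 - 1) ≤
        2 * (nbrOut G M (x 1)).card.choose (d 1 - 1 - 1) ∧
      ∃ p ∈ Y, ∀ y ∈ s, G.dist r p ≤ G.dist r y) :
    E'.card ≤ 8 * N.card := by
  have hm := H.deg.two_le
  have hG := H.tree.2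
  let Q : Finset V × V × V → V → Prop := fun c p =>
    ∀ t ∈ extSets G c.1 c.2.1 c.2.2 (d 1 - 1 - 1) 1,
      p ∉ t ∧ (∀ y ∈ t, G.dist r p < G.dist r y) ∧ insert p t ∈ N
  obtain ⟨C, hC⟩ : ∃ C : Finset (Finset V × V × V), ∀ c, c ∈ C ↔ (IsCoreTriple G d m c ∧
      (nbrOut G c.1 c.2.1).card.choose (d 1 - 1) ≤
        2 * (nbrOut G c.1 c.2.1).card.choose (d 1 - 1 - 1) ∧ ∃ p, Q c p) :=
    ⟨Finset.univ.filter fun c => IsCoreTriple G d m c ∧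
      (nbrOut G c.1 c.2.1).card.choose (d 1 - 1) ≤
        2 * (nbrOut G c.1 c.2.1).card.choose (d 1 - 1 - 1) ∧ ∃ p, Q c p, fun c => by simp⟩
  rcases E'.eq_empty_or_nonempty with rfl | ⟨s₀, hs₀⟩
  · simp
  have : Nonempty V := by
    obtain ⟨M, x, -⟩ := h s₀ hs₀
    exact ⟨x 0⟩
  have hp : ∀ c ∈ C, ∃ p, Q c p := fun c hc => ((hC c).1 hc).2.2
  choose! p hp using hp
  refine card_le_of_groups (C := C) (K := 2) (D := 4)
    (F := fun c => extSets G c.1 c.2.1 c.2.2 (d 1 - 1) 1)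
    (T := fun c => (extSets G c.1 c.2.1 c.2.2 (d 1 - 1 - 1) 1).image (insert (p c))) ?_ ?_ ?_ ?_
  · intro s hs
    obtain ⟨M, x, X, Y, hc, e, htight, hle, q, hq, hlow⟩ := h s hs
    rw [hdm] at e
    refine ⟨(M, x 1, x m), (hC _).2 ⟨⟨x, hc, rfl, rfl⟩, hle, ?_⟩, mem_extSets.2 ⟨X, Y, e⟩⟩
    have hqs := e.mem_right hq
    obtain ⟨p₁, h01, hp₁, hd₁, -⟩ := exists_upper H.tree hlow (hfar s hs q hqs)
    refine ⟨p₁, fun t ht => ?_⟩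
    obtain ⟨X', Y', e'⟩ := mem_extSets.1 ht
    dsimp only at e'
    have hYY : Y' ⊆ Y := by
      rw [← e.nbrOut_eq hG hm hc htight]
      exact fun z hz => mem_nbrOut.2 (e'.right z hz).symm
    have hYY' : Y' = Y := Finset.eq_of_subset_of_card_le hYY (by
      rw [e.card_right, e'.card_right])
    subst hYY'
    have hp₁t : p₁ ∉ t := by
      intro h1
      rcases (e'.mem_iff _).1 h1 with h2 | h2 | h2
      · exact hp₁ ((e.mem_iff _).2 (Or.inl h2))
      · have h3 := (e.conn hm hc).eq_of_adj hG hp₁ hqs (e.mem_spine hc le_rfl (by omega))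
          h01.symm (e'.left _ h2).2.symm
        apply (e.right _ hq).1
        rw [h3]
        exact hc.mem 1 le_rfl (by omega)
      · exact hp₁ (e.mem_right h2)
    have hqt := e'.mem_right hq
    have hconn := e'.conn hm hc
    refine ⟨hp₁t, dist_lt_of_connIn H.tree hconn hp₁t hqt h01 (by omega),
      H.mem_of_sqDeg_ne (hE' hs) (hconn.insert hqt h01) ?_ ?_⟩
    · rw [Finset.card_insert_of_notMem hp₁t, e'.card hG hm hc, e.card hG hm hc]
      omega
    · rw [sqDeg_insert hG hconn hp₁t hqt h01, e'.degIn_right hG hm hc hq, e'.sqDeg_eq hG hm hc,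
        e.sqDeg_eq hG hm hc]
      obtain ⟨a, ha⟩ : ∃ a, d 1 = a + 3 := ⟨d 1 - 3, by omega⟩
      rw [ha]
      simp only [show a + 3 - 1 = a + 2 by omega, show a + 2 - 1 = a + 1 by omega]
      intro h
      nlinarith
  · intro c hc
    obtain ⟨⟨x, hx, hx1, hxm⟩, hle, -⟩ := (hC c).1 hc
    rw [Finset.card_image_of_injOn]
    · rw [← hx1] at hle
      rw [← hx1, ← hxm, card_extSets hG hm hx, card_extSets hG hm hx, ← mul_assoc]
      exact Nat.mul_le_mul_right _ hle
    · intro t ht t' ht' heq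
      have h1 := (hp c hc t ht).1
      have h2 := (hp c hc t' ht').1
      rw [← Finset.erase_insert h1, heq, Finset.erase_insert h2]
  · intro c hc t ht
    obtain ⟨t', ht', rfl⟩ := Finset.mem_image.1 ht
    exact (hp c hc t' ht').2.2
  · intro t ht C' hC' h1
    rcases C'.eq_empty_or_nonempty with rfl | ⟨c₀, hc₀⟩
    · simp
    obtain ⟨t₀, ht₀, hte⟩ := Finset.mem_image.1 (h1 c₀ hc₀)
    have hup : ∀ c ∈ C', ∀ t' ∈ extSets G c.1 c.2.1 c.2.2 (d 1 - 1 - 1) 1,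
        insert (p c) t' = t → UpStep G r t' t := fun c hc t' ht' he =>
      ⟨p c, (hp c (hC' hc) t' ht').1, (hp c (hC' hc) t' ht').2.1, he.symm⟩
    refine card_cores_le_four (t := t₀) (j := d 1 - 1 - 1) (l := 1) hG H.deg (fun c hc => ?_)
      (by omega)
    obtain ⟨t', ht', he⟩ := Finset.mem_image.1 (h1 c hc)
    obtain rfl : t' = t₀ := UpStep.unique (hup c hc t' ht' he) (hup c₀ hc₀ t₀ ht₀ hte)
    exact ⟨((hC c).1 (hC' hc)).1, mem_extSets.1 ht'⟩

/-- Members of the family that contain all neighbours of an end of the spine whose single leaf is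
closest to the root, provided that the other end has further neighbours in the host tree. -/
theorem IsFamily.card_le_of_lowest [Fintype V] (H : IsFamily G d m k E N)
    {E' : Finset (Finset V)} (hE' : E' ⊆ E) (hdm : d m = 2) (hm3 : 3 ≤ m)
    (hfar : ∀ s ∈ E', ∀ y ∈ s, 1 ≤ G.dist r y)
    (h : ∀ s ∈ E', ∃ M x X Y, IsCore G d m M x ∧
      IsExt G M (x 1) (x m) (d 1 - 1) (d m - 1) s X Y ∧ (∀ y, G.Adj (x m) y → y ∈ s) ∧
      d 1 - 1 < (nbrOut G M (x 1)).card ∧ ∃ p ∈ Y, ∀ y ∈ s, G.dist r p ≤ G.dist r y) :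
    E'.card ≤ 16 * N.card := by
  have hm := H.deg.two_le
  have hG := H.tree.2
  have hd1 := H.deg.first
  have key : ∀ s ∈ E', (∃ M x X Y, IsCore G d m M x ∧
      IsExt G M (x 1) (x m) (d 1 - 1) (d m - 1) s X Y ∧
      (nbrOut G M (x 1)).card.choose (d 1 - 1) * (nbrOut G M (x m)).card.choose (d m - 1) ≤
        2 * ((nbrOut G M (x 1)).card.choose (d 1) * (nbrOut G M (x m)).card.choose 0)) ∨
      (3 ≤ d 1 ∧ ∃ M x X Y, IsCore G d m M x ∧
      IsExt G M (x 1) (x m) (d 1 - 1) (d m - 1) s X Y ∧ (∀ y, G.Adj (x m) y → y ∈ s) ∧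
      (nbrOut G M (x 1)).card.choose (d 1 - 1) ≤
        2 * (nbrOut G M (x 1)).card.choose (d 1 - 1 - 1) ∧
      ∃ p ∈ Y, ∀ y ∈ s, G.dist r p ≤ G.dist r y) := by
    intro s hs
    obtain ⟨M, x, X, Y, hc, e, htight, hloose, hlow⟩ := h s hs
    rcases choose_le_two_mul (by omega) hloose with h1 | ⟨h1, h2⟩
    · left
      refine ⟨M, x, X, Y, hc, e, ?_⟩
      rw [e.nbrOut_eq hG hm hc htight, e.card_right, hdm]
      rw [Nat.sub_add_cancel (by omega)] at h1
      simpa using h1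
    · exact Or.inr ⟨by omega, M, x, X, Y, hc, e, htight, h2, hlow⟩
  refine (card_le_add_of_or (a := 8 * N.card) (b := 8 * N.card) key (fun F hF hF' => ?_)
    (fun F hF hF' => ?_)).trans (by omega)
  · have := H.card_le_of_choose_le (hF.trans hE') (K := 2) (by omega) (by omega) (by omega)
      (Or.inl hm3) hF'
    omega
  · rcases F.eq_empty_or_nonempty with rfl | ⟨s₀, hs₀⟩
    · simp
    exact H.card_le_of_lowest_of_choose_le (hF.trans hE') hdm hm3 (hF' s₀ hs₀).1
      (fun s hs => hfar s (hF hs)) fun s hs => (hF' s hs).2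

end Lowest

/-- The set `s` contains all neighbours of the last spine vertex, and if there is only one leaf at
this vertex then it is not closest to the root `r` or the first spine vertex has further neighbours
in `G`. -/
def IsGood {V : Type*} [Fintype V] (G : SimpleGraph V) (d : ℕ → ℕ) (m : ℕ) (r : V)
    (s : Finset V) : Prop :=
  ∃ M x X Y, IsCore G d m M x ∧ IsExt G M (x 1) (x m) (d 1 - 1) (d m - 1) s X Y ∧
    (∀ y, G.Adj (x m) y → y ∈ s) ∧
    ((∃ p ∈ s, p ∉ Y ∧ ∀ y ∈ s, G.dist r p ≤ G.dist r y) ∨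
      (d 1 - 1 < (nbrOut G M (x 1)).card ∧ ∃ p ∈ Y, ∀ y ∈ s, G.dist r p ≤ G.dist r y))

section Combine

variable {V : Type*} [Fintype V] {G : SimpleGraph V} {d : ℕ → ℕ} {m k : ℕ} {M : Finset V}
  {x : ℕ → V} {j l : ℕ} {s t X Y : Finset V} {E N : Finset (Finset V)} {r : V}

open scoped Classical

theorem IsFamily.card_le_of_isGood (H : IsFamily G d m k E N) {E' : Finset (Finset V)}
    (hE' : E' ⊆ E) (hpos : 3 ≤ m ∨ (3 ≤ d 1 ∧ 3 ≤ d m))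
    (hfar : ∀ s ∈ E', ∀ y ∈ s, 2 ≤ G.dist r y) (h : ∀ s ∈ E', IsGood G d m r s) :
    E'.card ≤ 64 * N.card := by
  have hdm := H.deg.last
  rcases Nat.lt_or_ge (d m) 3 with h3 | h3
  · have hdm : d m = 2 := by omega
    have hm3 : 3 ≤ m := by omega
    refine (card_le_add_of_or (a := 48 * N.card) (b := 16 * N.card)
      (A := fun s => ∃ M x X Y, IsCore G d m M x ∧
        IsExt G M (x 1) (x m) (d 1 - 1) (d m - 1) s X Y ∧ (∀ y, G.Adj (x m) y → y ∈ s) ∧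
        ∃ p ∈ s, p ∉ Y ∧ ∀ y ∈ s, G.dist r p ≤ G.dist r y)
      (B := fun s => ∃ M x X Y, IsCore G d m M x ∧
        IsExt G M (x 1) (x m) (d 1 - 1) (d m - 1) s X Y ∧ (∀ y, G.Adj (x m) y → y ∈ s) ∧
        d 1 - 1 < (nbrOut G M (x 1)).card ∧ ∃ p ∈ Y, ∀ y ∈ s, G.dist r p ≤ G.dist r y)
      (fun s hs => ?_) (fun F hF hF' => ?_) (fun F hF hF' => ?_)).trans (by omega)
    · obtain ⟨M, x, X, Y, hc, e, htight, h1 | h1⟩ := h s hs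
      · exact Or.inl ⟨M, x, X, Y, hc, e, htight, h1⟩
      · exact Or.inr ⟨M, x, X, Y, hc, e, htight, h1⟩
    · exact H.card_le_of_eq_two (hF.trans hE') hdm hm3 (fun s hs => hfar s (hF hs)) hF'
    · exact H.card_le_of_lowest (hF.trans hE') hdm hm3
        (fun s hs y hy => (by norm_num : 1 ≤ 2).trans (hfar s (hF hs) y hy)) hF'
  · have := H.card_le_of_three_le hE' h3 (by omega) hfar fun s hs => by
      obtain ⟨M, x, X, Y, hc, e, htight, -⟩ := h s hs
      exact ⟨M, x, X, Y, hc, e, htight⟩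
    omega

theorem IsExt.mem_of_card_nbrOut_le {u w : V} (e : IsExt G M u w j l s X Y)
    (hle : (nbrOut G M w).card ≤ l) : ∀ y, G.Adj w y → y ∈ s := by
  intro y hy
  have h1 : Y = nbrOut G M w := by
    refine Finset.eq_of_subset_of_card_le (fun z hz => mem_nbrOut.2 (e.right z hz).symm) ?_
    rwa [e.card_right]
  rw [e.mem_iff, h1, mem_nbrOut]
  tauto

theorem IsExt.isGood_of_lt (hs : s.Nonempty) (h : IsCore G d m M x)
    (e : IsExt G M (x 1) (x m) (d 1 - 1) (d m - 1) s X Y)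
    (h1 : d 1 - 1 < (nbrOut G M (x 1)).card) (h2 : (nbrOut G M (x m)).card ≤ d m - 1) :
    IsGood G d m r s := by
  obtain ⟨p, hp, hlow⟩ := exists_lowest (G := G) (r := r) hs
  refine ⟨M, x, X, Y, h, e, e.mem_of_card_nbrOut_le h2, ?_⟩
  by_cases hpY : p ∈ Y
  · exact Or.inr ⟨h1, p, hpY, hlow⟩
  · exact Or.inl ⟨p, hp, hpY, hlow⟩

theorem IsFamily.loose_or_isGood (H : IsFamily G d m k E N) (hs : s ∈ E) (r : V) :
    (∃ M x X Y, IsCore G d m M x ∧ IsExt G M (x 1) (x m) (d 1 - 1) (d m - 1) s X Y ∧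
      d 1 - 1 < (nbrOut G M (x 1)).card ∧ d m - 1 < (nbrOut G M (x m)).card) ∨
    (IsGood G d m r s ∨ IsGood G (fun i => d (m + 1 - i)) m r s) := by
  have hm := H.deg.two_le
  obtain ⟨M, x, X, Y, hc, e⟩ := H.decomp s hs
  have hne := (e.conn hm hc).nonempty
  have e' : IsExt G M ((fun i => x (m + 1 - i)) 1) ((fun i => x (m + 1 - i)) m)
      ((fun i => d (m + 1 - i)) 1 - 1) ((fun i => d (m + 1 - i)) m - 1) s Y X := by
    simpa using e.reverse
  rcases Nat.lt_or_ge (d 1 - 1) (nbrOut G M (x 1)).card with h1 | h1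
  · rcases Nat.lt_or_ge (d m - 1) (nbrOut G M (x m)).card with h2 | h2
    · exact Or.inl ⟨M, x, X, Y, hc, e, h1, h2⟩
    · exact Or.inr (Or.inl (e.isGood_of_lt hne hc h1 h2))
  · rcases Nat.lt_or_ge (d m - 1) (nbrOut G M (x m)).card with h2 | h2
    · refine Or.inr (Or.inr (IsExt.isGood_of_lt hne hc.reverse e' ?_ ?_))
      · simpa using h2
      · simpa using h1
    · right
      obtain ⟨p, hp, hlow⟩ := exists_lowest (G := G) (r := r) hne
      by_cases hpY : p ∈ Y
      · right
        refine ⟨M, _, Y, X, hc.reverse, e', e'.mem_of_card_nbrOut_le ?_, Or.inl ⟨p, hp, ?_, hlow⟩⟩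
        · simpa using h1
        · intro hpX
          exact (e.right_union H.tree.2 hm hc p hpY).1 (Finset.mem_union_right _ hpX)
      · left
        exact ⟨M, x, X, Y, hc, e, e.mem_of_card_nbrOut_le h2, Or.inl ⟨p, hp, hpY, hlow⟩⟩

theorem IsFamily.card_le (H : IsFamily G d m k E N) (hpos : 3 ≤ m ∨ (3 ≤ d 1 ∧ 3 ≤ d m))
    {r₁ r₂ : V} (hr : ∀ s ∈ E, (∀ y ∈ s, 2 ≤ G.dist r₁ y) ∨ (∀ y ∈ s, 2 ≤ G.dist r₂ y)) :
    E.card ≤ 384 * N.card := by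
  have key : ∀ r, ∀ F ⊆ E, (∀ s ∈ F, (∀ y ∈ s, 2 ≤ G.dist r y) ∧
      (IsGood G d m r s ∨ IsGood G (fun i => d (m + 1 - i)) m r s)) →
      F.card ≤ 128 * N.card := by
    intro r F hF h
    refine (card_le_add_of_or (a := 64 * N.card) (b := 64 * N.card) (fun s hs => (h s hs).2)
      (fun F' hF' h' => ?_) (fun F' hF' h' => ?_)).trans (by omega)
    · exact H.card_le_of_isGood (hF'.trans hF) hpos (fun s hs => (h s (hF' hs)).1) h'
    · refine H.reverse.card_le_of_isGood (hF'.trans hF) ?_ (fun s hs => (h s (hF' hs)).1) h'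
      simpa [and_comm] using hpos
  refine (card_le_add_of_or (a := 128 * N.card) (b := 256 * N.card)
    (A := fun s => ∃ M x X Y, IsCore G d m M x ∧
      IsExt G M (x 1) (x m) (d 1 - 1) (d m - 1) s X Y ∧
      d 1 - 1 < (nbrOut G M (x 1)).card ∧ d m - 1 < (nbrOut G M (x m)).card)
    (B := fun s => ((∀ y ∈ s, 2 ≤ G.dist r₁ y) ∧
      (IsGood G d m r₁ s ∨ IsGood G (fun i => d (m + 1 - i)) m r₁ s)) ∨
      ((∀ y ∈ s, 2 ≤ G.dist r₂ y) ∧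
      (IsGood G d m r₂ s ∨ IsGood G (fun i => d (m + 1 - i)) m r₂ s)))
    (fun s hs => ?_) (fun F hF h => H.card_le_of_loose hF hpos h) fun F hF h =>
      (card_le_add_of_or h (fun F' hF' h' => key r₁ F' (hF'.trans hF) h')
        fun F' hF' h' => key r₂ F' (hF'.trans hF) h').trans (by omega)).trans (by omega)
  rcases hr s hs with h1 | h1
  · rcases H.loose_or_isGood hs r₁ with h2 | h2
    · exact Or.inl h2
    · exact Or.inr (Or.inl ⟨h1, h2⟩)
  · rcases H.loose_or_isGood hs r₂ with h2 | h2
    · exact Or.inl h2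
    · exact Or.inr (Or.inr ⟨h1, h2⟩)

end Combine

/-- The vertex sets consisting of `u`, of `p`, of `Q` and of `j` further neighbours of `u`. -/
noncomputable def hubSets {V : Type*} [Fintype V] (G : SimpleGraph V) (u : V) (p Q : Finset V)
    (j : ℕ) : Finset (Finset V) :=
  open scoped Classical in
  ((nbrOut G Q u).powersetCard j).image fun X => insert u (p ∪ (Q ∪ X))

theorem mul_choose_le {a e n q : ℕ} (ha : 7 ≤ a) (hq : n * n ≤ 4 * q) :
    n * (a + e).choose a ≤ 2 * ((a + 1 + e).choose (a + 2) + q * (a + 1 + e - 2).choose (a - 2)) := by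
  obtain ⟨b, rfl⟩ : ∃ b, a = b + 2 := ⟨a - 2, by omega⟩
  rcases Nat.eq_zero_or_pos e with rfl | he
  · simp only [add_zero, Nat.choose_self, mul_one, Nat.add_sub_cancel,
      show b + 2 + 1 - 2 = b + 1 by omega, Nat.choose_succ_self_right]
    nlinarith [Nat.zero_le ((b + 2 + 1).choose (b + 2 + 2)), Nat.mul_le_mul_left q ha]
  · simp only [Nat.add_sub_cancel, show b + 2 + 1 + e - 2 = b + 1 + e by omega]
    have h1 := Nat.add_one_mul_choose_eq (b + 2 + e) (b + 3)
    have h2 := Nat.choose_succ_right_eq (b + 2 + e) (b + 2)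
    have h3 := Nat.choose_succ_right_eq (b + 2 + e) (b + 1)
    have h4 := Nat.add_one_mul_choose_eq (b + 1 + e) b
    rw [show b + 2 + e - (b + 2) = e by omega] at h2
    rw [show b + 2 + e - (b + 1) = e + 1 by omega] at h3
    rw [show b + 2 + e + 1 = b + 2 + 1 + e by omega, show b + 3 + 1 = b + 2 + 2 by omega] at h1
    rw [show b + 1 + e + 1 = b + 2 + e by omega] at h4
    rw [show b + 2 + 1 = b + 3 by omega] at h2
    rw [show b + 1 + 1 = b + 2 by omega] at h3
    set A := (b + 2 + 1 + e).choose (b + 2 + 2)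
    set B := (b + 1 + e).choose b
    set P := (b + 2 + e).choose (b + 2)
    set P₁ := (b + 2 + e).choose (b + 3)
    set P₂ := (b + 2 + e).choose (b + 1)
    have hA : A * ((b + 4) * (b + 3)) = (b + 3 + e) * e * P := by
      zify at h1 h2 ⊢
      linear_combination (-(b + 3) : ℤ) * h1 + (b + 3 + e : ℤ) * h2
    have hB : B * ((b + 2 + e) * (e + 1)) = (b + 2) * (b + 1) * P := by
      zify at h3 h4 ⊢
      linear_combination (e + 1 : ℤ) * h4 - (b + 1 : ℤ) * h3
    have hP : P * P ≤ 4 * (A * B) := by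
      have h5 : (b + 4) * (b + 3) * ((b + 2 + e) * (e + 1)) ≤
          4 * ((b + 3 + e) * e * ((b + 2) * (b + 1))) := by
        have h6 : (b + 4) * (b + 3) ≤ 2 * ((b + 2) * (b + 1)) := by nlinarith
        have h7 : (b + 2 + e) * (e + 1) ≤ 2 * ((b + 3 + e) * e) := by nlinarith
        calc _ ≤ _ := Nat.mul_le_mul h6 h7
          _ = _ := by ring
      refine Nat.le_of_mul_le_mul_right (c := (b + 4) * (b + 3) * ((b + 2 + e) * (e + 1))) ?_
        (by positivity)
      calc P * P * ((b + 4) * (b + 3) * ((b + 2 + e) * (e + 1)))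
          ≤ P * P * (4 * ((b + 3 + e) * e * ((b + 2) * (b + 1)))) := Nat.mul_le_mul_left _ h5
        _ = 4 * ((b + 3 + e) * e * P) * ((b + 2) * (b + 1) * P) := by ring
        _ = 4 * (A * B) * ((b + 4) * (b + 3) * ((b + 2 + e) * (e + 1))) := by
          rw [← hA, ← hB]
          ring
    refine Nat.mul_self_le_mul_self_iff.1 ?_
    calc n * P * (n * P) = n * n * (P * P) := by ring
      _ ≤ 4 * q * (4 * (A * B)) := Nat.mul_le_mul hq hP
      _ ≤ 2 * (A + q * B) * (2 * (A + q * B)) := by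
        zify
        nlinarith [sq_nonneg ((A : ℤ) - q * B)]

theorem eq_of_common_adj {V : Type*} {G : SimpleGraph V} (hG : G.IsAcyclic) {u x y z : V}
    (hux : x ≠ u) (h1 : G.Adj u y)
    (h2 : G.Adj u z) (h3 : G.Adj x y) (h4 : G.Adj x z) : y = z := by
  classical
  have hc := ((connIn_singleton (G := G) u).insert (Finset.mem_singleton_self u) h1).insert
    (Finset.mem_insert_of_mem (Finset.mem_singleton_self u)) h2
  refine hc.eq_of_adj hG ?_ ?_ ?_ h3 h4
  · simp [hux, h3.ne, h4.ne]
  · simp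
  · simp

section Hub

variable {V : Type*} [Fintype V] {G : SimpleGraph V} {u : V} {p Q t : Finset V} {j : ℕ}

open scoped Classical

theorem mem_hubSets : t ∈ hubSets G u p Q j ↔
    ∃ X, (∀ z ∈ X, G.Adj u z ∧ z ∉ Q) ∧ X.card = j ∧ t = insert u (p ∪ (Q ∪ X)) := by
  unfold hubSets
  rw [Finset.mem_image]
  constructor
  · rintro ⟨X, hX, rfl⟩
    rw [Finset.mem_powersetCard] at hX
    exact ⟨X, fun z hz => mem_nbrOut.1 (hX.1 hz), hX.2, rfl⟩
  · rintro ⟨X, hX, hj, rfl⟩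
    exact ⟨X, Finset.mem_powersetCard.2 ⟨fun z hz => mem_nbrOut.2 (hX z hz), hj⟩, rfl⟩

theorem card_nbrOut_of_adj (hQ : ∀ z ∈ Q, G.Adj u z) :
    (nbrOut G Q u).card = (nbrOut G ∅ u).card - Q.card := by
  rw [← Finset.card_sdiff_of_subset fun z hz => mem_nbrOut.2 ⟨hQ z hz, Finset.notMem_empty z⟩]
  congr 1
  ext z
  simp [mem_nbrOut]

theorem mem_of_mem_hubSets (hp : ∀ z ∈ p, z ≠ u ∧ ¬ G.Adj u z) (hQ : ∀ z ∈ Q, G.Adj u z)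
    (ht : t ∈ hubSets G u p Q j) (z : V) : z ∈ p ↔ z ∈ t ∧ z ≠ u ∧ ¬ G.Adj u z := by
  obtain ⟨X, hX, -, rfl⟩ := mem_hubSets.1 ht
  simp only [Finset.mem_insert, Finset.mem_union]
  constructor
  · intro h
    exact ⟨Or.inr (Or.inl h), hp z h⟩
  · rintro ⟨h1 | h1 | h1 | h1, h2, h3⟩
    · exact absurd h1 h2
    · exact h1
    · exact absurd (hQ z h1) h3
    · exact absurd (hX z h1).1 h3

theorem card_hubSets (hp : ∀ z ∈ p, z ≠ u ∧ ¬ G.Adj u z) (hQ : ∀ z ∈ Q, G.Adj u z) :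
    (hubSets G u p Q j).card = ((nbrOut G ∅ u).card - Q.card).choose j := by
  unfold hubSets
  rw [Finset.card_image_of_injOn, Finset.card_powersetCard, card_nbrOut_of_adj hQ]
  have key : ∀ X, (∀ z ∈ X, z ∈ nbrOut G Q u) →
      ∀ z, z ∈ X ↔ z ∈ insert u (p ∪ (Q ∪ X)) ∧ G.Adj u z ∧ z ∉ Q := by
    intro X hX z
    simp only [Finset.mem_insert, Finset.mem_union]
    constructor
    · intro h
      exact ⟨Or.inr (Or.inr (Or.inr h)), mem_nbrOut.1 (hX z h)⟩
    · rintro ⟨rfl | h1 | h1 | h1, h2, h3⟩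
      · exact absurd h2 (G.loopless.irrefl _)
      · exact absurd h2 (hp z h1).2
      · exact absurd h1 h3
      · exact h1
  intro X hX X' hX' heq
  rw [Finset.mem_coe, Finset.mem_powersetCard] at hX hX'
  dsimp only at heq
  ext z
  rw [key X hX.1 z, key X' hX'.1 z, heq]

theorem degIn_hub (hp : ∀ z ∈ p, z ≠ u ∧ ¬ G.Adj u z) (hQ : ∀ z ∈ Q, G.Adj u z)
    (ht : t ∈ hubSets G u p Q j) : degIn G t u = Q.card + j := by
  obtain ⟨X, hX, rfl, rfl⟩ := mem_hubSets.1 ht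
  unfold degIn
  rw [← Finset.card_union_of_disjoint (Finset.disjoint_right.2 fun z hz => (hX z hz).2)]
  congr 1
  ext z
  simp only [Finset.mem_filter, Finset.mem_insert, Finset.mem_union]
  constructor
  · rintro ⟨rfl | h1 | h1, h2⟩
    · exact absurd h2 (G.loopless.irrefl _)
    · exact absurd h2 (hp z h1).2
    · exact h1
  · intro h
    refine ⟨Or.inr (Or.inr h), ?_⟩
    rcases h with h | h
    · exact hQ z h
    · exact (hX z h).1

theorem card_of_mem_hubSets (hp : ∀ z ∈ p, z ≠ u ∧ ¬ G.Adj u z) (hQ : ∀ z ∈ Q, G.Adj u z)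
    (ht : t ∈ hubSets G u p Q j) : t.card = 1 + p.card + Q.card + j := by
  obtain ⟨X, hX, rfl, rfl⟩ := mem_hubSets.1 ht
  have h1 : Disjoint Q X := Finset.disjoint_right.2 fun z hz => (hX z hz).2
  have h2 : Disjoint p (Q ∪ X) := by
    rw [Finset.disjoint_left]
    intro z hz h
    rcases Finset.mem_union.1 h with h | h
    · exact (hp z hz).2 (hQ z h)
    · exact (hp z hz).2 (hX z h).1
  have h3 : u ∉ p ∪ (Q ∪ X) := by
    simp only [Finset.mem_union]
    rintro (h | h | h)
    · exact (hp u h).1 rfl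
    · exact G.loopless.irrefl _ (hQ u h)
    · exact G.loopless.irrefl _ (hX u h).1
  rw [Finset.card_insert_of_notMem h3, Finset.card_union_of_disjoint h2,
    Finset.card_union_of_disjoint h1]
  omega

theorem connIn_hub (hc : ConnIn G (insert u (p ∪ Q))) (ht : t ∈ hubSets G u p Q j) :
    ConnIn G t := by
  obtain ⟨X, hX, rfl, rfl⟩ := mem_hubSets.1 ht
  have := connIn_union hc (Finset.mem_insert_self _ _) fun z hz => (hX z hz).1
  rwa [Finset.insert_union, Finset.union_assoc] at this

theorem degIn_hub_le (hG : G.IsAcyclic) (hQ : ∀ z ∈ Q, G.Adj u z)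
    (ht : t ∈ hubSets G u p Q j) {x : V} (hx : x ≠ u) : degIn G t x ≤ p.card + 2 := by
  obtain ⟨X, hX, rfl, rfl⟩ := mem_hubSets.1 ht
  unfold degIn
  calc _ ≤ (insert u (p ∪ (Q ∪ X).filter (G.Adj x))).card := by
        refine Finset.card_le_card fun z hz => ?_
        simp only [Finset.mem_filter, Finset.mem_insert, Finset.mem_union] at hz ⊢
        tauto
    _ ≤ (p ∪ (Q ∪ X).filter (G.Adj x)).card + 1 := Finset.card_insert_le _ _
    _ ≤ p.card + ((Q ∪ X).filter (G.Adj x)).card + 1 :=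
        Nat.add_le_add_right (Finset.card_union_le _ _) _
    _ ≤ p.card + 1 + 1 := by
        have hadj : ∀ z ∈ Q ∪ X, G.Adj u z := by
          intro z hz
          rcases Finset.mem_union.1 hz with h | h
          · exact hQ z h
          · exact (hX z h).1
        have : ((Q ∪ X).filter (G.Adj x)).card ≤ 1 := by
          rw [Finset.card_le_one]
          intro y hy z hz
          rw [Finset.mem_filter] at hy hz
          exact eq_of_common_adj hG hx (hadj y hy.1) (hadj z hz.1) hy.2 hz.2
        omega
    _ = _ := by ring

/-- If there are `n` vertices at distance two from `u` and a vertex at distance three, then there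
are at least `n ^ 2 / 4` pairs of vertices which can be connected to `u` through two neighbours of
`u`. -/
theorem exists_pairs (hG : G.IsTree) {L : Finset V}
    (hL : ∀ y, y ∈ L ↔ y ≠ u ∧ ¬ G.Adj u y ∧ ∃ w, G.Adj u w ∧ G.Adj w y)
    (hu : 2 ≤ (nbrOut G ∅ u).card) (hrad : ∃ w, 3 ≤ G.dist u w) :
    ∃ P : Finset (Finset V), L.card * L.card ≤ 4 * P.card ∧ ∀ p ∈ P, p.card = 2 ∧
      (∀ z ∈ p, z ≠ u ∧ ¬ G.Adj u z) ∧
      ∃ Q : Finset V, Q.card = 2 ∧ (∀ z ∈ Q, G.Adj u z) ∧ ConnIn G (insert u (p ∪ Q)) := by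
  have hQ : ∀ Q₀ : Finset V, (∀ z ∈ Q₀, G.Adj u z) → Q₀.card ≤ 2 →
      ∃ Q, Q₀ ⊆ Q ∧ Q.card = 2 ∧ ∀ z ∈ Q, G.Adj u z := by
    intro Q₀ h1 h2
    obtain ⟨Q, h3, h4, h5⟩ := Finset.exists_subsuperset_card_eq (s := Q₀) (t := nbrOut G ∅ u)
      (fun z hz => mem_nbrOut.2 ⟨h1 z hz, Finset.notMem_empty z⟩) h2 hu
    exact ⟨Q, h3, h5, fun z hz => (mem_nbrOut.1 (h4 hz)).1⟩
  have hstar : ∀ Q : Finset V, (∀ z ∈ Q, G.Adj u z) → ConnIn G (insert u Q) := by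
    intro Q h
    have := connIn_union (connIn_singleton (G := G) u) (Finset.mem_singleton_self u) h
    rwa [← Finset.insert_eq] at this
  rcases Nat.lt_or_ge L.card 2 with hL2 | hL2
  · obtain ⟨w, hw⟩ := hrad
    obtain ⟨q, -, hq⟩ : ∃ q : G.Walk u w, True ∧ q.length = G.dist u w := by
      obtain ⟨q, hq⟩ := hG.1.exists_walk_length_eq_dist u w
      exact ⟨q, trivial, hq⟩
    have hadj : ∀ i < 3, G.Adj (q.getVert i) (q.getVert (i + 1)) := fun i hi =>
      q.adj_getVert_succ (by omega)
    have hd : ∀ i ≤ 3, G.dist u (q.getVert i) = i := by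
      intro i hi
      have h1 := G.dist_le (q.take i)
      have h2 := G.dist_le (q.drop i)
      have h3 := hG.1.dist_triangle (u := u) (v := q.getVert i) (w := w)
      rw [Walk.take_length] at h1
      rw [Walk.drop_length] at h2
      omega
    have h0 := hadj 0 (by norm_num)
    rw [q.getVert_zero] at h0
    have h1 := hadj 1 (by norm_num)
    have h2 := hadj 2 (by norm_num)
    have hd2 := hd 2 (by norm_num)
    have hd3 := hd 3 le_rfl
    simp only [zero_add, Nat.reduceAdd] at h0 h1 h2
    have hfar : ∀ z, 2 ≤ G.dist u z → z ≠ u ∧ ¬ G.Adj u z := by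
      intro z hz
      refine ⟨?_, fun h => ?_⟩
      · rintro rfl
        simp at hz
      · rw [SimpleGraph.dist_eq_one_iff_adj.2 h] at hz
        omega
    refine ⟨{{q.getVert 2, q.getVert 3}}, ?_, ?_⟩
    · rw [Finset.card_singleton]
      nlinarith
    · intro p hp
      rw [Finset.mem_singleton] at hp
      subst hp
      refine ⟨Finset.card_pair h2.ne, ?_, ?_⟩
      · intro z hz
        rw [Finset.mem_insert, Finset.mem_singleton] at hz
        rcases hz with rfl | rfl
        · exact hfar _ (by omega)
        · exact hfar _ (by omega)
      · obtain ⟨Q, hQ0, hQ2, hQadj⟩ := hQ {q.getVert 1} (by simpa using h0) (by simp)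
        refine ⟨Q, hQ2, hQadj, ?_⟩
        have h3 := ((hstar Q hQadj).insert (Finset.mem_insert_of_mem
          (hQ0 (Finset.mem_singleton_self _))) h1).insert (Finset.mem_insert_self _ _) h2
        convert h3 using 1
        ext z
        simp only [Finset.mem_insert, Finset.mem_union, Finset.mem_singleton]
        tauto
  · refine ⟨L.powersetCard 2, ?_, ?_⟩
    · rw [Finset.card_powersetCard]
      have := Nat.choose_two_right L.card
      have h1 := Nat.div_mul_cancel (Nat.even_mul_pred_self L.card).two_dvd
      rw [← this] at h1
      obtain ⟨n, hn⟩ : ∃ n, L.card = n + 2 := ⟨L.card - 2, by omega⟩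
      rw [hn] at h1 ⊢
      rw [show n + 2 - 1 = n + 1 by omega] at h1
      nlinarith
    · intro p hp
      obtain ⟨hpL, hp2⟩ := Finset.mem_powersetCard.1 hp
      refine ⟨hp2, fun z hz => ⟨((hL z).1 (hpL hz)).1, ((hL z).1 (hpL hz)).2.1⟩, ?_⟩
      have : Nonempty V := ⟨u⟩
      have hf : ∀ y ∈ L, ∃ w, G.Adj u w ∧ G.Adj w y := fun y hy => ((hL y).1 hy).2.2
      choose! f hf using hf
      obtain ⟨Q, hQ0, hQ2, hQadj⟩ := hQ (p.image f) (by
        intro z hz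
        obtain ⟨y, hy, rfl⟩ := Finset.mem_image.1 hz
        exact (hf y (hpL hy)).1) (Finset.card_image_le.trans hp2.le)
      refine ⟨Q, hQ2, hQadj, (hstar Q hQadj).of_subset ?_ ?_⟩
      · intro z hz
        simp only [Finset.mem_insert, Finset.mem_union] at hz ⊢
        tauto
      · intro z hz
        simp only [Finset.mem_insert, Finset.mem_union] at hz
        rcases hz with h | h | h
        · exact Or.inl (Finset.mem_insert.2 (Or.inl h))
        · exact Or.inr ⟨f z, Finset.mem_insert_of_mem (hQ0 (Finset.mem_image_of_mem f h)),
            (hf z (hpL h)).2⟩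
        · exact Or.inl (Finset.mem_insert_of_mem h)

end Hub

section TwoSpine

variable {V : Type*} {G : SimpleGraph V} {d : ℕ → ℕ} {k a : ℕ}
  {E N : Finset (Finset V)} {s : Finset V}

open scoped Classical

theorem IsFamily.degIn_first_eq {m : ℕ} (H : IsFamily G d m k E N) {M X Y : Finset V} {x : ℕ → V}
    (hc : IsCore G d m M x) (e : IsExt G M (x 1) (x m) (d 1 - 1) (d m - 1) s X Y) :
    degIn G s (x 1) = d 1 := by
  rw [e.degIn_first H.tree.2 H.deg.two_le hc]
  have := H.deg.first
  omega

theorem IsFamily.first_add_two (H : IsFamily G d 2 k E N) (hd2 : d 2 = 2) (hs : s ∈ E) :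
    d 1 + 2 = k := by
  obtain ⟨M, x, X, Y, hc, e⟩ := H.decomp s hs
  have hM : M = {x 1, x 2} := by
    ext y
    rw [Finset.mem_insert, Finset.mem_singleton]
    constructor
    · intro hy
      rcases hc.cover y hy with ⟨i, h1, h2, rfl⟩ | ⟨-, i, h1, h2, -⟩
      · obtain rfl | rfl : i = 1 ∨ i = 2 := by omega
        · exact Or.inl rfl
        · exact Or.inr rfl
      · omega
    · rintro (rfl | rfl)
      · exact hc.mem 1 le_rfl (by norm_num)
      · exact hc.mem 2 (by norm_num) le_rfl
  have h1 := e.card H.tree.2 le_rfl hc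
  rw [H.card_eq s hs, hM, Finset.card_pair (hc.first_ne_last le_rfl), hd2] at h1
  have := H.deg.first
  omega

theorem IsFamily.exists_targets [Fintype V] (H : IsFamily G d 2 k E N) (hd2 : d 2 = 2) (hd1 : d 1 = a + 1)
    (hk : k = a + 3) (ha : 7 ≤ a) {u : V} (hrad : ∃ w, 3 ≤ G.dist u w)
    (hu : a + 1 ≤ (nbrOut G ∅ u).card) :
    ∃ F T : Finset (Finset V), F.card ≤ 2 * T.card ∧ T ⊆ N ∧
      (∀ s ∈ E, (∃ M x X Y, IsCore G d 2 M x ∧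
        IsExt G M (x 1) (x 2) (d 1 - 1) (d 2 - 1) s X Y ∧ x 1 = u) → s ∈ F) ∧
      ∀ t ∈ T, 5 ≤ degIn G t u ∧ ∀ x, x ≠ u → degIn G t x ≤ 4 := by
  have hG := H.tree.2
  have : Nonempty V := ⟨u⟩
  obtain ⟨L, hL⟩ : ∃ L : Finset V,
      ∀ y, y ∈ L ↔ y ≠ u ∧ ¬ G.Adj u y ∧ ∃ w, G.Adj u w ∧ G.Adj w y :=
    ⟨Finset.univ.filter fun y => y ≠ u ∧ ¬ G.Adj u y ∧ ∃ w, G.Adj u w ∧ G.Adj w y,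
      fun y => by simp⟩
  obtain ⟨P, hPL, hP⟩ := exists_pairs H.tree hL (by omega) hrad
  have hQ : ∀ p ∈ P, ∃ Q : Finset V, Q.card = 2 ∧ (∀ z ∈ Q, G.Adj u z) ∧
    ConnIn G (insert u (p ∪ Q)) := fun p hp => (hP p hp).2.2
  choose! Q hQ2 hQadj hQconn using hQ
  have hf : ∀ y ∈ L, ∃ w, G.Adj u w ∧ G.Adj w y := fun y hy => ((hL y).1 hy).2.2
  choose! f hf using hf
  obtain ⟨e, he⟩ : ∃ e, (nbrOut G ∅ u).card = a + 1 + e := ⟨_, (Nat.add_sub_of_le hu).symm⟩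
  have hLf : ∀ y ∈ L, ∀ z ∈ ({f y} : Finset V), G.Adj u z := by
    intro y hy z hz
    rw [Finset.mem_singleton] at hz
    rw [hz]
    exact (hf y hy).1
  have hLy : ∀ y ∈ L, ∀ z ∈ ({y} : Finset V), z ≠ u ∧ ¬ G.Adj u z := by
    intro y hy z hz
    rw [Finset.mem_singleton] at hz
    rw [hz]
    exact ⟨((hL y).1 hy).1, ((hL y).1 hy).2.1⟩
  have h0 : ∀ z ∈ (∅ : Finset V), z ≠ u ∧ ¬ G.Adj u z := fun z hz => absurd hz (Finset.notMem_empty z)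
  have h0' : ∀ z ∈ (∅ : Finset V), G.Adj u z := fun z hz => absurd hz (Finset.notMem_empty z)
  have hT : ∀ t ∈ hubSets G u ∅ ∅ (a + 2) ∪ P.biUnion (fun p => hubSets G u p (Q p) (a - 2)),
      t.card = k ∧ ConnIn G t ∧ 5 ≤ degIn G t u ∧ degIn G t u ≠ a + 1 ∧
      ∀ x, x ≠ u → degIn G t x ≤ 4 := by
    intro t ht
    rw [Finset.mem_union, Finset.mem_biUnion] at ht
    rcases ht with ht | ⟨p, hp, ht⟩
    · have h1 := degIn_hub h0 h0' ht
      have h2 := card_of_mem_hubSets h0 h0' ht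
      rw [Finset.card_empty] at h1 h2
      refine ⟨by omega, connIn_hub (by simpa using connIn_singleton u) ht, by omega, by omega,
        fun x hx => (degIn_hub_le hG h0' ht hx).trans (by simp)⟩
    · have h1 := degIn_hub (hP p hp).2.1 (hQadj p hp) ht
      have h2 := card_of_mem_hubSets (hP p hp).2.1 (hQadj p hp) ht
      rw [hQ2 p hp] at h1 h2
      rw [(hP p hp).1] at h2
      refine ⟨by omega, connIn_hub (hQconn p hp) ht, by omega, by omega,
        fun x hx => (degIn_hub_le hG (hQadj p hp) ht hx).trans ?_⟩
      rw [(hP p hp).1]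
  refine ⟨L.biUnion fun y => hubSets G u {y} {f y} a,
    hubSets G u ∅ ∅ (a + 2) ∪ P.biUnion fun p => hubSets G u p (Q p) (a - 2), ?_, ?_, ?_,
    fun t ht => ⟨(hT t ht).2.2.1, (hT t ht).2.2.2.2⟩⟩
  · have hF : (L.biUnion fun y => hubSets G u {y} {f y} a).card ≤ L.card * (a + e).choose a := by
      refine Finset.card_biUnion_le_card_mul _ _ _ fun y hy => ?_
      rw [card_hubSets (hLy y hy) (hLf y hy), Finset.card_singleton, he,
        show a + 1 + e - 1 = a + e by omega]
    refine hF.trans ((mul_choose_le ha hPL).trans (Nat.mul_le_mul_left _ ?_))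
    rw [Finset.card_union_of_disjoint, card_hubSets h0 h0', Finset.card_empty, he, Nat.sub_zero,
      Finset.card_biUnion, Finset.sum_const_nat (m := (a + 1 + e - 2).choose (a - 2))]
    · intro p hp
      rw [card_hubSets (hP p hp).2.1 (hQadj p hp), hQ2 p hp, he]
    · intro p hp p' hp' hne
      rw [Function.onFun, Finset.disjoint_left]
      intro t ht ht'
      apply hne
      ext z
      rw [mem_of_mem_hubSets (hP p hp).2.1 (hQadj p hp) ht,
        mem_of_mem_hubSets (hP p' hp').2.1 (hQadj p' hp') ht']
    · rw [Finset.disjoint_left]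
      intro t ht ht'
      obtain ⟨p, hp, ht'⟩ := Finset.mem_biUnion.1 ht'
      have h1 := degIn_hub h0 h0' ht
      have h2 := degIn_hub (hP p hp).2.1 (hQadj p hp) ht'
      rw [hQ2 p hp] at h2
      rw [Finset.card_empty] at h1
      omega
  · intro t ht
    obtain ⟨h1, h2, h3, h4, h5⟩ := hT t ht
    refine H.mem_of_notMem t h2 h1 fun htE => ?_
    obtain ⟨M, x, X, Y, hc, ee⟩ := H.decomp t htE
    have h6 := H.degIn_first_eq hc ee
    by_cases hx : x 1 = u
    · rw [hx] at h6
      omega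
    · have := h5 _ hx
      omega
  · rintro s hs ⟨M, x, X, Y, hc, ee, rfl⟩
    have h12 := hc.adj 1 le_rfl (by norm_num)
    rw [show 1 + 1 = 2 by norm_num] at h12
    obtain ⟨y, rfl⟩ := Finset.card_eq_one.1 (ee.card_right.trans (by rw [hd2]))
    obtain ⟨hyM, hy2⟩ := ee.right y (Finset.mem_singleton_self y)
    have hy1 : y ≠ x 1 := by
      rintro rfl
      exact hyM (hc.mem 1 le_rfl (by norm_num))
    have hny : ¬ G.Adj (x 1) y := by
      intro h
      have h2 := (hc.conn le_rfl).eq_of_adj hG hyM (hc.mem 1 le_rfl (by norm_num))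
        (hc.mem 2 (by norm_num) le_rfl) h.symm hy2.symm
      exact hc.first_ne_last le_rfl h2
    have hyL : y ∈ L := (hL y).2 ⟨hy1, hny, x 2, h12, hy2⟩
    have hfy : f y = x 2 :=
      eq_of_common_adj hG hy1 (hf y hyL).1 h12 (hf y hyL).2.symm hy2.symm
    refine Finset.mem_biUnion.2 ⟨y, hyL, mem_hubSets.2 ⟨X, ?_, ?_, ?_⟩⟩
    · intro z hz
      refine ⟨(ee.left z hz).2, ?_⟩
      rw [Finset.mem_singleton, hfy]
      rintro rfl
      exact (ee.left _ hz).1 (hc.mem 2 (by norm_num) le_rfl)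
    · rw [ee.card_left, hd1, Nat.add_sub_cancel]
    · ext z
      rw [ee.mem_iff, hfy]
      simp only [Finset.mem_insert, Finset.mem_union, Finset.mem_singleton]
      constructor
      · rintro (h | h | h)
        · rcases hc.cover z h with ⟨i, h1, h2, rfl⟩ | ⟨-, i, h1, h2, -⟩
          · obtain rfl | rfl : i = 1 ∨ i = 2 := by omega
            · exact Or.inl rfl
            · exact Or.inr (Or.inr (Or.inl rfl))
          · omega
        · exact Or.inr (Or.inr (Or.inr h))
        · exact Or.inr (Or.inl h)
      · rintro (rfl | h | rfl | h)
        · exact Or.inl (hc.mem 1 le_rfl (by norm_num))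
        · exact Or.inr (Or.inr h)
        · exact Or.inl (hc.mem 2 (by norm_num) le_rfl)
        · exact Or.inr (Or.inl h)

theorem IsFamily.card_le_of_spine_two [Fintype V] (H : IsFamily G d 2 k E N) (hd2 : d 2 = 2) (hk : 10 ≤ k)
    (hrad : ∀ u, ∃ w, 3 ≤ G.dist u w) : E.card ≤ 2 * N.card := by
  rcases E.eq_empty_or_nonempty with rfl | ⟨s₀, hs₀⟩
  · simp
  have hdk := H.first_add_two hd2 hs₀
  obtain ⟨a, rfl⟩ : ∃ a, k = a + 3 := ⟨k - 3, by omega⟩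
  have : Nonempty V := by
    obtain ⟨M, x, -⟩ := H.decomp s₀ hs₀
    exact ⟨x 0⟩
  have hT := fun u => H.exists_targets (u := u) (a := a) hd2 (by omega) rfl (by omega) (hrad u)
  obtain ⟨C, hC⟩ : ∃ C : Finset V, ∀ u, u ∈ C ↔ a + 1 ≤ (nbrOut G ∅ u).card :=
    ⟨Finset.univ.filter fun u => a + 1 ≤ (nbrOut G ∅ u).card, fun u => by simp⟩
  choose! F T h1 h2 h3 h4 using hT
  refine (card_le_of_groups (E := E) (N := N) (C := C) (K := 2) (D := 1) (F := F) (T := T) ?_ ?_ ?_ ?_).trans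
    (by omega)
  · intro s hs
    obtain ⟨M, x, X, Y, hc, e⟩ := H.decomp s hs
    have h5 : a + 1 ≤ (nbrOut G ∅ (x 1)).card := by
      have h6 := H.degIn_first_eq hc e
      rw [show a + 1 = d 1 by omega, ← h6]
      refine Finset.card_le_card fun z hz => ?_
      exact mem_nbrOut.2 ⟨(Finset.mem_filter.1 hz).2, Finset.notMem_empty z⟩
    exact ⟨x 1, (hC _).2 h5, h3 _ h5 s hs ⟨M, x, X, Y, hc, e, rfl⟩⟩
  · exact fun u hu => h1 u ((hC u).1 hu)
  · exact fun u hu => h2 u ((hC u).1 hu)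
  · intro t ht C' hC' h
    rw [Finset.card_le_one]
    intro u hu u' hu'
    by_contra hne
    have h5 := (h4 u ((hC u).1 (hC' hu)) t (h u hu)).1
    have h6 := (h4 u' ((hC u').1 (hC' hu')) t (h u' hu')).2 u hne
    omega

end TwoSpine

theorem IsFamily.card_le_of_radius {V : Type*} [Fintype V] {G : SimpleGraph V} {d : ℕ → ℕ}
    {m k : ℕ} {E N : Finset (Finset V)} (H : IsFamily G d m k E N) (hk : 10 ≤ k)
    (hrad : ∀ u, ∃ w, 3 ≤ G.dist u w) {r₁ r₂ : V}
    (hr : ∀ s ∈ E, (∀ y ∈ s, 2 ≤ G.dist r₁ y) ∨ (∀ y ∈ s, 2 ≤ G.dist r₂ y)) :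
    E.card ≤ 384 * N.card := by
  by_cases hpos : 3 ≤ m ∨ (3 ≤ d 1 ∧ 3 ≤ d m)
  · exact H.card_le hpos hr
  · have h1 := H.deg.first
    have h2 := H.deg.last
    have h3 := H.deg.two_le
    obtain rfl : m = 2 := by omega
    rcases (by omega : d 2 = 2 ∨ d 1 = 2) with h | h
    · exact (H.card_le_of_spine_two h hk hrad).trans (by omega)
    · exact (H.reverse.card_le_of_spine_two (by simpa using h) hk hrad).trans (by omega)

theorem ConnIn.dist_lt_card {V : Type*} {G : SimpleGraph V} {s : Finset V} (hs : ConnIn G s)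
    {y z : V} (hy : y ∈ s) (hz : z ∈ s) : G.dist y z < s.card := by
  classical
  obtain ⟨p, hp, hps⟩ := hs.exists_walk hy hz
  have h1 := G.dist_le p
  have h2 : p.support.toFinset.card ≤ s.card :=
    Finset.card_le_card fun w hw => hps w (List.mem_toFinset.1 hw)
  rw [List.toFinset_card_of_nodup hp.support_nodup, Walk.length_support] at h2
  omega

section Map

variable {V W : Type*} {G : SimpleGraph V} {S : SimpleGraph W} {d : ℕ → ℕ} {m j l : ℕ}
  {M s X Y : Finset W} {x : ℕ → W}

open scoped Classical

theorem degIn_map (g : S ↪g G) (s : Finset W) (w : W) :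
    degIn G (s.map g.toEmbedding) (g w) = degIn S s w := by
  unfold degIn
  rw [Finset.filter_map, Finset.card_map]
  congr 1
  ext z
  simp

theorem sqDeg_map (g : S ↪g G) (s : Finset W) : sqDeg G (s.map g.toEmbedding) = sqDeg S s := by
  unfold sqDeg
  rw [Finset.sum_map]
  exact Finset.sum_congr rfl fun w _ => by
    rw [RelEmbedding.coe_toEmbedding, degIn_map g s w]

theorem wiener_map (hG : G.IsTree) (hS : S.IsTree) (g : S ↪g G) (s : Finset W) :
    wiener G (s.map g.toEmbedding) = wiener S s := by
  unfold wiener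
  rw [Finset.sum_map]
  refine Finset.sum_congr rfl fun w _ => ?_
  rw [Finset.sum_map]
  refine Finset.sum_congr rfl fun w' _ => ?_
  obtain ⟨p, hp, hl⟩ := hS.1.exists_path_of_dist w w'
  have := length_eq_dist_of_isPath hG (hp.map (f := g.toHom) g.injective)
  rw [Walk.length_map, hl] at this
  exact this.symm

theorem IsCore.map (g : S ↪g G) (h : IsCore S d m M x) :
    IsCore G d m (M.map g.toEmbedding) fun i => g (x i) where
  inj := fun i hi j hj hij => h.inj hi hj (g.injective hij)
  mem := fun i h1 h2 => Finset.mem_map_of_mem _ (h.mem i h1 h2)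
  adj := fun i h1 h2 => g.map_adj_iff.2 (h.adj i h1 h2)
  deg_first := (degIn_map g M _).trans h.deg_first
  deg_last := (degIn_map g M _).trans h.deg_last
  deg_mid := fun i h1 h2 => (degIn_map g M _).trans (h.deg_mid i h1 h2)
  cover := by
    intro y hy
    obtain ⟨w, hw, rfl⟩ := Finset.mem_map.1 hy
    rcases h.cover w hw with ⟨i, h1, h2, rfl⟩ | ⟨h1, i, h2, h3, h4⟩
    · exact Or.inl ⟨i, h1, h2, rfl⟩
    · exact Or.inr ⟨(degIn_map g M w).trans h1, i, h2, h3, g.map_adj_iff.2 h4⟩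

theorem IsExt.map (g : S ↪g G) {u w : W} (h : IsExt S M u w j l s X Y) :
    IsExt G (M.map g.toEmbedding) (g u) (g w) j l (s.map g.toEmbedding) (X.map g.toEmbedding)
      (Y.map g.toEmbedding) where
  left := by
    intro y hy
    obtain ⟨z, hz, rfl⟩ := Finset.mem_map.1 hy
    rw [Finset.mem_map']
    exact ⟨(h.left z hz).1, g.map_adj_iff.2 (h.left z hz).2⟩
  right := by
    intro y hy
    obtain ⟨z, hz, rfl⟩ := Finset.mem_map.1 hy
    rw [Finset.mem_map']
    exact ⟨(h.right z hz).1, g.map_adj_iff.2 (h.right z hz).2⟩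
  card_left := (Finset.card_map _).trans h.card_left
  card_right := (Finset.card_map _).trans h.card_right
  mem_iff := by
    intro y
    simp only [Finset.mem_map]
    constructor
    · rintro ⟨z, hz, rfl⟩
      rcases (h.mem_iff z).1 hz with h1 | h1 | h1
      · exact Or.inl ⟨z, h1, rfl⟩
      · exact Or.inr (Or.inl ⟨z, h1, rfl⟩)
      · exact Or.inr (Or.inr ⟨z, h1, rfl⟩)
    · rintro (⟨z, h1, rfl⟩ | ⟨z, h1, rfl⟩ | ⟨z, h1, rfl⟩)
      · exact ⟨z, (h.mem_iff z).2 (Or.inl h1), rfl⟩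
      · exact ⟨z, (h.mem_iff z).2 (Or.inr (Or.inl h1)), rfl⟩
      · exact ⟨z, (h.mem_iff z).2 (Or.inr (Or.inr h1)), rfl⟩

theorem exists_embedding_of_iso [Fintype W] {t : Finset V}
    (h : Nonempty ((G.induce (t : Set V)) ≃g S)) :
    ∃ g : S ↪g G, t = Finset.univ.map g.toEmbedding := by
  obtain ⟨f⟩ := h
  refine ⟨f.symm.toEmbedding.trans (SimpleGraph.Embedding.induce (t : Set V)), ?_⟩
  ext y
  simp only [Finset.mem_map, Finset.mem_univ, true_and]
  constructor
  · intro hy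
    refine ⟨f ⟨y, hy⟩, ?_⟩
    simp
  · rintro ⟨w, rfl⟩
    exact (f.symm w).2

end Map

/-- The tree `S` has the internal vertices `x 1, …, x m`, which form a path. -/
structure IsSpine {W : Type*} (S : SimpleGraph W) (m : ℕ) (x : ℕ → W) : Prop where
  tree : S.IsTree
  two_le : 2 ≤ m
  inj : Set.InjOn x (Set.Icc 1 m)
  ndeg_ne_one : ∀ w, ndeg S w ≠ 1 ↔ ∃ i ∈ Set.Icc 1 m, w = x i
  adj : ∀ i, 1 ≤ i → i < m → S.Adj (x i) (x (i + 1))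

section Spine

variable {W : Type*} {S : SimpleGraph W} {m : ℕ} {x : ℕ → W}

open scoped Classical

theorem degIn_univ [Fintype W] (w : W) : degIn S Finset.univ w = ndeg S w := by
  unfold degIn ndeg
  rw [← Set.ncard_coe_finset]
  congr 1
  ext z
  simp

theorem IsSpine.eq_add_one_of_adj (h : IsSpine S m x) {i j : ℕ} (hi : 1 ≤ i) (hij : i < j)
    (hj : j ≤ m) (hadj : S.Adj (x i) (x j)) : j = i + 1 := by
  have hc := connIn_chain h.adj (i + 1) (by omega) (j - (i + 1)) (by omega)
  have hmem : ∀ l, i + 1 ≤ l → l ≤ j →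
      x l ∈ (Finset.Icc (i + 1) (i + 1 + (j - (i + 1)))).image x := fun l h1 h2 =>
    Finset.mem_image_of_mem _ (Finset.mem_Icc.2 ⟨h1, by omega⟩)
  have h1 : x (i + 1) = x j := by
    refine hc.eq_of_adj h.tree.2 (x := x i) ?_ (hmem _ le_rfl hij) (hmem _ hij le_rfl)
      (h.adj i hi (by omega)) hadj
    intro h2
    obtain ⟨l, hl, hle⟩ := Finset.mem_image.1 h2
    rw [Finset.mem_Icc] at hl
    have := h.inj ⟨by omega, by omega⟩ ⟨by omega, by omega⟩ hle
    omega
  exact (h.inj ⟨by omega, by omega⟩ ⟨by omega, by omega⟩ h1).symm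

theorem IsSpine.cases_of_adj (h : IsSpine S m x) {i j : ℕ} (hi : 1 ≤ i) (him : i ≤ m) (hj : 1 ≤ j)
    (hjm : j ≤ m) (hadj : S.Adj (x i) (x j)) : j = i + 1 ∨ i = j + 1 := by
  rcases lt_trichotomy i j with h1 | rfl | h1
  · exact Or.inl (h.eq_add_one_of_adj hi h1 hjm hadj)
  · exact absurd hadj (S.loopless.irrefl _)
  · exact Or.inr (h.eq_add_one_of_adj hj h1 him hadj.symm)

theorem eq_of_ndeg_eq_one {w a b : W} (h : ndeg S w = 1) (ha : S.Adj w a) (hb : S.Adj w b) :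
    a = b := by
  obtain ⟨c, hc⟩ := Set.ncard_eq_one.1 h
  have h1 : a ∈ S.neighborSet w := ha
  have h2 : b ∈ S.neighborSet w := hb
  rw [hc, Set.mem_singleton_iff] at h1 h2
  rw [h1, h2]

theorem IsSpine.exists_adj_of_ndeg_eq_one (h : IsSpine S m x) {w : W} (hw : ndeg S w = 1) :
    ∃ i, 1 ≤ i ∧ i ≤ m ∧ S.Adj w (x i) := by
  have hm := h.two_le
  have h1 : ndeg S (x 1) ≠ 1 := (h.ndeg_ne_one _).2 ⟨1, ⟨le_rfl, by omega⟩, rfl⟩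
  have hne : ∀ y, ndeg S y = 1 → S.dist (x 1) y ≠ 0 := by
    intro y hy h2
    rw [h.tree.1.dist_eq_zero_iff] at h2
    rw [← h2] at hy
    exact h1 hy
  obtain ⟨p, hp, hpd⟩ := exists_adj_dist_succ h.tree.1 (hne w hw)
  by_cases hp1 : ndeg S p = 1
  · obtain ⟨q, hq, hqd⟩ := exists_adj_dist_succ h.tree.1 (hne p hp1)
    rw [eq_of_ndeg_eq_one hp1 hq hp.symm] at hqd
    omega
  · obtain ⟨i, hi, rfl⟩ := (h.ndeg_ne_one p).1 hp1
    exact ⟨i, hi.1, hi.2, hp⟩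

theorem IsSpine.reverse (h : IsSpine S m x) : IsSpine S m fun i => x (m + 1 - i) where
  tree := h.tree
  two_le := h.two_le
  inj := by
    rintro i ⟨hi, hi'⟩ j ⟨hj, hj'⟩ hij
    have := h.inj ⟨by omega, by omega⟩ ⟨by omega, by omega⟩ hij
    omega
  ndeg_ne_one := by
    intro w
    rw [h.ndeg_ne_one]
    constructor
    · rintro ⟨i, ⟨hi, hi'⟩, rfl⟩
      exact ⟨m + 1 - i, ⟨by omega, by omega⟩, by rw [show m + 1 - (m + 1 - i) = i by omega]⟩
    · rintro ⟨i, ⟨hi, hi'⟩, rfl⟩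
      exact ⟨m + 1 - i, ⟨by omega, by omega⟩, rfl⟩
  adj := by
    intro i hi him
    have := h.adj (m - i) (by omega) (by omega)
    rw [show m - i + 1 = m + 1 - i by omega] at this
    rw [show m + 1 - (i + 1) = m - i by omega]
    exact this.symm

theorem IsSpine.two_le_ndeg [Finite W] (h : IsSpine S m x) {i : ℕ} (hi : 1 ≤ i) (him : i ≤ m) :
    2 ≤ ndeg S (x i) := by
  have h1 : ndeg S (x i) ≠ 1 := (h.ndeg_ne_one _).2 ⟨i, ⟨hi, him⟩, rfl⟩
  have h2 : ndeg S (x i) ≠ 0 := by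
    have hm := h.two_le
    obtain ⟨y, hy⟩ : ∃ y, S.Adj (x i) y := by
      rcases Nat.lt_or_ge i m with h3 | h3
      · exact ⟨_, h.adj i hi h3⟩
      · have := h.adj (i - 1) (by omega) (by omega)
        rw [Nat.sub_add_cancel hi] at this
        exact ⟨_, this.symm⟩
    exact Set.ncard_ne_zero_of_mem (show y ∈ S.neighborSet (x i) from hy)
  omega

theorem IsSpine.eq_second [Finite W] (h : IsSpine S m x) {y : W} (hadj : S.Adj (x 1) y)
    (hy : ndeg S y ≠ 1) : y = x 2 := by
  obtain ⟨i, ⟨hi, him⟩, rfl⟩ := (h.ndeg_ne_one y).1 hy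
  rcases h.cases_of_adj le_rfl (by omega) hi him hadj with h1 | h1
  · rw [h1]
  · omega

/-- The leaves adjacent to the first spine vertex. -/
theorem IsSpine.card_leaves [Fintype W] (h : IsSpine S m x) :
    (Finset.univ.filter fun w => S.Adj (x 1) w ∧ ndeg S w = 1).card = ndeg S (x 1) - 1 := by
  have hm := h.two_le
  have h2 : ndeg S (x 2) ≠ 1 := (h.ndeg_ne_one _).2 ⟨2, ⟨by norm_num, hm⟩, rfl⟩
  rw [← degIn_univ (S := S) (x 1)]
  unfold degIn
  rw [← Finset.card_erase_of_mem (a := x 2)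
    (Finset.mem_filter.2 ⟨Finset.mem_univ _, h.adj 1 le_rfl hm⟩)]
  congr 1
  ext z
  simp only [Finset.mem_filter, Finset.mem_univ, true_and, Finset.mem_erase]
  constructor
  · rintro ⟨h3, h4⟩
    refine ⟨?_, h3⟩
    rintro rfl
    exact h2 h4
  · rintro ⟨h3, h4⟩
    refine ⟨h4, ?_⟩
    by_contra h5
    exact h3 (h.eq_second h4 h5)

theorem IsSpine.degIn_first [Fintype W] (h : IsSpine S m x) {M : Finset W}
    (hM : ∀ w, w ∈ M ↔ ¬ (S.Adj (x 1) w ∧ ndeg S w = 1) ∧ ¬ (S.Adj (x m) w ∧ ndeg S w = 1)) :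
    degIn S M (x 1) = 1 := by
  have hm := h.two_le
  have h2 : ndeg S (x 2) ≠ 1 := (h.ndeg_ne_one _).2 ⟨2, ⟨by norm_num, hm⟩, rfl⟩
  unfold degIn
  rw [Finset.card_eq_one]
  refine ⟨x 2, ?_⟩
  ext z
  rw [Finset.mem_filter, Finset.mem_singleton, hM]
  constructor
  · rintro ⟨⟨h3, -⟩, h4⟩
    exact h.eq_second h4 fun h5 => h3 ⟨h4, h5⟩
  · rintro rfl
    exact ⟨⟨fun h3 => h2 h3.2, fun h3 => h2 h3.2⟩, h.adj 1 le_rfl hm⟩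

theorem IsSpine.exists_isCore [Fintype W] (h : IsSpine S m x) :
    ∃ M X Y, IsCore S (fun i => ndeg S (x i)) m M x ∧
      IsExt S M (x 1) (x m) (ndeg S (x 1) - 1) (ndeg S (x m) - 1) Finset.univ X Y := by
  have hm := h.two_le
  obtain ⟨M, hM⟩ : ∃ M : Finset W, ∀ w, w ∈ M ↔
      ¬ (S.Adj (x 1) w ∧ ndeg S w = 1) ∧ ¬ (S.Adj (x m) w ∧ ndeg S w = 1) :=
    ⟨Finset.univ.filter fun w => ¬ (S.Adj (x 1) w ∧ ndeg S w = 1) ∧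
      ¬ (S.Adj (x m) w ∧ ndeg S w = 1), fun w => by simp⟩
  have hmem : ∀ i, 1 ≤ i → i ≤ m → x i ∈ M := by
    intro i hi him
    have h1 : ndeg S (x i) ≠ 1 := (h.ndeg_ne_one _).2 ⟨i, ⟨hi, him⟩, rfl⟩
    exact (hM _).2 ⟨fun h2 => h1 h2.2, fun h2 => h1 h2.2⟩
  refine ⟨M, Finset.univ.filter fun w => S.Adj (x 1) w ∧ ndeg S w = 1,
    Finset.univ.filter fun w => S.Adj (x m) w ∧ ndeg S w = 1,
    ⟨h.inj, hmem, h.adj, h.degIn_first hM, ?_, ?_, ?_⟩, ⟨?_, ?_, h.card_leaves, ?_, ?_⟩⟩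
  · have := h.reverse.degIn_first (M := M) fun w => by
      rw [hM w]
      simp only [Nat.add_sub_cancel, show m + 1 - m = 1 by omega]
      tauto
    simpa using this
  · intro i hi him
    rw [← degIn_univ]
    unfold degIn
    congr 1
    ext z
    simp only [Finset.mem_filter, Finset.mem_univ, true_and, and_iff_right_iff_imp]
    intro hz
    have hne : ∀ j, 1 ≤ j → j ≤ m → j ≠ i → ¬ (S.Adj (x j) z ∧ ndeg S z = 1) := by
      rintro j hj hjm hji ⟨h1, h2⟩
      exact hji (h.inj ⟨hj, hjm⟩ ⟨by omega, by omega⟩ (eq_of_ndeg_eq_one h2 h1.symm hz.symm))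
    exact (hM z).2 ⟨hne 1 le_rfl (by omega) (by omega), hne m (by omega) le_rfl (by omega)⟩
  · intro y hy
    by_cases h1 : ndeg S y = 1
    · obtain ⟨i, hi, him, hadj⟩ := h.exists_adj_of_ndeg_eq_one h1
      have h2 := (hM y).1 hy
      have hi1 : i ≠ 1 := by
        rintro rfl
        exact h2.1 ⟨hadj.symm, h1⟩
      have him' : i ≠ m := by
        rintro rfl
        exact h2.2 ⟨hadj.symm, h1⟩
      refine Or.inr ⟨?_, i, by omega, by omega, hadj⟩
      unfold degIn
      rw [Finset.card_eq_one]
      refine ⟨x i, ?_⟩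
      ext z
      rw [Finset.mem_filter, Finset.mem_singleton]
      constructor
      · exact fun hz => eq_of_ndeg_eq_one h1 hz.2 hadj
      · rintro rfl
        exact ⟨hmem i hi him, hadj⟩
    · obtain ⟨i, hi, rfl⟩ := (h.ndeg_ne_one y).1 h1
      exact Or.inl ⟨i, hi.1, hi.2, rfl⟩
  · intro y hy
    rw [Finset.mem_filter] at hy
    exact ⟨fun h1 => ((hM y).1 h1).1 hy.2, hy.2.1⟩
  · intro y hy
    rw [Finset.mem_filter] at hy
    exact ⟨fun h1 => ((hM y).1 h1).2 hy.2, hy.2.1⟩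
  · have := h.reverse.card_leaves
    simpa using this
  · intro y
    simp only [Finset.mem_univ, true_iff, hM, Finset.mem_filter, true_and]
    tauto

theorem IsSpine.add_two_lt_card [Fintype W] (h : IsSpine S m x)
    (hd : SpineDegrees (fun i => ndeg S (x i)) m) : m + 2 < Fintype.card W := by
  have hm := h.two_le
  obtain ⟨M, X, Y, hc, e⟩ := h.exists_isCore
  have h1 := e.card h.tree.2 hm hc
  rw [Finset.card_univ] at h1
  have h2 : ((Finset.Icc 1 m).image x).card = m := by
    rw [Finset.card_image_of_injOn (by rw [Finset.coe_Icc]; exact h.inj), Nat.card_Icc]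
    omega
  have h3 : (Finset.Icc 1 m).image x ⊆ M := by
    intro y hy
    obtain ⟨i, hi, rfl⟩ := Finset.mem_image.1 hy
    rw [Finset.mem_Icc] at hi
    exact hc.mem i hi.1 hi.2
  have h4 := Finset.card_le_card h3
  have h5 : 2 ≤ ndeg S (x 1) := hd.first
  have h6 : 2 ≤ ndeg S (x m) := hd.last
  by_contra hlt
  have h7 : (Finset.Icc 1 m).image x = M := Finset.eq_of_subset_of_card_le h3 (by omega)
  obtain ⟨i, hi, him, hne⟩ := hd.not_path
  have hne : ndeg S (x i) ≠ 2 := hne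
  have hi1 : i ≠ 1 := by
    rintro rfl
    omega
  have him' : i ≠ m := by
    rintro rfl
    omega
  have h8 : degIn S M (x i) = ndeg S (x i) := hc.deg_mid i (by omega) (by omega)
  have h9 := h.two_le_ndeg hi him
  have h10 : degIn S M (x i) ≤ ({x (i - 1), x (i + 1)} : Finset W).card := by
    refine Finset.card_le_card fun z hz => ?_
    rw [Finset.mem_filter, ← h7, Finset.mem_image] at hz
    obtain ⟨⟨j, hj, rfl⟩, hz⟩ := hz
    rw [Finset.mem_Icc] at hj
    rw [Finset.mem_insert, Finset.mem_singleton]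
    rcases h.cases_of_adj hi him hj.1 hj.2 hz with h11 | h11
    · exact Or.inr (by rw [h11])
    · exact Or.inl (by rw [h11, Nat.add_sub_cancel])
  have := Finset.card_le_two (a := x (i - 1)) (b := x (i + 1))
  omega

end Spine

theorem IsSpine.isFamily {V W : Type*} [Fintype W] {S : SimpleGraph W} {G : SimpleGraph V}
    {m : ℕ} {x : ℕ → W} (h : IsSpine S m x) (hG : G.IsTree)
    (hd : SpineDegrees (fun i => ndeg S (x i)) m) {E N : Finset (Finset V)}
    (hE : ∀ s ∈ E, ∃ g : S ↪g G, s = Finset.univ.map g.toEmbedding)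
    (hN : ∀ t, ConnIn G t → t.card = Fintype.card W → t ∉ E → t ∈ N) :
    IsFamily G (fun i => ndeg S (x i)) m (Fintype.card W) E N where
  tree := hG
  deg := hd
  decomp := by
    intro s hs
    obtain ⟨g, rfl⟩ := hE s hs
    obtain ⟨M, X, Y, hc, e⟩ := h.exists_isCore
    exact ⟨_, _, _, _, hc.map g, e.map g⟩
  sqDeg_eq := by
    intro s hs t ht
    obtain ⟨g, rfl⟩ := hE s hs
    obtain ⟨g', rfl⟩ := hE t ht
    rw [sqDeg_map, sqDeg_map]
  wiener_eq := by
    intro s hs t ht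
    obtain ⟨g, rfl⟩ := hE s hs
    obtain ⟨g', rfl⟩ := hE t ht
    rw [wiener_map hG h.tree, wiener_map hG h.tree]
  card_eq := by
    intro s hs
    obtain ⟨g, rfl⟩ := hE s hs
    rw [Finset.card_map, Finset.card_univ]
  lt_card := h.add_two_lt_card hd
  mem_of_notMem := hN

theorem IsSpine.embCount_le {V W : Type*} [Fintype V] [Fintype W] {S : SimpleGraph W}
    {G : SimpleGraph V} {m : ℕ} {x : ℕ → W} (h : IsSpine S m x) (hG : G.IsTree)
    (hd : SpineDegrees (fun i => ndeg S (x i)) m) (hk : 10 ≤ Fintype.card W)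
    (hrad : ∀ u : V, ∃ w : V, 4 * Fintype.card W ≤ G.dist u w) :
    1000 * embCount G S (Fintype.card W) ≤ 999 * subtreeCount G (Fintype.card W) := by
  classical
  set k := Fintype.card W with hkdef
  obtain ⟨E, hE⟩ : ∃ E : Finset (Finset V),
      ∀ s, s ∈ E ↔ s.card = k ∧ Nonempty ((G.induce (s : Set V)) ≃g S) :=
    ⟨Finset.univ.filter fun s => s.card = k ∧ Nonempty ((G.induce (s : Set V)) ≃g S),
      fun s => by simp⟩
  obtain ⟨C, hC⟩ : ∃ C : Finset (Finset V), ∀ s, s ∈ C ↔ s.card = k ∧ ConnIn G s :=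
    ⟨Finset.univ.filter fun s => s.card = k ∧ ConnIn G s, fun s => by simp⟩
  have hEcard : embCount G S k = E.card := by
    unfold embCount
    rw [← Set.ncard_coe_finset]
    congr 1
    ext s
    exact (hE s).symm
  have hCcard : subtreeCount G k = C.card := by
    unfold subtreeCount
    rw [← Set.ncard_coe_finset]
    congr 1
    ext s
    exact (hC s).symm
  have hEC : E ⊆ C := by
    intro s hs
    obtain ⟨h1, ⟨f⟩⟩ := (hE s).1 hs
    exact (hC s).2 ⟨h1, f.connected_iff.2 h.tree.1⟩
  have H : IsFamily G (fun i => ndeg S (x i)) m k E (C \ E) :=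
    h.isFamily hG hd (fun s hs => exists_embedding_of_iso ((hE s).1 hs).2)
      fun t h1 h2 h3 => Finset.mem_sdiff.2 ⟨(hC t).2 ⟨h2, h1⟩, h3⟩
  obtain ⟨r₁⟩ := hG.1.nonempty
  obtain ⟨r₂, hr⟩ := hrad r₁
  have hfar : ∀ s ∈ E, (∀ y ∈ s, 2 ≤ G.dist r₁ y) ∨ (∀ y ∈ s, 2 ≤ G.dist r₂ y) := by
    intro s hs
    by_contra! hcon
    obtain ⟨⟨y, hy, hy1⟩, z, hz, hz1⟩ := hcon
    obtain ⟨h1, h2⟩ := (hC s).1 (hEC hs)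
    have h3 := h2.dist_lt_card hy hz
    have h4 := hG.1.dist_triangle (u := r₁) (v := y) (w := r₂)
    have h5 := hG.1.dist_triangle (u := y) (v := z) (w := r₂)
    rw [G.dist_comm (u := z)] at h5
    omega
  have h1 := H.card_le_of_radius hk
    (fun u => (hrad u).imp fun w hw => (by omega : 3 ≤ 4 * k).trans hw) hfar
  rw [Finset.card_sdiff_of_subset hEC] at h1
  rw [hEcard, hCcard]
  omega

theorem IsSpine.spineDegrees {W : Type*} [Finite W] {S : SimpleGraph W} {m : ℕ} {x : ℕ → W}
    (h : IsSpine S m x) (hpath : ¬ IsPathlike S)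
    (hm : m = 2 ∨ (3 ≤ m ∧ ndeg S (x 2) = 2 ∧ ndeg S (x (m - 1)) = 2)) :
    SpineDegrees (fun i => ndeg S (x i)) m where
  two_le := h.two_le
  first := h.two_le_ndeg le_rfl (by have := h.two_le; omega)
  last := h.two_le_ndeg (by have := h.two_le; omega) le_rfl
  mid := fun i h1 h2 => h.two_le_ndeg h1.le h2.le
  second := fun h3 => by
    rcases hm with rfl | hm
    · omega
    · exact hm.2.1
  penult := fun h3 => by
    rcases hm with rfl | hm
    · omega
    · exact hm.2.2
  not_path := by
    unfold IsPathlike at hpath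
    push Not at hpath
    obtain ⟨w, hw⟩ := hpath
    obtain ⟨i, hi, rfl⟩ := (h.ndeg_ne_one w).1 (by omega)
    exact ⟨i, hi.1, hi.2, hw.ne'⟩

/-- Let S be a caterpillar with k ≥ 10 vertices that is not a path, whose
internal vertices form the path v 1, ..., v m.  Assume m = 2, or m ≥ 3 and the degrees of
v 2 and v (m-1) in S both equal 2.  If T is a tree with radius at least 4k, then
d(S,T) ≤ 1 - 10^(-3). -/
theorem density_le_of_caterpillar_ends {V W : Type*} [Fintype V] [Fintype W]
    (k : ℕ) (hk : 10 ≤ k)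
    (S : SimpleGraph W) (hcard : Fintype.card W = k)
    (hcat : IsCaterpillar S) (hpath : ¬ IsPathlike S)
    (m : ℕ) (v : ℕ → W)
    (hinj : Set.InjOn v (Set.Icc 1 m))
    (henum : ∀ w : W, ndeg S w ≠ 1 ↔ ∃ i ∈ Set.Icc 1 m, w = v i)
    (hchain : ∀ i : ℕ, 1 ≤ i → i < m → S.Adj (v i) (v (i + 1)))
    (hm : m = 2 ∨ (3 ≤ m ∧ ndeg S (v 2) = 2 ∧ ndeg S (v (m - 1)) = 2))
    (T : SimpleGraph V) (hT : T.IsTree)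
    (hrad : ∀ x : V, ∃ w : V, 4 * k ≤ T.dist x w) :
    density S T ≤ 1 - (1 / 10 : ℝ) ^ 3 := by

  have h : IsSpine S m v := ⟨hcat.1, by omega, hinj, henum, hchain⟩
  subst hcard
  have h1 := h.embCount_le hT (h.spineDegrees hpath hm) hk hrad
  have h2 : (1000 : ℝ) * embCount T S (Fintype.card W) ≤
      999 * subtreeCount T (Fintype.card W) := by exact_mod_cast h1
  unfold density
  rcases (Nat.cast_nonneg (α := ℝ) (subtreeCount T (Fintype.card W))).eq_or_lt with h3 | h3
  · rw [← h3, div_zero]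
    norm_num
  · rw [div_le_iff₀ h3]
    norm_num
    linarith
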